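/- Let ℓ be a prime and let K be a function field over an algebraically closed field k with char k ≠ ℓ and trdeg(K|k) ≥ 2. Let r ≥ 2 be an integer and let A be a subgroup of k^M_1(K). Then A ∈ 𝔊^r(K|k) if and only if the following holds: A satisfies conditions (a) and (b) below and every subgroup B of k^M_1(K) with A ⊆ B satisfying (a) and (b) equals A, where (a) B is generated by a collection of rational subgroups of k^M_1(K), and (b) dim^M_K(B) = r. -/

import Mathlib

/-! Common definitions: mod-ℓ Milnor K-theory, K^×/(K^×)^ℓ, Ω_K, relative algebraic
closure, transcendence degree predicates, discrete valuations, etc. -/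

noncomputable section

open scoped TensorProduct

universe u v

/-- The `n`-fold tensor power (over `ℤ`) of the multiplicative group `Kˣ`,
written additively. -/
abbrev MilnorPre (n : ℕ) (K : Type*) [Field K] : Type _ :=
  PiTensorProduct ℤ (fun _ : Fin n => Additive Kˣ)

/-- The submodule of Steinberg relations: generated by all `a₁ ⊗ ⋯ ⊗ aₙ`
with `aᵢ + aⱼ = 1` for some `i < j`. -/
def SteinbergRel (n : ℕ) (K : Type*) [Field K] : Submodule ℤ (MilnorPre n K) :=
  Submodule.span ℤ
    {x | ∃ a : Fin n → Kˣ,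
      (∃ i j : Fin n, i < j ∧ ((a i : K) + (a j : K) = 1)) ∧
        x = PiTensorProduct.tprod ℤ (fun i => Additive.ofMul (a i))}

/-- The `n`-th Milnor K-group `K^M_n(K)`: the quotient of the `n`-fold tensor
power of `K^×` by the Steinberg relations. -/
abbrev MilnorK (n : ℕ) (K : Type*) [Field K] : Type _ :=
  MilnorPre n K ⧸ SteinbergRel n K

/-- The mod-`ℓ` Milnor K-group `k^M_n(K) = K^M_n(K)/ℓ`. -/
abbrev MilnorKMod (ℓ n : ℕ) (K : Type*) [Field K] : Type _ :=
  MilnorK n K ⧸ LinearMap.range ((ℓ : ℤ) • (LinearMap.id : MilnorK n K →ₗ[ℤ] MilnorK n K))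

/-- The symbol `{a₁, …, aₙ}` in `k^M_n(K)`. -/
def milnorSymbol (ℓ : ℕ) {n : ℕ} {K : Type*} [Field K] (a : Fin n → Kˣ) :
    MilnorKMod ℓ n K :=
  Submodule.Quotient.mk (Submodule.Quotient.mk
    (PiTensorProduct.tprod ℤ (fun i => Additive.ofMul (a i))))

/-- `k^M_1(K) = K^×/(K^×)^ℓ`, written multiplicatively. -/
abbrev K1 (ℓ : ℕ) (K : Type*) [Field K] : Type _ :=
  Kˣ ⧸ (powMonoidHom ℓ : Kˣ →* Kˣ).range

/-- The projection `K^× → K^×/(K^×)^ℓ`. -/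
def K1proj (ℓ : ℕ) (K : Type*) [Field K] : Kˣ →* K1 ℓ K :=
  QuotientGroup.mk' _

/-- The subgroup of `Kˣ` consisting of the units lying in an intermediate field `L`. -/
def fieldUnits {k K : Type*} [Field k] [Field K] [Algebra k K]
    (L : IntermediateField k K) : Subgroup Kˣ where
  carrier := {x : Kˣ | (x : K) ∈ L}
  one_mem' := by simpa using one_mem L
  mul_mem' := by
    intro a b ha hb
    simpa using mul_mem ha hb
  inv_mem' := by
    intro a ha
    simpa using inv_mem (show (a : K) ∈ L from ha)

/-- `Ω_K(L)`: the image of `L^×` in `K^×/(K^×)^ℓ`. -/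
def Omega (ℓ : ℕ) {k K : Type*} [Field k] [Field K] [Algebra k K]
    (L : IntermediateField k K) : Subgroup (K1 ℓ K) :=
  (fieldUnits L).map (K1proj ℓ K)

/-- A subextension `L` of `K|k` is relatively algebraically closed in `K` if every
element of `K` algebraic over `L` lies in `L`. -/
def RelAlgClosed {k K : Type*} [Field k] [Field K] [Algebra k K]
    (L : IntermediateField k K) : Prop :=
  ∀ x : K, IsAlgebraic L x → x ∈ L

/-- `K` is a function field over `k`: a finitely generated field extension. -/
def IsFunctionField (k K : Type*) [Field k] [Field K] [Algebra k K] : Prop :=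
  ∃ s : Finset K, IntermediateField.adjoin k (s : Set K) = ⊤

/-- `trdeg(K|k) = d`: there is a transcendence basis indexed by `Fin d`. -/
def HasTrdeg (k : Type*) (K : Type*) [Field k] [Field K] [Algebra k K] (d : ℕ) : Prop :=
  ∃ x : Fin d → K, IsTranscendenceBasis k x

/-- `trdeg(K|k) ≥ m`: there are `m` algebraically independent elements. -/
def TrdegGe (k : Type*) (K : Type*) [Field k] [Field K] [Algebra k K] (m : ℕ) : Prop :=
  ∃ x : Fin m → K, AlgebraicIndependent k x

/-- `dim^M_K(S) ≥ d` for a subset `S ⊆ k^M_1(K)`: there are `s₁, …, s_d ∈ S` with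
`{s₁, …, s_d} ≠ 0` in `k^M_d(K)`. -/
def dimMge (ℓ : ℕ) {K : Type*} [Field K] (S : Set (K1 ℓ K)) (d : ℕ) : Prop :=
  ∃ a : Fin d → Kˣ, (∀ i, K1proj ℓ K (a i) ∈ S) ∧ milnorSymbol ℓ a ≠ 0

/-- `dim^M_K(S) = r`. -/
def dimMeq (ℓ : ℕ) {K : Type*} [Field K] (S : Set (K1 ℓ K)) (r : ℕ) : Prop :=
  dimMge ℓ S r ∧ ¬ dimMge ℓ S (r + 1)

/-- `t` is a general element of `K` over `k`: `t ∉ k` and `k(t)` is relatively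
algebraically closed in `K`. -/
def IsGeneralElement (k : Type*) {K : Type*} [Field k] [Field K] [Algebra k K] (t : K) : Prop :=
  t ∉ (⊥ : IntermediateField k K) ∧ RelAlgClosed (IntermediateField.adjoin k {t})

/-- A rational subgroup of `k^M_1(K)`: `Ω_K(k(t))` for a general element `t`. -/
def IsRationalSubgroup (ℓ : ℕ) (k : Type*) {K : Type*} [Field k] [Field K] [Algebra k K]
    (A : Subgroup (K1 ℓ K)) : Prop :=
  ∃ t : K, IsGeneralElement k t ∧ A = Omega ℓ (IntermediateField.adjoin k {t})

/-- `𝔊^r(K|k)`: the subgroups `Ω_K(L)` for `L` relatively algebraically closed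
in `K` of transcendence degree `r` over `k`. -/
def GSet (ℓ : ℕ) (k : Type*) {K : Type*} [Field k] [Field K] [Algebra k K] (r : ℕ) :
    Set (Subgroup (K1 ℓ K)) :=
  {A | ∃ L : IntermediateField k K, RelAlgClosed L ∧ HasTrdeg k L r ∧ A = Omega ℓ L}

/-- `𝔐^1(K)`: subgroups maximal among the subgroups `B` of `k^M_1(K)`
with `dim^M_K(B) = 1`. -/
def M1Set (ℓ : ℕ) (K : Type*) [Field K] : Set (Subgroup (K1 ℓ K)) :=
  {A | dimMeq ℓ (A : Set (K1 ℓ K)) 1 ∧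
    ∀ B : Subgroup (K1 ℓ K), dimMeq ℓ (B : Set (K1 ℓ K)) 1 → A ≤ B → B = A}

/-- Condition (a) and (b) of the maximality characterization of `𝔊^r`:
`B` is generated by rational subgroups and `dim^M_K(B) = r`. -/
def SpannedByRatWithDim (ℓ : ℕ) (k : Type*) {K : Type*} [Field k] [Field K] [Algebra k K]
    (r : ℕ) (B : Subgroup (K1 ℓ K)) : Prop :=
  (∃ S : Set (Subgroup (K1 ℓ K)), (∀ T ∈ S, IsRationalSubgroup ℓ k T) ∧ B = sSup S) ∧
    dimMeq ℓ (B : Set (K1 ℓ K)) r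

/-- A discrete valuation of a field `F`: a surjective homomorphism `F^× → ℤ`
satisfying the ultrametric inequality. -/
structure DiscreteValuation (F : Type*) [Field F] where
  v : Fˣ → ℤ
  map_mul' : ∀ x y : Fˣ, v (x * y) = v x + v y
  surjective' : Function.Surjective v
  min_le' : ∀ x y z : Fˣ, (x : F) + (y : F) = (z : F) → min (v x) (v y) ≤ v z

lemma DiscreteValuation.v_one {F : Type*} [Field F] (w : DiscreteValuation F) : w.v 1 = 0 := by
  have h := w.map_mul' 1 1
  simp only [mul_one] at h
  omega

/-- A discrete valuation of `F` is trivial on the base field `k`. -/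
def DiscreteValuation.TrivialOn (k : Type*) {F : Type*} [Field k] [Field F] [Algebra k F]
    (w : DiscreteValuation F) : Prop :=
  ∀ (c : k) (hc : algebraMap k F c ≠ 0), w.v (Units.mk0 _ hc) = 0

/-- The unit group `U_w ⊆ F^×` of a discrete valuation. -/
def DiscreteValuation.units {F : Type*} [Field F] (w : DiscreteValuation F) : Subgroup Fˣ where
  carrier := {x : Fˣ | w.v x = 0}
  one_mem' := w.v_one
  mul_mem' := by
    intro a b ha hb
    have h := w.map_mul' a b
    simp only [Set.mem_setOf_eq] at ha hb ⊢
    omega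
  inv_mem' := by
    intro a ha
    have h := w.map_mul' a a⁻¹
    rw [mul_inv_cancel] at h
    have h1 := w.v_one
    simp only [Set.mem_setOf_eq] at ha ⊢
    omega

/-- `𝔘_v`: the image of the unit group `U_v` in `K^×/(K^×)^ℓ`. -/
def DiscreteValuation.unitsImage (ℓ : ℕ) {F : Type*} [Field F] (w : DiscreteValuation F) :
    Subgroup (K1 ℓ F) :=
  w.units.map (K1proj ℓ F)

/-- For a discrete valuation `w` of an intermediate field `F` of `K|k`, the image of
the unit group `U_w` in `K^×/(K^×)^ℓ`. -/
def unitsImageIn (ℓ : ℕ) {k K : Type*} [Field k] [Field K] [Algebra k K]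
    (F : IntermediateField k K) (w : DiscreteValuation F) : Subgroup (K1 ℓ K) :=
  (w.units.map (Units.map (algebraMap F K).toMonoidHom)).map (K1proj ℓ K)

/-- The residue field of `v` has transcendence degree `≥ m` over `k`: there are
`v`-units `x₁, …, x_m` whose residues are algebraically independent over `k`,
expressed by saying that every nonzero polynomial over `k` evaluated at the `xᵢ`
is a unit of value `0`. -/
def DiscreteValuation.ResidueTrdegGe (k : Type*) {K : Type*} [Field k] [Field K] [Algebra k K]
    (v : DiscreteValuation K) (m : ℕ) : Prop :=
  ∃ x : Fin m → Kˣ, (∀ i, v.v (x i) = 0) ∧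
    ∀ P : MvPolynomial (Fin m) k, P ≠ 0 →
      ∃ u : Kˣ, (u : K) = MvPolynomial.aeval (fun i => ((x i : K))) P ∧ v.v u = 0

/-- A divisorial-type valuation of `K|k` (where `d = trdeg(K|k)`): a discrete valuation
trivial on `k` whose residue field has transcendence degree exactly `d - 1` over `k`. -/
def IsDivisorialType (k : Type*) {K : Type*} [Field k] [Field K] [Algebra k K] (d : ℕ)
    (v : DiscreteValuation K) : Prop :=
  v.TrivialOn k ∧ v.ResidueTrdegGe k (d - 1) ∧ ¬ v.ResidueTrdegGe k d

/-- `Δ_A`: the set of subgroups `A ⊓ 𝔘_v`, for `v` ranging over the divisorial-type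
valuations of `K` with `A ⊄ 𝔘_v`. -/
def DeltaA (ℓ : ℕ) (k : Type*) {K : Type*} [Field k] [Field K] [Algebra k K] (d : ℕ)
    (A : Subgroup (K1 ℓ K)) : Set (Subgroup (K1 ℓ K)) :=
  {T | ∃ v : DiscreteValuation K, IsDivisorialType k d v ∧
    ¬ A ≤ v.unitsImage ℓ ∧ T = A ⊓ v.unitsImage ℓ}

/-- A good rational subgroup: a rational subgroup `A = Ω_K(k(t))` such that for every
discrete valuation `w` of `k(t)` trivial on `k`, the image of `U_w` in `K^×/(K^×)^ℓ`
belongs to `Δ_A`. -/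
def IsGoodRationalSubgroup (ℓ : ℕ) (k : Type*) {K : Type*} [Field k] [Field K] [Algebra k K]
    (d : ℕ) (A : Subgroup (K1 ℓ K)) : Prop :=
  ∃ t : K, IsGeneralElement k t ∧ A = Omega ℓ (IntermediateField.adjoin k {t}) ∧
    ∀ w : DiscreteValuation (IntermediateField.adjoin k {t}), w.TrivialOn k →
      unitsImageIn ℓ (IntermediateField.adjoin k {t}) w ∈ DeltaA ℓ k d A

/-- A very general element: a general element `t` such that `Ω_K(k(t))` is a good
rational subgroup. -/
def IsVeryGeneral (ℓ : ℕ) (k : Type*) {K : Type*} [Field k] [Field K] [Algebra k K]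
    (d : ℕ) (t : K) : Prop :=
  IsGeneralElement k t ∧ IsGoodRationalSubgroup ℓ k d (Omega ℓ (IntermediateField.adjoin k {t}))

/-- `x` is separable in `K`: in characteristic `p > 0`, `x` is not a `p`-th power;
in characteristic `0` every element is separable. -/
def IsSeparableIn (K : Type*) [Field K] (x : K) : Prop :=
  ∀ p : ℕ, p.Prime → CharP K p → ¬ ∃ y : K, y ^ p = x

/-- A perfect closure of `K`: a perfect field which is a purely inseparable
extension of `K`. -/
structure PerfectClosureOf (K : Type u) [Field K] : Type (u + 1) where
  carrier : Type u
  [fieldInst : Field carrier]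
  [algebraInst : Algebra K carrier]
  purelyInseparable : IsPurelyInseparable K carrier
  perfect : PerfectField carrier

attribute [instance] PerfectClosureOf.fieldInst PerfectClosureOf.algebraInst

/-- A group isomorphism `φ : k^M_1(K) → k^M_1(L)` is induced by a field isomorphism
`σ : K^i → L^i` of the perfect closures, via the canonical identifications
`k^M_1(K) ≅ k^M_1(K^i)` and `k^M_1(L) ≅ k^M_1(L^i)`. -/
def InducesOnK1 (ℓ : ℕ) {K : Type u} {L : Type v} [Field K] [Field L]
    (PK : PerfectClosureOf K) (PL : PerfectClosureOf L)
    (σ : PK.carrier ≃+* PL.carrier) (φ : K1 ℓ K ≃* K1 ℓ L) : Prop :=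
  ∀ (x : Kˣ) (y : Lˣ),
    (φ (K1proj ℓ K x) = K1proj ℓ L y ↔
      ∃ z : (PL.carrier)ˣ,
        Units.map σ.toRingHom.toMonoidHom
            (Units.map (algebraMap K PK.carrier).toMonoidHom x) =
          Units.map (algebraMap L PL.carrier).toMonoidHom y * z ^ ℓ)

/-- `φ : k^M_1(K) → k^M_1(L)` is compatible with `k^M_2`: `φ ⊗ φ` descends, along the
multiplication maps, to an isomorphism `k^M_2(K) → k^M_2(L)`; equivalently, there is an
additive isomorphism `k^M_2(K) ≃ k^M_2(L)` carrying `{a, b}` to `{a', b'}` whenever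
`φ` carries the class of `a` (resp. `b`) to the class of `a'` (resp. `b'`). -/
def CompatWithK2 (ℓ : ℕ) {K L : Type*} [Field K] [Field L] (φ : K1 ℓ K ≃* K1 ℓ L) : Prop :=
  ∃ ψ : MilnorKMod ℓ 2 K ≃+ MilnorKMod ℓ 2 L,
    ∀ (a b : Kˣ) (a' b' : Lˣ),
      φ (K1proj ℓ K a) = K1proj ℓ L a' → φ (K1proj ℓ K b) = K1proj ℓ L b' →
        ψ (milnorSymbol ℓ ![a, b]) = milnorSymbol ℓ ![a', b']

/-- `φ : k^M_1(K) → k^M_1(L)` is compatible with `𝔊^1_rat`: it maps rational subgroups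
bijectively onto rational subgroups. -/
def CompatWithRat (ℓ : ℕ) (k : Type*) (l : Type*) {K L : Type*}
    [Field k] [Field K] [Algebra k K] [Field l] [Field L] [Algebra l L]
    (φ : K1 ℓ K ≃* K1 ℓ L) : Prop :=
  (∀ A : Subgroup (K1 ℓ K), IsRationalSubgroup ℓ k A →
     IsRationalSubgroup ℓ l (A.map φ.toMonoidHom)) ∧
  (∀ B : Subgroup (K1 ℓ L), IsRationalSubgroup ℓ l B →
     ∃ A : Subgroup (K1 ℓ K), IsRationalSubgroup ℓ k A ∧ A.map φ.toMonoidHom = B)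

/-- Two isomorphisms of perfect closures differ by a power of the Frobenius
(in characteristic `0`, they are equal). -/
def FrobTwistEquiv {Ki Li : Type*} [Field Ki] [Field Li] (σ σ' : Ki ≃+* Li) : Prop :=
  σ = σ' ∨ ∃ p : ℕ, p.Prime ∧ CharP Ki p ∧
    ((∃ n : ℕ, ∀ x, σ' x = σ (x ^ p ^ n)) ∨ (∃ n : ℕ, ∀ x, σ x = σ' (x ^ p ^ n)))

/-! ### The mod-`ℓ` Milnor ring -/

/-- The defining relations of the mod-`ℓ` Milnor ring. -/
inductive MilnorRingRel (ℓ : ℕ) (F : Type*) [Field F] :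
    FreeAlgebra ℤ Fˣ → FreeAlgebra ℤ Fˣ → Prop
  | mul (a b : Fˣ) : MilnorRingRel ℓ F (FreeAlgebra.ι ℤ (a * b))
      (FreeAlgebra.ι ℤ a + FreeAlgebra.ι ℤ b)
  | steinberg (a b : Fˣ) (h : (a : F) + b = 1) :
      MilnorRingRel ℓ F (FreeAlgebra.ι ℤ a * FreeAlgebra.ι ℤ b) 0
  | torsion : MilnorRingRel ℓ F (ℓ : FreeAlgebra ℤ Fˣ) 0

/-- The mod-`ℓ` Milnor ring of a field. -/
def MilnorRing (ℓ : ℕ) (F : Type*) [Field F] : Type _ := RingQuot (MilnorRingRel ℓ F)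

namespace MilnorRing

variable {ℓ : ℕ} {F F' F'' : Type*} [Field F] [Field F'] [Field F'']

instance : Ring (MilnorRing ℓ F) := inferInstanceAs (Ring (RingQuot (MilnorRingRel ℓ F)))

variable (ℓ) in
/-- The degree one symbol of a unit. -/
def sy (a : Fˣ) : MilnorRing ℓ F :=
  RingQuot.mkRingHom (MilnorRingRel ℓ F) (FreeAlgebra.ι ℤ a)

lemma sy_mul (a b : Fˣ) : sy ℓ (a * b) = sy ℓ a + sy ℓ b := by
  have := RingQuot.mkRingHom_rel (MilnorRingRel.mul (ℓ := ℓ) a b)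
  rw [map_add] at this
  exact this

lemma sy_steinberg {a b : Fˣ} (h : (a : F) + b = 1) : sy ℓ a * sy ℓ b = 0 := by
  have := RingQuot.mkRingHom_rel (MilnorRingRel.steinberg (ℓ := ℓ) a b h)
  rw [map_mul, map_zero] at this
  exact this

lemma natCast_self : ((ℓ : ℕ) : MilnorRing ℓ F) = 0 := by
  have := RingQuot.mkRingHom_rel (MilnorRingRel.torsion (ℓ := ℓ) (F := F))
  rw [map_natCast, map_zero] at this
  exact this

/-- The universal property of the Milnor ring. -/
def lift {T : Type*} [Ring T] (f : Fˣ → T) (hmul : ∀ a b, f (a * b) = f a + f b)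
    (hst : ∀ a b : Fˣ, (a : F) + b = 1 → f a * f b = 0) (hℓ : (ℓ : T) = 0) :
    MilnorRing ℓ F →+* T :=
  RingQuot.lift ⟨(FreeAlgebra.lift ℤ f).toRingHom, by
    intro x y h
    cases h with
    | mul a b => simp [hmul]
    | steinberg a b h => simp [hst a b h]
    | torsion => simp [hℓ]⟩

@[simp]
lemma lift_sy {T : Type*} [Ring T] (f : Fˣ → T) (hmul hst hℓ) (a : Fˣ) :
    lift (ℓ := ℓ) f hmul hst hℓ (sy ℓ a) = f a := by
  refine (RingQuot.lift_mkRingHom_apply _ _ _).trans ?_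
  simp

lemma closure_sy : Subring.closure (Set.range (sy (F := F) ℓ)) = ⊤ := by
  rw [eq_top_iff]
  rintro x -
  obtain ⟨y, rfl⟩ := RingQuot.mkRingHom_surjective (MilnorRingRel ℓ F) x
  induction y using FreeAlgebra.induction with
  | grade0 r =>
    have : RingQuot.mkRingHom (MilnorRingRel ℓ F) (algebraMap ℤ _ r) =
        ((r : ℤ) : MilnorRing ℓ F) := by
      rw [eq_intCast, map_intCast]; rfl
    rw [this]
    exact intCast_mem _ r
  | grade1 a => exact Subring.subset_closure ⟨a, rfl⟩
  | mul a b ha hb => rw [map_mul]; exact mul_mem ha hb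
  | add a b ha hb => rw [map_add]; exact add_mem ha hb

lemma hom_ext {T : Type*} [Ring T] {f g : MilnorRing ℓ F →+* T}
    (h : ∀ a, f (sy ℓ a) = g (sy ℓ a)) : f = g := by
  refine RingHom.eq_of_eqOn_set_dense closure_sy ?_
  rintro _ ⟨a, rfl⟩
  exact h a

@[simp]
lemma sy_one : sy ℓ (1 : Fˣ) = 0 := by
  have := sy_mul (ℓ := ℓ) (1 : Fˣ) 1
  rw [mul_one] at this
  simpa using this

lemma sy_inv (a : Fˣ) : sy ℓ a⁻¹ = - sy ℓ a := by
  have := sy_mul (ℓ := ℓ) a a⁻¹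
  rw [mul_inv_cancel, sy_one] at this
  exact eq_neg_of_add_eq_zero_right this.symm

lemma sy_div (a b : Fˣ) : sy ℓ (a / b) = sy ℓ a - sy ℓ b := by
  rw [div_eq_mul_inv, sy_mul, sy_inv, sub_eq_add_neg]

lemma sy_pow (a : Fˣ) (n : ℕ) : sy ℓ (a ^ n) = n * sy ℓ a := by
  induction n with
  | zero => simp
  | succ n ih => rw [pow_succ, sy_mul, ih]; push_cast; rw [add_mul, one_mul]

lemma sy_pow_self (a : Fˣ) : sy ℓ (a ^ ℓ) = 0 := by
  rw [sy_pow, natCast_self, zero_mul]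

lemma sy_mul_sy_neg (a : Fˣ) : sy ℓ a * sy ℓ (-a) = 0 := by
  by_cases h1 : (a : F) = 1
  · have : a = 1 := Units.ext h1
    simp [this]
  have h2 : (1 : F) - a ≠ 0 := sub_ne_zero.mpr (Ne.symm h1)
  have h3 : (1 : F) - (a⁻¹ : Fˣ) ≠ 0 := by
    rw [sub_ne_zero]
    intro h
    apply h1
    have : a⁻¹ = 1 := Units.ext h.symm
    rw [inv_eq_one] at this
    simp [this]
  have e : -a = Units.mk0 _ h2 / Units.mk0 _ h3 := by
    rw [eq_div_iff_mul_eq']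
    ext
    simp
    field_simp
    ring
  rw [e, sy_div, mul_sub, sy_steinberg (by simp), zero_sub, ← neg_mul, ← sy_inv,
    sy_steinberg (by simp)]

variable (ℓ) in
/-- The map of Milnor rings induced by a field homomorphism. -/
def map (φ : F →+* F') : MilnorRing ℓ F →+* MilnorRing ℓ F' :=
  lift (fun a => sy ℓ (Units.map φ.toMonoidHom a)) (fun a b => by rw [map_mul, sy_mul])
    (fun a b h => sy_steinberg (by simpa using congrArg φ h)) natCast_self

@[simp]
lemma map_sy (φ : F →+* F') (a : Fˣ) :
    map ℓ φ (sy ℓ a) = sy ℓ (Units.map φ.toMonoidHom a) := lift_sy ..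

lemma map_comp (ψ : F' →+* F'') (φ : F →+* F') :
    map ℓ (ψ.comp φ) = (map ℓ ψ).comp (map ℓ φ) :=
  hom_ext fun a => by simp; rfl

lemma map_map (ψ : F' →+* F'') (φ : F →+* F') (x : MilnorRing ℓ F) :
    map ℓ ψ (map ℓ φ x) = map ℓ (ψ.comp φ) x := by
  rw [map_comp]; rfl

lemma map_id : map ℓ (RingHom.id F) = RingHom.id _ :=
  hom_ext fun a => by simp

variable (ℓ) (F) in
/-- The field `F` contains an `ℓ`-th root of `-1`. -/
class NegOnePow : Prop where
  out : ∃ u : Fˣ, u ^ ℓ = -1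

lemma NegOnePow.of_ringHom [h : NegOnePow ℓ F] (φ : F →+* F') : NegOnePow ℓ F' := by
  obtain ⟨u, hu⟩ := h.out
  refine ⟨Units.map φ.toMonoidHom u, ?_⟩
  rw [← map_pow, hu]
  ext
  simp

section NegOnePow

variable [NegOnePow ℓ F]

@[simp]
lemma sy_neg_one : sy ℓ (-1 : Fˣ) = 0 := by
  obtain ⟨u, hu⟩ := NegOnePow.out (ℓ := ℓ) (F := F)
  rw [← hu, sy_pow_self]

@[simp]
lemma sy_neg (a : Fˣ) : sy ℓ (-a) = sy ℓ a := by
  rw [← neg_one_mul, sy_mul, sy_neg_one, zero_add]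

@[simp]
lemma sy_mul_self (a : Fˣ) : sy ℓ a * sy ℓ a = 0 := by
  simpa using sy_mul_sy_neg (ℓ := ℓ) a

lemma sy_anticomm (a b : Fˣ) : sy ℓ a * sy ℓ b = -(sy ℓ b * sy ℓ a) := by
  have := sy_mul_self (ℓ := ℓ) (a * b)
  rw [sy_mul, add_mul, mul_add, mul_add, sy_mul_self, sy_mul_self, zero_add, add_zero] at this
  exact eq_neg_of_add_eq_zero_left this

end NegOnePow

variable (ℓ F) in
/-- The sign automorphism of the Milnor ring. -/
def sgn : MilnorRing ℓ F →+* MilnorRing ℓ F :=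
  lift (fun a => - sy ℓ a) (fun a b => by rw [sy_mul, neg_add])
    (fun a b h => by rw [neg_mul_neg, sy_steinberg h]) natCast_self

@[simp]
lemma sgn_sy (a : Fˣ) : sgn ℓ F (sy ℓ a) = - sy ℓ a := lift_sy ..

lemma sgn_sgn (x : MilnorRing ℓ F) : sgn ℓ F (sgn ℓ F x) = x := by
  have : (sgn ℓ F).comp (sgn ℓ F) = RingHom.id _ := hom_ext fun a => by simp
  exact congrArg (fun f => f x) this

lemma sy_mul_eq_sgn_mul [NegOnePow ℓ F] (b : Fˣ) (x : MilnorRing ℓ F) :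
    sy ℓ b * x = sgn ℓ F x * sy ℓ b := by
  have hx : x ∈ Subring.closure (Set.range (sy (F := F) ℓ)) := by rw [closure_sy]; trivial
  induction hx using Subring.closure_induction with
  | mem x hx => obtain ⟨a, rfl⟩ := hx; simp [sy_anticomm b a]
  | zero => simp
  | one => simp
  | add x y _ _ hx hy => simp [mul_add, add_mul, hx, hy]
  | neg x _ hx => simp [hx]
  | mul x y _ _ hx hy => rw [← mul_assoc, hx, mul_assoc, hy, map_mul, mul_assoc]

/-! ### Link with the symbols -/

section Link

variable (ℓ F)

variable {n : ℕ}
/-- The symbol map as a multilinear map. -/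
def symbolMultilinear (n : ℕ) :
    MultilinearMap ℤ (fun _ : Fin n => Additive Fˣ) (MilnorKMod ℓ n F) :=
  ((Submodule.mkQ _).comp (Submodule.mkQ _)).compMultilinearMap (PiTensorProduct.tprod ℤ)

variable {F} in
lemma symbolMultilinear_apply (a : Fin n → Fˣ) :
    symbolMultilinear ℓ F n (fun i => Additive.ofMul (a i)) = milnorSymbol ℓ a := rfl

variable {F} in
lemma milnorSymbol_eq_zero_of_steinberg (a : Fin n → Fˣ) {i j : Fin n} (hij : i < j)
    (h : (a i : F) + a j = 1) : milnorSymbol ℓ a = 0 := by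
  unfold milnorSymbol
  have : PiTensorProduct.tprod ℤ (fun i => Additive.ofMul (a i)) ∈ SteinbergRel n F :=
    Submodule.subset_span ⟨a, ⟨i, j, hij, h⟩, rfl⟩
  rw [(Submodule.Quotient.mk_eq_zero _).mpr this]
  rfl

lemma smul_milnorKMod (x : MilnorKMod ℓ n F) : (ℓ : ℤ) • x = 0 := by
  obtain ⟨x, rfl⟩ := Submodule.Quotient.mk_surjective _ x
  rw [← Submodule.Quotient.mk_smul, Submodule.Quotient.mk_eq_zero]
  exact ⟨x, rfl⟩

variable {F} in
/-- A multilinear map killing the Steinberg relations and `ℓ` descends to Milnor K-theory. -/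
def milnorLift {N : Type*} [AddCommGroup N]
    (f : MultilinearMap ℤ (fun _ : Fin n => Additive Fˣ) N)
    (hst : ∀ a : Fin n → Fˣ, ∀ i j : Fin n, i < j → (a i : F) + a j = 1 →
      f (fun i => Additive.ofMul (a i)) = 0)
    (hℓ : ∀ x : N, (ℓ : ℤ) • x = 0) : MilnorKMod ℓ n F →ₗ[ℤ] N :=
  Submodule.liftQ _ (Submodule.liftQ _ (PiTensorProduct.lift f) (by
    refine Submodule.span_le.mpr ?_
    rintro _ ⟨a, ⟨i, j, hij, h⟩, rfl⟩
    simpa using hst a i j hij h)) (by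
    rintro _ ⟨x, rfl⟩
    simpa using hℓ _)

variable {F} in
lemma milnorLift_symbol {N : Type*} [AddCommGroup N]
    (f : MultilinearMap ℤ (fun _ : Fin n => Additive Fˣ) N) (hst hℓ) (a : Fin n → Fˣ) :
    milnorLift ℓ f hst hℓ (milnorSymbol ℓ a) = f (fun i => Additive.ofMul (a i)) := by
  unfold milnorLift milnorSymbol
  refine Eq.trans (Submodule.liftQ_apply ..) ?_
  refine Eq.trans (Submodule.liftQ_apply ..) ?_
  simp

variable {F} in
lemma milnorKMod_hom_ext {N : Type*} [AddCommGroup N] {f g : MilnorKMod ℓ n F →ₗ[ℤ] N}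
    (h : ∀ a : Fin n → Fˣ, f (milnorSymbol ℓ a) = g (milnorSymbol ℓ a)) : f = g := by
  refine Submodule.linearMap_qext _ (Submodule.linearMap_qext _ (PiTensorProduct.ext ?_))
  ext a
  exact h (fun i => (a i).toMul)

variable {F} in
/-- Left multiplication by `{a}` on Milnor K-theory. -/
def consMap (n : ℕ) (a : Fˣ) : MilnorKMod ℓ n F →ₗ[ℤ] MilnorKMod ℓ (n + 1) F :=
  milnorLift ℓ ((symbolMultilinear ℓ F (n + 1)).curryLeft (Additive.ofMul a)) (by
    intro b i j hij h
    rw [MultilinearMap.curryLeft_apply]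
    have : (Fin.cons (Additive.ofMul a) fun i => Additive.ofMul (b i) :
        Fin (n + 1) → Additive Fˣ) = fun i => Additive.ofMul ((Fin.cons a b : Fin (n + 1) → Fˣ) i) := by
      funext i
      refine Fin.cases ?_ (fun i => ?_) i <;> simp
    rw [this, symbolMultilinear_apply]
    exact milnorSymbol_eq_zero_of_steinberg ℓ _ (Fin.succ_lt_succ_iff.mpr hij) (by simpa using h))
    (smul_milnorKMod ℓ F)

variable {F} in
lemma consMap_symbol (a : Fˣ) (b : Fin n → Fˣ) :
    consMap ℓ n a (milnorSymbol ℓ b) = milnorSymbol ℓ (Fin.cons a b : Fin (n + 1) → Fˣ) := by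
  unfold consMap
  rw [milnorLift_symbol, MultilinearMap.curryLeft_apply, ← symbolMultilinear_apply]
  congr 1

variable {F} in
lemma consMap_mul (a b : Fˣ) : consMap ℓ n (a * b) = consMap ℓ n a + consMap ℓ n b := by
  refine milnorKMod_hom_ext ℓ fun c => ?_
  rw [LinearMap.add_apply]
  unfold consMap
  rw [milnorLift_symbol, milnorLift_symbol, milnorLift_symbol, ofMul_mul, map_add]
  rfl

variable {F} in
lemma consMap_steinberg {a b : Fˣ} (h : (a : F) + b = 1) (x : MilnorKMod ℓ n F) :
    consMap ℓ (n + 1) a (consMap ℓ n b x) = 0 := by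
  have : (consMap ℓ (n + 1) a).comp (consMap ℓ n b) = 0 := by
    refine milnorKMod_hom_ext ℓ fun c => ?_
    rw [LinearMap.comp_apply, consMap_symbol, consMap_symbol, LinearMap.zero_apply]
    exact milnorSymbol_eq_zero_of_steinberg ℓ _ (i := 0) (j := 1) (by simp) (by simpa using h)
  exact congrArg (fun f => f x) this

/-- Milnor K-theory as a family of abelian groups. -/
def KGroup (n : ℕ) : Type _ := MilnorKMod ℓ n F

instance (n : ℕ) : AddCommGroup (KGroup ℓ F n) := inferInstanceAs (AddCommGroup (MilnorKMod ℓ n F))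

variable {F} in
/-- The left multiplication operator by `{a}` on the product of all Milnor K-groups. -/
def consOp (a : Fˣ) : AddMonoid.End (∀ n, KGroup ℓ F n) where
  toFun x := Nat.rec 0 (fun n _ => consMap ℓ n a (x n))
  map_zero' := by
    funext n
    cases n
    · rfl
    · exact map_zero _
  map_add' x y := by
    funext n
    cases n
    · exact (add_zero _).symm
    · exact map_add _ _ _

/-- The action of the Milnor ring on Milnor K-theory. -/
def act : MilnorRing ℓ F →+* AddMonoid.End (∀ n, KGroup ℓ F n) :=
  lift (consOp ℓ)
    (by
      intro a b
      refine AddMonoidHom.ext fun x => funext fun n => ?_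
      cases n with
      | zero => exact (add_zero _).symm
      | succ n => exact congrArg (fun f => f (x n)) (consMap_mul ℓ a b))
    (by
      intro a b h
      refine AddMonoidHom.ext fun x => funext fun n => ?_
      match n with
      | 0 => rfl
      | 1 => exact map_zero (consMap ℓ 0 a)
      | n + 2 => exact consMap_steinberg ℓ h _)
    (by
      refine AddMonoidHom.ext fun x => funext fun n => ?_
      have := smul_milnorKMod ℓ F (x n)
      exact (congrFun (AddMonoid.End.natCast_apply ℓ x) n).trans
        ((natCast_zsmul _ _).symm.trans this))

variable {F} in
lemma act_sy (a : Fˣ) : act ℓ F (sy ℓ a) = consOp ℓ a := lift_sy ..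

variable {F} in
lemma act_prod (a : Fin n → Fˣ) :
    act ℓ F (List.ofFn fun i => sy ℓ (a i)).prod
      (Pi.single (M := KGroup ℓ F) 0 (milnorSymbol ℓ Fin.elim0)) n = milnorSymbol ℓ a := by
  induction n with
  | zero =>
    rw [Subsingleton.elim a Fin.elim0, List.ofFn_zero, List.prod_nil, map_one]
    exact Pi.single_eq_same (M := KGroup ℓ F) 0 _
  | succ n ih =>
    rw [List.ofFn_succ, List.prod_cons, map_mul, act_sy]
    refine Eq.trans (congrArg (consMap ℓ n (a 0)) (ih fun i => a i.succ)) ?_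
    rw [consMap_symbol]
    congr 1
    exact Fin.cons_self_tail a

variable {F} in
lemma milnorSymbol_eq_zero_of_prod (a : Fin n → Fˣ)
    (h : (List.ofFn fun i => sy ℓ (a i)).prod = 0) : milnorSymbol ℓ a = 0 := by
  rw [← act_prod, h, map_zero]
  rfl

end Link

/-! ### Tame symbols -/

variable (F F') in
/-- A valuation with values in `ℤ` together with an angular component map. -/
structure TameData where
  /-- the valuation -/
  v : Fˣ → ℤ
  /-- the angular component -/
  ac : Fˣ →* F'ˣ
  v_mul : ∀ a b, v (a * b) = v a + v b
  steinberg : ∀ a b : Fˣ, (a : F) + b = 1 → (v a = 0 ∧ ac a = 1) ∨ (v b = 0 ∧ ac b = 1) ∨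
    (v a = 0 ∧ v b = 0 ∧ (ac a : F') + ac b = 1) ∨ (v a = v b ∧ ac b = - ac a)

namespace TameData

variable [NegOnePow ℓ F'] (D : TameData F F')

variable (ℓ) in
/-- The matrix encoding the tame symbol. -/
def tame : MilnorRing ℓ F →+* Matrix (Fin 2) (Fin 2) (MilnorRing ℓ F') :=
  lift (fun a => !![- sy ℓ (D.ac a), 0; (D.v a : MilnorRing ℓ F'), sy ℓ (D.ac a)])
    (by
      intro a b
      ext i j
      fin_cases i <;> fin_cases j <;> simp [sy_mul, D.v_mul, add_comm])
    (by
      intro a b h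
      have key : - sy ℓ (D.ac a) * - sy ℓ (D.ac b) = 0 ∧
          (D.v a : MilnorRing ℓ F') * - sy ℓ (D.ac b) + sy ℓ (D.ac a) * (D.v b) = 0 := by
        rcases D.steinberg a b h with ⟨h1, h2⟩ | ⟨h1, h2⟩ | ⟨h1, h2, h3⟩ | ⟨h1, h2⟩
        · simp [h1, h2]
        · simp [h1, h2]
        · simp [h1, h2, sy_steinberg h3]
        · simp [h1, h2, (Int.cast_commute (D.v b) (sy ℓ (D.ac a))).eq]
      rw [Matrix.mul_fin_two, key.2]
      rw [neg_mul_neg] at key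
      ext i j
      fin_cases i <;> fin_cases j <;> simp [key.1])
    (by
      ext i j
      rw [Matrix.natCast_apply]
      simp [natCast_self])

lemma tame_sy (a : Fˣ) : D.tame ℓ (sy ℓ a) =
    !![- sy ℓ (D.ac a), 0; (D.v a : MilnorRing ℓ F'), sy ℓ (D.ac a)] := lift_sy ..

/-- The residue (tame symbol) attached to tame data. -/
def residue (x : MilnorRing ℓ F) : MilnorRing ℓ F' := D.tame ℓ x 1 0

/-- The specialization attached to tame data. -/
def spec (x : MilnorRing ℓ F) : MilnorRing ℓ F' := D.tame ℓ x 1 1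

@[simp] lemma residue_add (x y : MilnorRing ℓ F) :
    D.residue (x + y) = D.residue x + D.residue y := by simp [residue]

@[simp] lemma residue_zero : D.residue (0 : MilnorRing ℓ F) = 0 := by simp [residue]

@[simp] lemma residue_neg (x : MilnorRing ℓ F) : D.residue (-x) = - D.residue x := by
  simp [residue]

lemma residue_sum {ι : Type*} (s : Finset ι) (f : ι → MilnorRing ℓ F) :
    D.residue (∑ i ∈ s, f i) = ∑ i ∈ s, D.residue (f i) := by
  simp [residue, Matrix.sum_apply]

@[simp] lemma residue_sy (a : Fˣ) : D.residue (sy ℓ a) = D.v a := by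
  simp [residue, tame_sy]

@[simp] lemma spec_sy (a : Fˣ) : D.spec (sy ℓ a) = sy ℓ (D.ac a) := by
  simp [spec, tame_sy]

lemma tame_zero_one (x : MilnorRing ℓ F) : D.tame ℓ x 0 1 = 0 := by
  have hx : x ∈ Subring.closure (Set.range (sy (F := F) ℓ)) := by rw [closure_sy]; trivial
  induction hx using Subring.closure_induction with
  | mem x hx => obtain ⟨a, rfl⟩ := hx; simp [tame_sy]
  | zero => simp
  | one => simp
  | add x y _ _ hx hy => simp [hx, hy]
  | neg x _ hx => simp [hx]
  | mul x y _ _ hx hy => simp [Matrix.mul_apply, hx, hy]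

lemma spec_mul (x y : MilnorRing ℓ F) : D.spec (x * y) = D.spec x * D.spec y := by
  simp [spec, Matrix.mul_apply, tame_zero_one]

lemma tame_zero_zero (x : MilnorRing ℓ F) : D.tame ℓ x 0 0 = sgn ℓ F' (D.spec x) := by
  have hx : x ∈ Subring.closure (Set.range (sy (F := F) ℓ)) := by rw [closure_sy]; trivial
  induction hx using Subring.closure_induction with
  | mem x hx => obtain ⟨a, rfl⟩ := hx; simp [tame_sy]
  | zero => simp [spec]
  | one => simp [spec]
  | add x y _ _ hx hy => simp [hx, hy, spec]
  | neg x _ hx => simp [hx, spec]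
  | mul x y _ _ hx hy => rw [spec_mul]; simp [Matrix.mul_apply, hx, hy, tame_zero_one]

lemma residue_mul (x y : MilnorRing ℓ F) :
    D.residue (x * y) = D.residue x * sgn ℓ F' (D.spec y) + D.spec x * D.residue y := by
  rw [← tame_zero_zero]
  simp [spec, residue, Matrix.mul_apply]

/-- The specialization as a ring homomorphism. -/
def specHom : MilnorRing ℓ F →+* MilnorRing ℓ F' where
  toFun := D.spec
  map_one' := by simp [spec]
  map_zero' := by simp [spec]
  map_add' := by simp [spec]
  map_mul' := D.spec_mul

end TameData

open Polynomial

/-- Leading term data on a domain `A` with values in a field. -/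
structure LeadingData (A κ : Type*) [CommRing A] [Field κ] where
  /-- the order -/
  v : A → ℤ
  /-- the leading coefficient -/
  lc : A → κ
  lc_ne : ∀ f, f ≠ 0 → lc f ≠ 0
  v_mul : ∀ f g, f ≠ 0 → g ≠ 0 → v (f * g) = v f + v g
  lc_mul : ∀ f g, f ≠ 0 → g ≠ 0 → lc (f * g) = lc f * lc g
  add_of_lt : ∀ f g, f ≠ 0 → g ≠ 0 → v f < v g → v (f + g) = v f ∧ lc (f + g) = lc f
  add_of_eq : ∀ f g, f ≠ 0 → g ≠ 0 → v f = v g → lc f + lc g ≠ 0 →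
    v (f + g) = v f ∧ lc (f + g) = lc f + lc g

section FractionUnits

variable {A E : Type*} [CommRing A] [IsDomain A] [Field E] [Algebra A E] [IsFractionRing A E]

open Classical in
variable (E) in
/-- The unit of the fraction field attached to a nonzero element (and `1` for `0`). -/
def fu (f : A) : Eˣ :=
  if h : f = 0 then 1 else Units.mk0 (algebraMap A E f) (by simpa using h)

@[simp] lemma fu_zero : fu E (0 : A) = 1 := by simp [fu]

lemma coe_fu {f : A} (h : f ≠ 0) : (fu E f : E) = algebraMap A E f := by simp [fu, h]

lemma fu_mul {f g : A} (hf : f ≠ 0) (hg : g ≠ 0) : fu E (f * g) = fu E f * fu E g := by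
  ext
  simp [coe_fu, hf, hg]

@[simp] lemma fu_one : fu E (1 : A) = 1 := by
  ext
  simp [coe_fu]

variable (A) in
lemma exists_fu (a : Eˣ) : ∃ f g : A, f ≠ 0 ∧ g ≠ 0 ∧ a = fu E f / fu E g := by
  obtain ⟨f, g, hg, h⟩ := IsFractionRing.div_surjective (A := A) (a : E)
  have hg' : g ≠ 0 := nonZeroDivisors.ne_zero hg
  have hf : f ≠ 0 := by
    rintro rfl
    simp at h
    exact a.ne_zero h.symm
  refine ⟨f, g, hf, hg', ?_⟩
  ext
  simp [coe_fu, hf, hg', h]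

lemma fu_div_eq_iff {f g f' g' : A} (hf : f ≠ 0) (hg : g ≠ 0) (hf' : f' ≠ 0) (hg' : g' ≠ 0) :
    fu E f / fu E g = fu E f' / fu E g' ↔ f * g' = f' * g := by
  rw [div_eq_div_iff_mul_eq_mul, ← fu_mul hf hg', ← fu_mul hf' hg, Units.ext_iff,
    coe_fu (mul_ne_zero hf hg'), coe_fu (mul_ne_zero hf' hg)]
  exact (IsFractionRing.injective A E).eq_iff

variable (E) in
/-- A multiplicative map on nonzero elements extends to units of the fraction field. -/
lemma exists_extend_fu {G : Type*} [CommGroup G] (φ : A → G)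
    (hφ : ∀ f g, f ≠ 0 → g ≠ 0 → φ (f * g) = φ f * φ g) :
    ∃ Φ : Eˣ →* G, ∀ f : A, f ≠ 0 → Φ (fu E f) = φ f := by
  choose n d hn hd h using exists_fu (A := A) (E := E)
  have key : ∀ f g : A, f ≠ 0 → g ≠ 0 →
      φ (n (fu E f / fu E g)) / φ (d (fu E f / fu E g)) = φ f / φ g := by
    intro f g hf hg
    have := (fu_div_eq_iff hf hg (hn _) (hd _)).mp (h (fu E f / fu E g))
    rw [div_eq_div_iff_mul_eq_mul, ← hφ _ _ (hn _) hg, ← hφ _ _ hf (hd _), this]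
  have h1 : φ 1 = 1 := by
    have := hφ 1 1 one_ne_zero one_ne_zero
    rw [mul_one] at this
    exact left_eq_mul.mp this
  refine ⟨⟨⟨fun a => φ (n a) / φ (d a), ?_⟩, ?_⟩, ?_⟩
  · simpa using key 1 1 one_ne_zero one_ne_zero
  · intro a b
    have e : a * b = fu E (n a * n b) / fu E (d a * d b) := by
      rw [fu_mul (hn a) (hn b), fu_mul (hd a) (hd b), mul_div_mul_comm, ← h a, ← h b]
    have := key _ _ (mul_ne_zero (hn a) (hn b)) (mul_ne_zero (hd a) (hd b))
    rw [← e, hφ _ _ (hn a) (hn b), hφ _ _ (hd a) (hd b), mul_div_mul_comm] at this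
    exact this
  · intro f hf
    have := key f 1 hf one_ne_zero
    simpa [h1] using this

end FractionUnits

section

variable {A κ : Type*} [CommRing A] [IsDomain A] [Field κ] (D : LeadingData A κ)
  (E : Type*) [Field E] [Algebra A E] [IsFractionRing A E]

namespace LeadingData

lemma steinberg {f g : A} (hf : f ≠ 0) (hg : g ≠ 0) (hfg : f + g ≠ 0) :
    (D.v f = D.v (f + g) ∧ D.lc f = D.lc (f + g)) ∨
    (D.v g = D.v (f + g) ∧ D.lc g = D.lc (f + g)) ∨
    (D.v f = D.v (f + g) ∧ D.v g = D.v (f + g) ∧ D.lc f + D.lc g = D.lc (f + g)) ∨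
    (D.v f = D.v g ∧ D.lc g = - D.lc f) := by
  rcases lt_trichotomy (D.v f) (D.v g) with h | h | h
  · have := D.add_of_lt f g hf hg h
    exact Or.inl ⟨this.1.symm, this.2.symm⟩
  · by_cases h0 : D.lc f + D.lc g = 0
    · exact Or.inr (Or.inr (Or.inr ⟨h, eq_neg_of_add_eq_zero_right h0⟩))
    · have := D.add_of_eq f g hf hg h h0
      exact Or.inr (Or.inr (Or.inl ⟨this.1.symm, by rw [← h, this.1], this.2.symm⟩))
  · have := D.add_of_lt g f hg hf h
    rw [add_comm g f] at this
    exact Or.inr (Or.inl ⟨this.1.symm, this.2.symm⟩)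

open Classical in
lemma exists_tameData : ∃ T : TameData E κ,
    (∀ f : A, f ≠ 0 → T.v (fu E f) = D.v f) ∧ ∀ f : A, f ≠ 0 → (T.ac (fu E f) : κ) = D.lc f := by
  obtain ⟨V, hV⟩ := exists_extend_fu E (fun f : A => Multiplicative.ofAdd (D.v f))
    (fun f g hf hg => by rw [D.v_mul f g hf hg]; rfl)
  obtain ⟨W, hW⟩ := exists_extend_fu E
    (fun f : A => if h : f = 0 then 1 else Units.mk0 (D.lc f) (D.lc_ne f h))
    (fun f g hf hg => by
      ext
      simp [hf, hg, D.lc_mul])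
  have hV' : ∀ f : A, f ≠ 0 → (V (fu E f)).toAdd = D.v f := fun f hf => by rw [hV f hf]; rfl
  have hW' : ∀ f : A, f ≠ 0 → (W (fu E f) : κ) = D.lc f := fun f hf => by
    rw [hW f hf]; simp [hf]
  refine ⟨⟨fun a => (V a).toAdd, W, fun a b => by simp, ?_⟩, hV', hW'⟩
  intro a b hab
  obtain ⟨f₀, h, hf₀, hh, rfl⟩ := exists_fu A a
  obtain ⟨g₀, h', hg₀, hh', rfl⟩ := exists_fu A b
  obtain ⟨f, g, m, hf, hg, hm, e1, e2⟩ : ∃ f g m : A, f ≠ 0 ∧ g ≠ 0 ∧ m ≠ 0 ∧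
      fu E f₀ / fu E h = fu E f / fu E m ∧ fu E g₀ / fu E h' = fu E g / fu E m := by
    refine ⟨f₀ * h', g₀ * h, h * h', mul_ne_zero hf₀ hh', mul_ne_zero hg₀ hh, mul_ne_zero hh hh',
      ?_, ?_⟩
    · rw [fu_div_eq_iff hf₀ hh (mul_ne_zero hf₀ hh') (mul_ne_zero hh hh')]
      ring
    · rw [fu_div_eq_iff hg₀ hh' (mul_ne_zero hg₀ hh) (mul_ne_zero hh hh')]
      ring
  rw [e1, e2] at hab ⊢
  have hfg : f + g = m := by
    apply IsFractionRing.injective A E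
    have hm' : algebraMap A E m ≠ 0 := by simpa using hm
    simp only [Units.val_div_eq_div_val, coe_fu hf, coe_fu hg, coe_fu hm] at hab
    field_simp at hab
    rw [map_add, hab]
  subst hfg
  have hlc := D.lc_ne _ hm
  simp only [_root_.map_div, toAdd_div, hV' _ hf, hV' _ hg, hV' _ hm, Units.ext_iff,
    Units.val_div_eq_div_val, hW' _ hf, hW' _ hg, hW' _ hm, Units.val_one, Units.val_neg]
  rcases D.steinberg hf hg hm with ⟨h1, h2⟩ | ⟨h1, h2⟩ | ⟨h1, h2, h3⟩ | ⟨h1, h2⟩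
  · left
    rw [← h1, ← h2]
    exact ⟨by ring, div_self (D.lc_ne _ hf)⟩
  · right; left
    rw [← h1, ← h2]
    exact ⟨by ring, div_self (D.lc_ne _ hg)⟩
  · right; right; left
    refine ⟨by rw [← h1]; ring, by rw [← h2]; ring, ?_⟩
    rw [← add_div, h3, div_self hlc]
  · right; right; right
    exact ⟨by rw [h1], by rw [h2]; ring⟩

/-- The tame data on the fraction field attached to leading term data. -/
def tameData : TameData E κ := (D.exists_tameData E).choose

lemma tameData_v {f : A} (hf : f ≠ 0) : (D.tameData E).v (fu E f) = D.v f :=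
  (D.exists_tameData E).choose_spec.1 f hf

lemma tameData_ac {f : A} (hf : f ≠ 0) : ((D.tameData E).ac (fu E f) : κ) = D.lc f :=
  (D.exists_tameData E).choose_spec.2 f hf

end LeadingData

end

section Polynomial

variable {F : Type*} [Field F]

variable (F) in
/-- The leading term data at infinity on polynomials. -/
def leadingInfty : LeadingData F[X] F where
  v f := - (f.natDegree : ℤ)
  lc f := f.leadingCoeff
  lc_ne f hf := by simpa using hf
  v_mul f g hf hg := by rw [natDegree_mul hf hg]; push_cast; ring
  lc_mul f g hf hg := leadingCoeff_mul f g
  add_of_lt f g hf hg h := by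
    have h' : g.natDegree < f.natDegree := by omega
    exact ⟨by rw [natDegree_add_eq_left_of_natDegree_lt h'],
      leadingCoeff_add_of_degree_lt' (degree_lt_degree h')⟩
  add_of_eq f g hf hg h h0 := by
    have h' : f.natDegree = g.natDegree := by omega
    have hd : f.degree = g.degree := by
      rw [degree_eq_natDegree hf, degree_eq_natDegree hg, h']
    have h1 := leadingCoeff_add_of_degree_eq hd h0
    refine ⟨?_, h1⟩
    have : (f + g).degree = f.degree := by
      rw [degree_add_eq_of_leadingCoeff_add_ne_zero h0, ← hd, max_self]
    rw [natDegree_eq_of_degree_eq this]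

variable (ρ : F[X]) [hρ : Fact (Irreducible ρ)]

open Classical in
/-- The prime-to-`ρ` part of a polynomial. -/
def primePart (f : F[X]) : F[X] := if h : f = 0 then 0 else
  (FiniteMultiplicity.exists_eq_pow_mul_and_not_dvd
    (FiniteMultiplicity.of_not_isUnit hρ.out.not_isUnit h)).choose

lemma primePart_spec {f : F[X]} (hf : f ≠ 0) :
    f = ρ ^ multiplicity ρ f * primePart ρ f ∧ ¬ ρ ∣ primePart ρ f := by
  rw [primePart, dif_neg hf]
  exact (FiniteMultiplicity.exists_eq_pow_mul_and_not_dvd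
    (FiniteMultiplicity.of_not_isUnit hρ.out.not_isUnit hf)).choose_spec

lemma eq_of_pow_mul {f c : F[X]} {n : ℕ} (h : f = ρ ^ n * c) (hc : ¬ ρ ∣ c) :
    multiplicity ρ f = n ∧ primePart ρ f = c := by
  have hρ0 := hρ.out.ne_zero
  have hf : f ≠ 0 := by
    rw [h]
    exact mul_ne_zero (pow_ne_zero _ hρ0) (by rintro rfl; simp at hc)
  have hm : multiplicity ρ f = n := by
    refine multiplicity_eq_of_dvd_of_not_dvd ⟨c, h⟩ ?_
    rw [h, pow_succ]
    exact fun h' => hc ((mul_dvd_mul_iff_left (pow_ne_zero _ hρ0)).mp h')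
  refine ⟨hm, ?_⟩
  have := (primePart_spec ρ hf).1
  rw [hm] at this
  exact mul_left_cancel₀ (pow_ne_zero n hρ0) (this.symm.trans h)

/-- The leading term data on polynomials at an irreducible polynomial. -/
def leadingAt : LeadingData F[X] (AdjoinRoot ρ) where
  v f := multiplicity ρ f
  lc f := AdjoinRoot.mk ρ (primePart ρ f)
  lc_ne f hf := by
    rw [Ne, AdjoinRoot.mk_eq_zero]
    exact (primePart_spec ρ hf).2
  v_mul f g hf hg := by
    rw [(eq_of_pow_mul ρ (c := primePart ρ f * primePart ρ g)
      (n := multiplicity ρ f + multiplicity ρ g) ?_ ?_).1]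
    · push_cast; rfl
    · conv_lhs => rw [(primePart_spec ρ hf).1, (primePart_spec ρ hg).1]
      ring
    · exact hρ.out.prime.not_dvd_mul (primePart_spec ρ hf).2 (primePart_spec ρ hg).2
  lc_mul f g hf hg := by
    rw [← map_mul, (eq_of_pow_mul ρ (c := primePart ρ f * primePart ρ g)
      (n := multiplicity ρ f + multiplicity ρ g) ?_ ?_).2]
    · conv_lhs => rw [(primePart_spec ρ hf).1, (primePart_spec ρ hg).1]
      ring
    · exact hρ.out.prime.not_dvd_mul (primePart_spec ρ hf).2 (primePart_spec ρ hg).2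
  add_of_lt f g hf hg h := by
    obtain ⟨m, hm⟩ : ∃ m, multiplicity ρ g = multiplicity ρ f + (m + 1) :=
      ⟨multiplicity ρ g - multiplicity ρ f - 1, by omega⟩
    have := eq_of_pow_mul ρ (f := f + g) (c := primePart ρ f + ρ ^ (m + 1) * primePart ρ g)
      (n := multiplicity ρ f) ?_ ?_
    · refine ⟨by rw [this.1], ?_⟩
      rw [this.2]
      simp
    · conv_lhs => rw [(primePart_spec ρ hf).1, (primePart_spec ρ hg).1, hm]
      ring
    · rw [pow_succ']
      intro h'
      exact (primePart_spec ρ hf).2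
        ((dvd_add_left (Dvd.dvd.mul_right (Dvd.intro _ rfl) _)).mp h')
  add_of_eq f g hf hg h h0 := by
    have hm : multiplicity ρ g = multiplicity ρ f := by omega
    rw [← map_add] at h0 ⊢
    rw [Ne, AdjoinRoot.mk_eq_zero] at h0
    have := eq_of_pow_mul ρ (f := f + g) (c := primePart ρ f + primePart ρ g)
      (n := multiplicity ρ f) ?_ h0
    · exact ⟨by rw [this.1], by rw [this.2]⟩
    · conv_lhs => rw [(primePart_spec ρ hf).1, (primePart_spec ρ hg).1, hm]
      ring

lemma leadingAt_of_not_dvd {f : F[X]} (hf : ¬ ρ ∣ f) :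
    (leadingAt ρ).v f = 0 ∧ (leadingAt ρ).lc f = AdjoinRoot.mk ρ f := by
  have := eq_of_pow_mul ρ (f := f) (n := 0) (by simp) hf
  exact ⟨by simp [leadingAt, this.1], by simp [leadingAt, this.2]⟩

end Polynomial

section Exactness

variable {ℓ : ℕ} {F : Type*} [Field F] [NegOnePow ℓ F]

instance (ρ : F[X]) [Fact (Irreducible ρ)] : NegOnePow ℓ (AdjoinRoot ρ) :=
  .of_ringHom (AdjoinRoot.of ρ)

variable (ℓ F) (E : Type*) [Field E] [Algebra F[X] E] [IsFractionRing F[X] E] [NegOnePow ℓ E]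

/-- The subring generated by the symbols of polynomials of degree less than `d`. -/
def degLT (d : ℕ) : Subring (MilnorRing ℓ E) :=
  Subring.closure {x | ∃ f : F[X], f.natDegree < d ∧ x = sy ℓ (fu E f)}

/-- The tame data at an irreducible polynomial. -/
def tameAt (ρ : F[X]) [Fact (Irreducible ρ)] : TameData E (AdjoinRoot ρ) :=
  (leadingAt ρ).tameData E

variable {ℓ F E}

lemma sy_fu_mem_degLT {f : F[X]} {d : ℕ} (h : f.natDegree < d) : sy ℓ (fu E f) ∈ degLT ℓ F E d :=
  Subring.subset_closure ⟨f, h, rfl⟩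

lemma sgn_mem_degLT {d : ℕ} {x : MilnorRing ℓ E} (hx : x ∈ degLT ℓ F E d) :
    sgn ℓ E x ∈ degLT ℓ F E d := by
  have : degLT ℓ F E d ≤ (degLT ℓ F E d).comap (sgn ℓ E) := by
    refine Subring.closure_le.mpr ?_
    rintro _ ⟨f, hf, rfl⟩
    simpa using sy_fu_mem_degLT hf
  exact this hx

lemma degLT_mono {d e : ℕ} (h : d ≤ e) : degLT ℓ F E d ≤ degLT ℓ F E e :=
  Subring.closure_mono fun _ ⟨f, hf, e⟩ => ⟨f, hf.trans_le h, e⟩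

variable (F) in
lemma exists_mem_degLT (x : MilnorRing ℓ E) : ∃ d, x ∈ degLT ℓ F E d := by
  have hx : x ∈ Subring.closure (Set.range (sy (F := E) ℓ)) := by rw [closure_sy]; trivial
  induction hx using Subring.closure_induction with
  | mem x hx =>
    obtain ⟨a, rfl⟩ := hx
    obtain ⟨f, g, -, -, rfl⟩ := exists_fu F[X] a
    rw [sy_div]
    exact ⟨max f.natDegree g.natDegree + 1, sub_mem
      (sy_fu_mem_degLT (by omega)) (sy_fu_mem_degLT (by omega))⟩
  | zero => exact ⟨0, zero_mem _⟩
  | one => exact ⟨0, one_mem _⟩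
  | add x y _ _ hx hy =>
    obtain ⟨d, hd⟩ := hx
    obtain ⟨e, he⟩ := hy
    exact ⟨max d e, add_mem (degLT_mono (le_max_left _ _) hd) (degLT_mono (le_max_right _ _) he)⟩
  | neg x _ hx =>
    obtain ⟨d, hd⟩ := hx
    exact ⟨d, neg_mem hd⟩
  | mul x y _ _ hx hy =>
    obtain ⟨d, hd⟩ := hx
    obtain ⟨e, he⟩ := hy
    exact ⟨max d e, mul_mem (degLT_mono (le_max_left _ _) hd) (degLT_mono (le_max_right _ _) he)⟩

lemma degLT_one_le (x : MilnorRing ℓ E) (hx : x ∈ degLT ℓ F E 1) :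
    ∃ y, x = map ℓ ((algebraMap F[X] E).comp C) y := by
  have : degLT ℓ F E 1 ≤ (map ℓ ((algebraMap F[X] E).comp C)).range := by
    refine Subring.closure_le.mpr ?_
    rintro _ ⟨f, hf, rfl⟩
    obtain ⟨c, rfl⟩ := natDegree_eq_zero.mp (Nat.lt_one_iff.mp hf)
    by_cases hc : c = 0
    · subst hc
      exact ⟨0, by simp⟩
    refine ⟨sy ℓ (Units.mk0 c hc), ?_⟩
    rw [map_sy]
    congr 1
    ext
    simp [coe_fu, hc]
  obtain ⟨y, hy⟩ := this hx
  exact ⟨y, hy.symm⟩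

/-- If `b + c ρ = a a'`, the defect of multiplicativity is annihilated by `ρ` modulo smaller
degree. -/
lemma defect_mem {a a' b c ρ : F[X]} {d : ℕ} (ha : a ≠ 0) (ha' : a' ≠ 0) (hb : b ≠ 0)
    (hρ : ρ ≠ 0) (h : b + ρ * c = a * a') (hda : a.natDegree < d) (hda' : a'.natDegree < d)
    (hdb : b.natDegree < d) (hdc : c.natDegree < d) :
    (sy ℓ (fu E b) - sy ℓ (fu E a) - sy ℓ (fu E a')) * sy ℓ (fu E ρ) ∈ degLT ℓ F E d := by
  by_cases hc : c = 0
  · subst hc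
    rw [mul_zero, add_zero] at h
    rw [h, fu_mul ha ha', sy_mul, add_sub_cancel_left, sub_self, zero_mul]
    exact zero_mem _
  have h1 : sy ℓ (fu E b / (fu E a * fu E a')) * sy ℓ (fu E (ρ * c) / (fu E a * fu E a')) = 0 := by
    refine sy_steinberg ?_
    have ha2 : algebraMap F[X] E a ≠ 0 := by simpa using ha
    have ha2' : algebraMap F[X] E a' ≠ 0 := by simpa using ha'
    simp only [Units.val_div_eq_div_val, Units.val_mul, coe_fu ha, coe_fu ha', coe_fu hb,
      coe_fu (mul_ne_zero hρ hc)]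
    rw [← add_div, ← map_add, h, map_mul, div_self (mul_ne_zero ha2 ha2')]
  rw [fu_mul hρ hc, sy_div, sy_div, sy_mul, sy_mul, sub_add_eq_sub_sub] at h1
  set u := sy ℓ (fu E b) - sy ℓ (fu E a) - sy ℓ (fu E a')
  have hu : u ∈ degLT ℓ F E d :=
    sub_mem (sub_mem (sy_fu_mem_degLT hdb) (sy_fu_mem_degLT hda)) (sy_fu_mem_degLT hda')
  have : u * sy ℓ (fu E ρ) = - (u * (sy ℓ (fu E c) - sy ℓ (fu E a) - sy ℓ (fu E a'))) := by
    rw [eq_neg_iff_add_eq_zero, ← mul_add]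
    rw [← h1]
    congr 1
    abel
  rw [this]
  exact neg_mem (mul_mem hu (sub_mem (sub_mem (sy_fu_mem_degLT hdc) (sy_fu_mem_degLT hda))
    (sy_fu_mem_degLT hda')))

variable (ℓ E) in
/-- The ideal of elements of the subring of smaller degree whose product with `ρ` stays there. -/
def annIdeal (ρ : F[X]) (d : ℕ) : Ideal (degLT ℓ F E d) where
  carrier := {x | (x : MilnorRing ℓ E) * sy ℓ (fu E ρ) ∈ degLT ℓ F E d}
  add_mem' {x y} hx hy := by
    change ((x : MilnorRing ℓ E) + y) * sy ℓ (fu E ρ) ∈ degLT ℓ F E d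
    rw [add_mul]
    exact (degLT ℓ F E d).add_mem hx hy
  zero_mem' := by simp
  smul_mem' c x hx := by
    change ((c : MilnorRing ℓ E) * x) * sy ℓ (fu E ρ) ∈ degLT ℓ F E d
    rw [mul_assoc]
    exact (degLT ℓ F E d).mul_mem c.2 hx

lemma mem_annIdeal {ρ : F[X]} {d : ℕ} {x : degLT ℓ F E d} :
    x ∈ annIdeal ℓ E ρ d ↔ (x : MilnorRing ℓ E) * sy ℓ (fu E ρ) ∈ degLT ℓ F E d := Iff.rfl

instance (ρ : F[X]) (d : ℕ) : (annIdeal ℓ E ρ d).IsTwoSided := ⟨by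
  intro x y hx
  rw [mem_annIdeal] at hx ⊢
  have : ((x * y : degLT ℓ F E d) : MilnorRing ℓ E) * sy ℓ (fu E ρ) =
      (x * sy ℓ (fu E ρ)) * sgn ℓ E y := by
    rw [Subring.coe_mul, mul_assoc, mul_assoc, sy_mul_eq_sgn_mul, sgn_sgn]
  rw [this]
  exact mul_mem hx (sgn_mem_degLT y.2)⟩

section

variable (ρ : F[X]) [hρ : Fact (Irreducible ρ)]

/-- The representative of smallest degree of an element of `F[X]/ρ`. -/
def rep (x : AdjoinRoot ρ) : F[X] := (AdjoinRoot.mk_surjective x).choose % ρ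

lemma mk_rep (x : AdjoinRoot ρ) : AdjoinRoot.mk ρ (rep ρ x) = x := by
  conv_rhs => rw [← (AdjoinRoot.mk_surjective (g := ρ) x).choose_spec]
  rw [AdjoinRoot.mk_eq_mk, rep]
  refine ⟨-((AdjoinRoot.mk_surjective x).choose / ρ), ?_⟩
  have := EuclideanDomain.div_add_mod (AdjoinRoot.mk_surjective x).choose ρ
  linear_combination this

lemma degree_rep_lt (x : AdjoinRoot ρ) : (rep ρ x).degree < ρ.degree :=
  EuclideanDomain.mod_lt _ hρ.out.ne_zero

lemma natDegree_rep_lt (x : AdjoinRoot ρ) : (rep ρ x).natDegree < ρ.natDegree := by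
  by_cases h : rep ρ x = 0
  · rw [h, natDegree_zero]
    exact hρ.out.natDegree_pos
  · exact natDegree_lt_natDegree h (degree_rep_lt ρ x)

lemma rep_ne_zero (x : (AdjoinRoot ρ)ˣ) : rep ρ x ≠ 0 := by
  intro h
  apply x.ne_zero
  rw [← mk_rep ρ x, h, map_zero]

lemma eq_rep {f : F[X]} (h : f.degree < ρ.degree) {x : AdjoinRoot ρ} (hf : AdjoinRoot.mk ρ f = x) :
    f = rep ρ x := by
  rw [← mk_rep ρ x, AdjoinRoot.mk_eq_mk] at hf
  by_contra hne
  exact not_dvd_of_degree_lt (sub_ne_zero.mpr hne)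
    ((degree_sub_le _ _).trans_lt (max_lt h (degree_rep_lt ρ x))) hf

variable (ℓ E) in
/-- The action of the Milnor ring of `F[X]/ρ` on symbols ending with `ρ`, modulo symbols of
smaller degree. -/
def quotHom : MilnorRing ℓ (AdjoinRoot ρ) →+*
    degLT ℓ F E ρ.natDegree ⧸ annIdeal ℓ E ρ ρ.natDegree :=
  lift (fun u => Ideal.Quotient.mk _ ⟨sy ℓ (fu E (rep ρ u)), sy_fu_mem_degLT (natDegree_rep_lt ρ _)⟩)
    (by
      intro u v
      rw [← map_add, Ideal.Quotient.eq, mem_annIdeal]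
      set a := rep ρ (u : AdjoinRoot ρ)
      set a' := rep ρ (v : AdjoinRoot ρ)
      set b := rep ρ ((u * v : (AdjoinRoot ρ)ˣ) : AdjoinRoot ρ)
      have ha : a ≠ 0 := rep_ne_zero ρ _
      have ha' : a' ≠ 0 := rep_ne_zero ρ _
      have : AdjoinRoot.mk ρ (a * a') = AdjoinRoot.mk ρ b := by
        rw [map_mul, mk_rep, mk_rep, mk_rep, Units.val_mul]
      rw [AdjoinRoot.mk_eq_mk] at this
      obtain ⟨c, hc⟩ := this
      have hd : 0 < ρ.natDegree := hρ.out.natDegree_pos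
      have hda : a.natDegree < ρ.natDegree := natDegree_rep_lt ρ _
      have hda' : a'.natDegree < ρ.natDegree := natDegree_rep_lt ρ _
      have hdb : b.natDegree < ρ.natDegree := natDegree_rep_lt ρ _
      have hdc : c.natDegree < ρ.natDegree := by
        by_cases h0 : c = 0
        · rwa [h0, natDegree_zero]
        have h1 : (ρ * c).natDegree < ρ.natDegree + ρ.natDegree := by
          rw [← hc]
          refine (natDegree_sub_le _ _).trans_lt (max_lt ?_ (by omega))
          rw [natDegree_mul ha ha']
          omega
        rw [natDegree_mul hρ.out.ne_zero h0] at h1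
        omega
      have := defect_mem (ℓ := ℓ) (E := E) ha ha' (rep_ne_zero ρ _) hρ.out.ne_zero
        (show b + ρ * c = a * a' by rw [← hc]; ring) hda hda' hdb hdc
      simpa [sub_sub] using this)
    (by
      intro u v h
      rw [← map_mul]
      have hz : sy ℓ (fu E (rep ρ (u : AdjoinRoot ρ))) * sy ℓ (fu E (rep ρ (v : AdjoinRoot ρ))) = 0 := by
        refine sy_steinberg ?_
        rw [coe_fu (rep_ne_zero ρ _), coe_fu (rep_ne_zero ρ _), ← map_add]
        have h1 : rep ρ (u : AdjoinRoot ρ) + rep ρ (v : AdjoinRoot ρ) = rep ρ (1 : AdjoinRoot ρ) :=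
          eq_rep ρ ((degree_add_le _ _).trans_lt (max_lt (degree_rep_lt ρ _) (degree_rep_lt ρ _)))
            (by rw [map_add, mk_rep, mk_rep, h])
        have h2 : (1 : F[X]) = rep ρ (1 : AdjoinRoot ρ) :=
          eq_rep ρ (by rw [degree_one]; exact hρ.out.degree_pos) (map_one _)
        rw [h1, ← h2, map_one]
      rw [← map_zero (Ideal.Quotient.mk _)]
      congr 1
      exact Subtype.ext hz)
    (by
      rw [← map_natCast (Ideal.Quotient.mk _), ← map_zero (Ideal.Quotient.mk _)]
      congr 1
      exact Subtype.ext (by simpa using natCast_self))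

lemma tameAt_of_not_dvd {f : F[X]} (h : ¬ ρ ∣ f) :
    (tameAt F E ρ).v (fu E f) = 0 ∧ ((tameAt F E ρ).ac (fu E f) : AdjoinRoot ρ) = AdjoinRoot.mk ρ f := by
  have hf : f ≠ 0 := by rintro rfl; simp at h
  rw [tameAt, LeadingData.tameData_v _ _ hf, LeadingData.tameData_ac _ _ hf]
  exact leadingAt_of_not_dvd ρ h

lemma not_dvd_of_natDegree_lt {f : F[X]} (hf : f ≠ 0) (h : f.natDegree < ρ.natDegree) : ¬ ρ ∣ f :=
  Polynomial.not_dvd_of_natDegree_lt hf h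

lemma quotHom_spec {x : MilnorRing ℓ E} (hx : x ∈ degLT ℓ F E ρ.natDegree) :
    quotHom ℓ E ρ ((tameAt F E ρ).spec x) = Ideal.Quotient.mk _ ⟨x, hx⟩ := by
  change quotHom ℓ E ρ ((tameAt F E ρ).specHom x) = _
  induction hx using Subring.closure_induction with
  | mem x hx =>
    obtain ⟨f, hf, rfl⟩ := hx
    by_cases h0 : f = 0
    · subst h0
      simp only [fu_zero, sy_one, map_zero]
      exact (map_zero (Ideal.Quotient.mk _)).symm
    change quotHom ℓ E ρ ((tameAt F E ρ).spec _) = _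
    rw [TameData.spec_sy]
    refine (lift_sy ..).trans ?_
    congr 3
    rw [← eq_rep ρ (degree_lt_degree hf)
      (tameAt_of_not_dvd ρ (E := E) (not_dvd_of_natDegree_lt ρ h0 hf)).2.symm]
  | zero => simp only [map_zero]; exact (map_zero (Ideal.Quotient.mk _)).symm
  | one => simp only [map_one]; exact (map_one (Ideal.Quotient.mk _)).symm
  | add x y _ _ hx hy => rw [map_add, map_add, hx, hy]; exact (map_add (Ideal.Quotient.mk _) _ _).symm
  | neg x _ hx => rw [map_neg, map_neg, hx]; exact (map_neg (Ideal.Quotient.mk _) _).symm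
  | mul x y _ _ hx hy => rw [map_mul, map_mul, hx, hy]; exact (map_mul (Ideal.Quotient.mk _) _ _).symm

lemma mul_sy_mem_of_spec_eq_zero {x : MilnorRing ℓ E} (hx : x ∈ degLT ℓ F E ρ.natDegree)
    (h : (tameAt F E ρ).spec x = 0) : x * sy ℓ (fu E ρ) ∈ degLT ℓ F E ρ.natDegree := by
  have := quotHom_spec ρ hx
  rw [h, map_zero, eq_comm, Ideal.Quotient.eq_zero_iff_mem, mem_annIdeal] at this
  exact this

lemma residue_of_mem_degLT {x : MilnorRing ℓ E} (hx : x ∈ degLT ℓ F E ρ.natDegree) :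
    (tameAt F E ρ).residue x = 0 := by
  induction hx using Subring.closure_induction with
  | mem x hx =>
    obtain ⟨f, hf, rfl⟩ := hx
    by_cases h0 : f = 0
    · subst h0; simp
    rw [TameData.residue_sy, (tameAt_of_not_dvd ρ (not_dvd_of_natDegree_lt ρ h0 hf)).1, Int.cast_zero]
  | zero => simp
  | one => simp [TameData.residue]
  | add x y _ _ hx hy => simp [hx, hy]
  | neg x _ hx => simp [hx]
  | mul x y _ _ hx hy => simp [TameData.residue_mul, hx, hy]

end

/-- Expressions `y + ∑ c_ρ ρ` with `ρ` monic irreducible of degree `d` and coefficients of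
smaller degree. -/
def IsTopSum (d : ℕ) (x : MilnorRing ℓ E) : Prop :=
  ∃ y ∈ degLT ℓ F E d, ∃ c : F[X] →₀ MilnorRing ℓ E, (∀ ρ, c ρ ∈ degLT ℓ F E d) ∧
    (∀ ρ ∈ c.support, ρ.Monic ∧ Irreducible ρ ∧ ρ.natDegree = d) ∧
    x = y + c.sum fun ρ z => z * sy ℓ (fu E ρ)

lemma IsTopSum.add {d : ℕ} {x x' : MilnorRing ℓ E} (h : IsTopSum (F := F) d x)
    (h' : IsTopSum (F := F) d x') : IsTopSum (F := F) d (x + x') := by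
  classical
  obtain ⟨y, hy, c, hc, hs, rfl⟩ := h
  obtain ⟨y', hy', c', hc', hs', rfl⟩ := h'
  refine ⟨y + y', add_mem hy hy', c + c', fun ρ => add_mem (hc ρ) (hc' ρ), ?_, ?_⟩
  · intro ρ hρ
    rcases Finset.mem_union.mp (Finsupp.support_add hρ) with h | h
    · exact hs ρ h
    · exact hs' ρ h
  · rw [Finsupp.sum_add_index' (by simp) (by intros; rw [add_mul])]
    abel

lemma IsTopSum.of_mem {d : ℕ} {x : MilnorRing ℓ E} (hx : x ∈ degLT ℓ F E d) :
    IsTopSum (F := F) d x :=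
  ⟨x, hx, 0, fun _ => zero_mem _, by simp, by simp⟩

lemma IsTopSum.of_mul {d : ℕ} {x : MilnorRing ℓ E} (hx : x ∈ degLT ℓ F E d) {ρ : F[X]}
    (h1 : ρ.Monic) (h2 : Irreducible ρ) (h3 : ρ.natDegree = d) :
    IsTopSum (F := F) d (x * sy ℓ (fu E ρ)) := by
  classical
  refine ⟨0, zero_mem _, Finsupp.single ρ x, ?_, ?_, ?_⟩
  · intro σ
    rw [Finsupp.single_apply]
    split_ifs
    · exact hx
    · exact zero_mem _
  · intro σ hσ
    rw [Finset.mem_singleton.mp (Finsupp.support_single_subset hσ)]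
    exact ⟨h1, h2, h3⟩
  · rw [Finsupp.sum_single_index (by simp), zero_add]

lemma IsTopSum.sum {ι : Type*} (s : Finset ι) {d : ℕ} {f : ι → MilnorRing ℓ E}
    (h : ∀ i ∈ s, IsTopSum (F := F) d (f i)) : IsTopSum (F := F) d (∑ i ∈ s, f i) := by
  classical
  induction s using Finset.induction_on with
  | empty => exact .of_mem (by simp)
  | insert a s ha ih =>
    rw [Finset.sum_insert ha]
    exact (h a (by simp)).add (ih fun i hi => h i (by simp [hi]))

lemma IsTopSum.mul_left {d : ℕ} {x y : MilnorRing ℓ E} (h : IsTopSum (F := F) d x)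
    (hy : y ∈ degLT ℓ F E d) : IsTopSum (F := F) d (y * x) := by
  obtain ⟨z, hz, c, hc, hs, rfl⟩ := h
  rw [mul_add, Finsupp.mul_sum]
  refine (IsTopSum.of_mem (mul_mem hy hz)).add (IsTopSum.sum _ fun ρ hρ => ?_)
  dsimp only
  rw [← mul_assoc]
  exact .of_mul (mul_mem hy (hc ρ)) (hs ρ hρ).1 (hs ρ hρ).2.1 (hs ρ hρ).2.2

lemma sy_mul_sy_top {d : ℕ} {ρ σ : F[X]} (h1 : ρ.Monic) (h2 : Irreducible ρ)
    (h3 : ρ.natDegree = d) (h1' : σ.Monic) (h2' : Irreducible σ) (h3' : σ.natDegree = d) :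
    IsTopSum (F := F) d (sy ℓ (fu E ρ) * sy ℓ (fu E σ)) := by
  by_cases h0 : σ - ρ = 0
  · rw [sub_eq_zero.mp h0, sy_mul_self]
    exact .of_mem (zero_mem _)
  have hst : sy ℓ (fu E ρ / fu E σ) * sy ℓ (fu E (σ - ρ) / fu E σ) = 0 := by
    refine sy_steinberg ?_
    have : algebraMap F[X] E σ ≠ 0 := by simpa using h2'.ne_zero
    simp only [Units.val_div_eq_div_val, coe_fu h2.ne_zero, coe_fu h2'.ne_zero, coe_fu h0]
    rw [← add_div, ← map_add, add_sub_cancel, div_self this]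
  have hg : sy ℓ (fu E (σ - ρ)) ∈ degLT ℓ F E d := by
    refine sy_fu_mem_degLT ?_
    rw [← h3']
    refine natDegree_lt_natDegree h0 (degree_sub_lt_left ?_ h2'.ne_zero ?_)
    · rw [degree_eq_natDegree h2.ne_zero, degree_eq_natDegree h2'.ne_zero, h3, h3']
    · rw [h1, h1']
  rw [sy_div, sy_div, sub_mul, mul_sub, mul_sub, sy_mul_self, sub_zero,
    sy_anticomm (fu E ρ) (fu E (σ - ρ)), sy_anticomm (fu E σ) (fu E (σ - ρ))] at hst
  have : sy ℓ (fu E ρ) * sy ℓ (fu E σ) = - sy ℓ (fu E (σ - ρ)) * sy ℓ (fu E ρ) +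
      sy ℓ (fu E (σ - ρ)) * sy ℓ (fu E σ) := by
    rw [← sub_eq_zero, ← neg_eq_zero, ← hst, neg_mul]
    abel
  rw [this]
  exact (IsTopSum.of_mul (neg_mem hg) h1 h2 h3).add (IsTopSum.of_mul hg h1' h2' h3')

lemma IsTopSum.sy_mul {d : ℕ} {x : MilnorRing ℓ E} (h : IsTopSum (F := F) d x) {ρ : F[X]}
    (h1 : ρ.Monic) (h2 : Irreducible ρ) (h3 : ρ.natDegree = d) :
    IsTopSum (F := F) d (sy ℓ (fu E ρ) * x) := by
  obtain ⟨z, hz, c, hc, hs, rfl⟩ := h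
  rw [mul_add, Finsupp.mul_sum, sy_mul_eq_sgn_mul]
  refine (IsTopSum.of_mul (sgn_mem_degLT hz) h1 h2 h3).add (IsTopSum.sum _ fun σ hσ => ?_)
  dsimp only
  rw [← mul_assoc, sy_mul_eq_sgn_mul, mul_assoc]
  obtain ⟨h1', h2', h3'⟩ := hs σ hσ
  exact (sy_mul_sy_top h1 h2 h3 h1' h2' h3').mul_left (sgn_mem_degLT (hc σ))

lemma IsTopSum.of_mem_succ {d : ℕ} (hd : 1 ≤ d) {x : MilnorRing ℓ E}
    (hx : x ∈ degLT ℓ F E (d + 1)) : IsTopSum (F := F) d x := by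
  have gen : ∀ f : F[X], f.natDegree < d + 1 → ∀ y, IsTopSum (F := F) d y →
      IsTopSum (F := F) d (sy ℓ (fu E f) * y) := by
    intro f hf y hy
    rcases Nat.lt_succ_iff_lt_or_eq.mp hf with h | h
    · exact hy.mul_left (sy_fu_mem_degLT h)
    have hf0 : f ≠ 0 := by rintro rfl; simp at h; omega
    by_cases hirr : Irreducible f
    · set c := f.leadingCoeff
      have hc : c ≠ 0 := leadingCoeff_ne_zero.mpr hf0
      have hm : (f * C c⁻¹).Monic := monic_mul_leadingCoeff_inv hf0
      have e : f = C c * (f * C c⁻¹) := by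
        rw [mul_left_comm, ← C_mul, mul_inv_cancel₀ hc, C_1, mul_one]
      have hirr' : Irreducible (f * C c⁻¹) := by
        rw [irreducible_mul_isUnit (isUnit_C.mpr (IsUnit.mk0 _ (inv_ne_zero hc)))]
        exact hirr
      have hdeg : (f * C c⁻¹).natDegree = d := by
        rw [natDegree_mul_C (inv_ne_zero hc), h]
      rw [e, fu_mul (C_ne_zero.mpr hc) hm.ne_zero, MilnorRing.sy_mul, add_mul]
      exact (hy.mul_left (sy_fu_mem_degLT (by rw [natDegree_C]; omega))).add
        (hy.sy_mul hm hirr' hdeg)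
    · have hnu : ¬ IsUnit f := fun hu => by
        have := natDegree_eq_zero_of_isUnit hu
        omega
      obtain ⟨a, ha, b, hb, hab⟩ : ∃ a, ¬ IsUnit a ∧ ∃ b, ¬ IsUnit b ∧ f = a * b := by
        simp only [irreducible_iff, not_and, not_forall, not_or] at hirr
        obtain ⟨a, b, e, h1, h2⟩ := hirr hnu
        exact ⟨a, h1, b, h2, e⟩
      have ha0 : a ≠ 0 := by rintro rfl; simp at hab; exact hf0 hab
      have hb0 : b ≠ 0 := by rintro rfl; simp at hab; exact hf0 hab
      have hda : 0 < a.natDegree := natDegree_pos_iff_degree_pos.mpr (degree_pos_of_ne_zero_of_nonunit ha0 ha)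
      have hdb : 0 < b.natDegree := natDegree_pos_iff_degree_pos.mpr (degree_pos_of_ne_zero_of_nonunit hb0 hb)
      rw [hab, natDegree_mul ha0 hb0] at h
      rw [hab, fu_mul ha0 hb0, MilnorRing.sy_mul, add_mul]
      exact (hy.mul_left (sy_fu_mem_degLT (by omega))).add
        (hy.mul_left (sy_fu_mem_degLT (by omega)))
  have : ∀ x ∈ degLT ℓ F E (d + 1), ∀ y, IsTopSum (F := F) d y → IsTopSum (F := F) d (x * y) := by
    intro x hx
    induction hx using Subring.closure_induction with
    | mem x hx =>
      obtain ⟨f, hf, rfl⟩ := hx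
      exact gen f hf
    | zero => intro y hy; rw [zero_mul]; exact .of_mem (zero_mem _)
    | one => intro y hy; rwa [one_mul]
    | add x z _ _ hx hz => intro y hy; rw [add_mul]; exact (hx y hy).add (hz y hy)
    | neg x _ hx =>
      intro y hy
      rw [← neg_one_mul, mul_assoc]
      exact (hx y hy).mul_left (neg_mem (one_mem _))
    | mul x z _ _ hx hz => intro y hy; rw [mul_assoc]; exact hx _ (hz y hy)
  simpa using this x hx 1 (.of_mem (one_mem _))

lemma not_dvd_of_monic_irreducible {ρ σ : F[X]} (h1 : ρ.Monic) (h2 : Irreducible ρ)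
    (h1' : σ.Monic) (h2' : Irreducible σ) (h : ρ ≠ σ) : ¬ ρ ∣ σ := fun hd =>
  h (eq_of_monic_of_associated h1 h1' (h2.associated_of_dvd h2' hd))

lemma mem_degLT_of_residue {d : ℕ} (hd : 1 ≤ d) {x : MilnorRing ℓ E}
    (hx : x ∈ degLT ℓ F E (d + 1))
    (h : ∀ (ρ : F[X]) [Fact (Irreducible ρ)], ρ.Monic → (tameAt F E ρ).residue x = 0) :
    x ∈ degLT ℓ F E d := by
  obtain ⟨y, hy, c, hc, hs, rfl⟩ := IsTopSum.of_mem_succ hd hx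
  refine add_mem hy (sum_mem fun ρ hρ => ?_)
  obtain ⟨h1, h2, rfl⟩ := hs ρ hρ
  have : Fact (Irreducible ρ) := ⟨h2⟩
  refine mul_sy_mem_of_spec_eq_zero ρ (hc ρ) ?_
  have hres := h ρ h1
  rw [TameData.residue_add, residue_of_mem_degLT ρ hy, zero_add, Finsupp.sum,
    TameData.residue_sum, Finset.sum_eq_single_of_mem ρ hρ] at hres
  · have hv : (tameAt F E ρ).v (fu E ρ) = 1 ∧ (tameAt F E ρ).ac (fu E ρ) = 1 := by
      rw [tameAt, LeadingData.tameData_v _ _ h2.ne_zero]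
      have := eq_of_pow_mul ρ (f := ρ) (c := 1) (n := 1) (by simp)
        (fun h => h2.not_isUnit (isUnit_of_dvd_one h))
      refine ⟨by simp [leadingAt, this.1], Units.ext ?_⟩
      rw [LeadingData.tameData_ac _ _ h2.ne_zero]
      simp [leadingAt, this.2]
    rw [TameData.residue_mul, TameData.spec_sy, TameData.residue_sy, hv.1, hv.2] at hres
    simpa using hres
  · intro σ hσ hne
    obtain ⟨h1', h2', h3'⟩ := hs σ hσ
    have hv := tameAt_of_not_dvd ρ (E := E) (not_dvd_of_monic_irreducible h1 h2 h1' h2' hne.symm)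
    rw [TameData.residue_mul, residue_of_mem_degLT ρ (hc σ), TameData.residue_sy, hv.1]
    simp

/-- An element of the Milnor ring of a rational function field with trivial residues is
constant. -/
theorem exists_const_of_residue {x : MilnorRing ℓ E}
    (h : ∀ (ρ : F[X]) [Fact (Irreducible ρ)], ρ.Monic → (tameAt F E ρ).residue x = 0) :
    ∃ y, x = map ℓ ((algebraMap F[X] E).comp C) y := by
  obtain ⟨d, hd⟩ := exists_mem_degLT F x
  have : ∀ n, x ∈ degLT ℓ F E (n + 1) → x ∈ degLT ℓ F E 1 := by
    intro n
    induction n with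
    | zero => exact id
    | succ n ih => exact fun hx => ih (mem_degLT_of_residue (by omega) hx h)
  exact degLT_one_le x (this d (degLT_mono (Nat.le_succ d) hd))

end Exactness

section

variable {ℓ : ℕ} {F : Type*} [Field F]

open Classical in
variable (ℓ) in
/-- The symbol of an element of the field, `0` for the zero element. -/
def sym (x : F) : MilnorRing ℓ F := if h : x = 0 then 0 else sy ℓ (Units.mk0 x h)

lemma sym_coe (a : Fˣ) : sym ℓ (a : F) = sy ℓ a := by
  rw [sym, dif_neg a.ne_zero, Units.mk0_val]

lemma sym_zero : sym ℓ (0 : F) = 0 := by simp [sym]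

lemma sym_of_ne {x : F} (h : x ≠ 0) : sym ℓ x = sy ℓ (Units.mk0 x h) := by simp [sym, h]

lemma sym_eq_sy {x : F} {a : Fˣ} (h : (a : F) = x) : sym ℓ x = sy ℓ a := by rw [← h, sym_coe]

lemma sym_one : sym ℓ (1 : F) = 0 := by rw [sym_eq_sy Units.val_one, sy_one]

lemma sym_mul {x y : F} (hx : x ≠ 0) (hy : y ≠ 0) : sym ℓ (x * y) = sym ℓ x + sym ℓ y := by
  rw [sym_of_ne hx, sym_of_ne hy, ← sy_mul]
  exact sym_eq_sy (by simp)

lemma sym_pow {x : F} (hx : x ≠ 0) (n : ℕ) : sym ℓ (x ^ n) = n * sym ℓ x := by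
  rw [sym_of_ne hx, ← sy_pow]
  exact sym_eq_sy (by simp)

lemma sym_neg [NegOnePow ℓ F] (x : F) : sym ℓ (-x) = sym ℓ x := by
  by_cases hx : x = 0
  · simp [hx]
  rw [sym_of_ne hx, ← sy_neg]
  exact sym_eq_sy (by simp)

lemma sym_neg_one_pow_mul [NegOnePow ℓ F] (n : ℕ) (x : F) : sym ℓ ((-1) ^ n * x) = sym ℓ x := by
  rcases neg_one_pow_eq_or F n with h | h <;> simp [h, sym_neg]

lemma map_sym {F' : Type*} [Field F'] (φ : F →+* F') (x : F) :
    map ℓ φ (sym ℓ x) = sym ℓ (φ x) := by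
  by_cases hx : x = 0
  · simp [hx, sym_zero]
  rw [sym_of_ne hx, map_sy]
  exact (sym_eq_sy (by simp)).symm

lemma sym_eq_zero_of_pow {x y : F} (h : y ^ ℓ = x) : sym ℓ x = 0 := by
  by_cases hx : y = 0
  · subst hx
    rcases eq_or_ne ℓ 0 with rfl | h0
    · rw [← h]; simp [sym_one]
    · rw [← h, zero_pow h0, sym_zero]
  · rw [← h, sym_pow hx, natCast_self, zero_mul]

end

variable {ℓ : ℕ} {F : Type*} [Field F] [NegOnePow ℓ F]

lemma resultant_mod {q g : F[X]} (hq : q.Monic) (h : g % q ≠ 0) :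
    q.resultant g = q.resultant (g % q) := by
  by_cases hd : g.natDegree < q.natDegree
  · rw [(mod_eq_self_iff hq.ne_zero).mpr (degree_lt_degree hd)]
  have hlt : (g % q).natDegree < q.natDegree :=
    natDegree_lt_natDegree h (EuclideanDomain.mod_lt _ hq.ne_zero)
  have e : g % q = g + q * (-(g / q)) := by
    conv_rhs => rw [← EuclideanDomain.div_add_mod g q]
    have := EuclideanDomain.div_add_mod g q
    rw [this]
    linear_combination this
  have h1 : (g / q).natDegree + q.natDegree ≤ g.natDegree := by
    rw [← divByMonic_eq_div _ hq, natDegree_divByMonic _ hq]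
    omega
  have h2 := resultant_add_mul_right q g (-(g / q)) q.natDegree g.natDegree
    (by rwa [natDegree_neg]) le_rfl
  obtain ⟨k, hk⟩ := Nat.exists_eq_add_of_le (show (g % q).natDegree ≤ g.natDegree by omega)
  rw [← e] at h2
  rw [← h2]
  conv_lhs => rw [hk]
  rw [resultant_add_right_deg _ _ _ _ _ le_rfl, coeff_natDegree, hq.leadingCoeff]
  simp

variable (ℓ) (E : Type*) [Field E] [Algebra F[X] E] [IsFractionRing F[X] E] [NegOnePow ℓ E]

variable (F) in
/-- The tame data at infinity. -/
def tameInfty : TameData E F := (leadingInfty F).tameData E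

lemma tameAt_v {ρ : F[X]} [hρ : Fact (Irreducible ρ)] {f : F[X]} (hf : f ≠ 0) :
    (tameAt F E ρ).v (fu E f) = multiplicity ρ f := by
  rw [tameAt, LeadingData.tameData_v _ _ hf]
  rfl

lemma exists_reciprocity (n : ℕ) : ∀ q g : F[X], q.natDegree = n → q.Monic → IsCoprime q g →
    ∃ ω : MilnorRing ℓ E, (∀ (ρ : F[X]) [Fact (Irreducible ρ)], ρ.Monic →
      (tameAt F E ρ).residue ω = multiplicity ρ q * sym ℓ (AdjoinRoot.mk ρ g)) ∧
      (tameInfty F E).residue ω = - sym ℓ (q.resultant g) := by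
  induction n using Nat.strong_induction_on with
  | _ n ih =>
  intro q g hn hq hqg
  rcases Nat.eq_zero_or_pos n with rfl | hpos
  · obtain rfl := hq.natDegree_eq_zero.mp hn
    refine ⟨0, fun ρ hρ _ => ?_, ?_⟩
    · have : multiplicity ρ (1 : F[X]) = 0 := by
        refine multiplicity_eq_zero.mpr fun h => hρ.out.not_isUnit (isUnit_of_dvd_one h)
      simp [this]
    · rw [natDegree_one, resultant_zero_left_deg]
      simp [sym_one]
  have hq0 := hq.ne_zero
  have hg' : g % q ≠ 0 := by
    intro h
    have : IsUnit q := hqg.isUnit_of_dvd' dvd_rfl (EuclideanDomain.mod_eq_zero.mp h)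
    rw [hq.isUnit_iff] at this
    rw [this] at hn
    simp at hn
    omega
  set g' := g % q with hg'_def
  set c := g'.leadingCoeff with hc_def
  have hc : c ≠ 0 := leadingCoeff_ne_zero.mpr hg'
  set h := C c⁻¹ * g' with hh_def
  have hhm : h.Monic := by
    rw [Monic, hh_def, leadingCoeff_mul, leadingCoeff_C, inv_mul_cancel₀ hc]
  have hch : g' = C c * h := by
    rw [hh_def, ← mul_assoc, ← C_mul, mul_inv_cancel₀ hc, C_1, one_mul]
  have hdeg : h.natDegree = g'.natDegree := by rw [hch, natDegree_C_mul hc]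
  have hlt : g'.natDegree < n := by
    rw [← hn]
    exact natDegree_lt_natDegree hg' (EuclideanDomain.mod_lt _ hq0)
  have hcop' : IsCoprime q g' := by
    rw [hg'_def]
    have := EuclideanDomain.div_add_mod g q
    rw [← this, add_comm] at hqg
    exact IsCoprime.of_add_mul_left_right hqg
  have hcop : IsCoprime h q := by
    rw [hch] at hcop'
    exact (IsCoprime.of_mul_right_right hcop').symm
  obtain ⟨ω, hω, hω'⟩ := ih h.natDegree (by omega) h q rfl hhm hcop
  refine ⟨sy ℓ (fu E g') * sy ℓ (fu E q) + ω, fun ρ hρ hρm => ?_, ?_⟩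
  · rw [TameData.residue_add, hω ρ hρm, TameData.residue_mul]
    simp only [TameData.residue_sy, TameData.spec_sy, sgn_sy, tameAt_v E hg', tameAt_v E hq0]
    have hfin : ∀ {f : F[X]}, ¬ ρ ∣ f → multiplicity ρ f = 0 := fun h =>
      multiplicity_eq_zero.mpr h
    by_cases hρq : ρ ∣ q
    · have hρg : ¬ ρ ∣ g' := fun h' => hρ.out.not_isUnit (hcop'.isUnit_of_dvd' hρq h')
      have hρh : ¬ ρ ∣ h := fun h' => hρg (hch ▸ h'.mul_left _)
      have e : AdjoinRoot.mk ρ g = AdjoinRoot.mk ρ g' := by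
        rw [AdjoinRoot.mk_eq_mk]
        refine hρq.trans ⟨g / q, ?_⟩
        have := EuclideanDomain.div_add_mod g q
        linear_combination -this
      rw [e, ← (tameAt_of_not_dvd (E := E) ρ hρg).2, sym_coe, hfin hρg, hfin hρh]
      simp [(Nat.cast_commute _ _).eq]
    · have hm : multiplicity ρ g' = multiplicity ρ h := by
        refine multiplicity_eq_of_associated_right ?_
        rw [hch]
        exact (associated_unit_mul_left _ _ (isUnit_C.mpr hc.isUnit))
      rw [← (tameAt_of_not_dvd (E := E) ρ hρq).2, sym_coe, hfin hρq, hm]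
      simp
  · rw [TameData.residue_add, hω', TameData.residue_mul]
    have hvq : (tameInfty F E).v (fu E q) = - (q.natDegree : ℤ) := by
      rw [tameInfty, LeadingData.tameData_v _ _ hq0]; rfl
    have hvac : (tameInfty F E).ac (fu E q) = 1 := by
      ext
      rw [tameInfty, LeadingData.tameData_ac _ _ hq0]; exact hq
    have hac : ((tameInfty F E).ac (fu E g') : F) = c := by
      rw [tameInfty, LeadingData.tameData_ac _ _ hg']; rfl
    simp only [TameData.residue_sy, TameData.spec_sy, sgn_sy, hvq, hvac]
    have hres : q.resultant g = c ^ q.natDegree * ((-1) ^ (q.natDegree * h.natDegree) * h.resultant q) := by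
      rw [resultant_mod hq hg', ← hg'_def, ← resultant_comm]
      conv_lhs => rw [← hdeg, hch, resultant_C_mul_right]
    rw [hres, sym_mul (pow_ne_zero _ hc) (mul_ne_zero (pow_ne_zero _ (by simp))
      (resultant_ne_zero _ _ hcop)), sym_neg_one_pow_mul, sym_pow hc, ← hac, sym_coe]
    simp [(Nat.cast_commute _ _).eq]
    abel

variable {ℓ}


lemma units_map_C (a : Fˣ) :
    Units.map ((algebraMap F[X] E).comp C : F →+* E).toMonoidHom a = fu E (C (a : F)) := by
  ext
  rw [coe_fu (by simp)]
  rfl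

lemma spec_infty_const (y : MilnorRing ℓ F) : (tameInfty F E).spec (map ℓ ((algebraMap F[X] E).comp C) y) = y := by
  have : ((tameInfty F E).specHom (ℓ := ℓ)).comp (map ℓ ((algebraMap F[X] E).comp C)) = RingHom.id _ := by
    refine hom_ext fun a => ?_
    change (tameInfty F E).spec (map ℓ ((algebraMap F[X] E).comp C) (sy ℓ a)) = sy ℓ a
    rw [map_sy, units_map_C, TameData.spec_sy]
    congr 1
    ext
    rw [tameInfty, LeadingData.tameData_ac _ _ (by simp)]
    simp [leadingInfty]
  exact DFunLike.congr_fun this y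

lemma residue_const {F' : Type*} [Field F'] [NegOnePow ℓ F'] (D : TameData E F')
    (h : ∀ a : Fˣ, D.v (fu E (C (a : F))) = 0) (y : MilnorRing ℓ F) : D.residue (map ℓ ((algebraMap F[X] E).comp C) y) = 0 := by
  have hx : y ∈ Subring.closure (Set.range (sy (F := F) ℓ)) := by rw [closure_sy]; trivial
  induction hx using Subring.closure_induction with
  | mem x hx => obtain ⟨a, rfl⟩ := hx; rw [map_sy, units_map_C, TameData.residue_sy, h]; simp
  | zero => simp
  | one => rw [map_one]; simp [TameData.residue]
  | add x y _ _ hx hy => simp [hx, hy]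
  | neg x _ hx => simp [hx]
  | mul x y _ _ hx hy => rw [map_mul, TameData.residue_mul, hx, hy]; simp

lemma residue_infty_const (y : MilnorRing ℓ F) : (tameInfty F E).residue (map ℓ ((algebraMap F[X] E).comp C) y) = 0 := by
  refine residue_const E _ (fun a => ?_) y
  rw [tameInfty, LeadingData.tameData_v _ _ (by simp)]
  simp [leadingInfty]

section

variable (ρ : F[X]) [hρ : Fact (Irreducible ρ)]

lemma not_dvd_C (a : Fˣ) : ¬ ρ ∣ C (a : F) := fun h =>
  hρ.out.not_isUnit (isUnit_of_dvd_unit h (isUnit_C.mpr a.isUnit))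

lemma residue_at_const (y : MilnorRing ℓ F) : (tameAt F E ρ).residue (map ℓ ((algebraMap F[X] E).comp C) y) = 0 :=
  residue_const E _ (fun a => (tameAt_of_not_dvd ρ (not_dvd_C ρ a)).1) y

lemma spec_at_const (y : MilnorRing ℓ F) :
    (tameAt F E ρ).spec (map ℓ ((algebraMap F[X] E).comp C) y) = map ℓ (AdjoinRoot.of ρ) y := by
  have : ((tameAt F E ρ).specHom (ℓ := ℓ)).comp (map ℓ ((algebraMap F[X] E).comp C)) = map ℓ (AdjoinRoot.of ρ) := by
    refine hom_ext fun a => ?_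
    change (tameAt F E ρ).spec (map ℓ ((algebraMap F[X] E).comp C) (sy ℓ a)) = map ℓ (AdjoinRoot.of ρ) (sy ℓ a)
    rw [map_sy, map_sy, units_map_C, TameData.spec_sy]
    congr 1
    ext
    rw [(tameAt_of_not_dvd ρ (not_dvd_C ρ a)).2]
    simp
  exact DFunLike.congr_fun this y

end

/-- The norm principle: if a product vanishes over all residue fields of `q` then its norm
vanishes. -/
theorem mul_sym_resultant_eq_zero {q g : F[X]} (hq : q.Monic) (hqg : IsCoprime q g)
    (β : MilnorRing ℓ F) (h : ∀ (ρ : F[X]) [Fact (Irreducible ρ)], ρ.Monic → ρ ∣ q →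
      map ℓ (AdjoinRoot.of ρ) β * sym ℓ (AdjoinRoot.mk ρ g) = 0) :
    β * sym ℓ (q.resultant g) = 0 := by
  have : NegOnePow ℓ (FractionRing F[X]) :=
    .of_ringHom ((algebraMap F[X] (FractionRing F[X])).comp C)
  obtain ⟨ω, hω, hω'⟩ := exists_reciprocity ℓ (FractionRing F[X]) _ q g rfl hq hqg
  obtain ⟨γ, hγ⟩ := exists_const_of_residue (F := F)
    (x := map ℓ ((algebraMap F[X] (FractionRing F[X])).comp C) β * ω) (fun ρ hρ hρm => by
      rw [TameData.residue_mul, residue_at_const, spec_at_const, hω ρ hρm, zero_mul, zero_add]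
      by_cases hd : ρ ∣ q
      · rw [← mul_assoc, (Nat.cast_commute _ _).eq.symm, mul_assoc, h ρ hρm hd, mul_zero]
      · rw [multiplicity_eq_zero.mpr hd]
        simp)
  have := congrArg (tameInfty F (FractionRing F[X])).residue hγ
  rw [residue_infty_const, TameData.residue_mul, residue_infty_const, spec_infty_const, hω',
    zero_mul, zero_add, mul_neg, neg_eq_zero] at this
  exact this

section Zero

variable {k σ : Type*} [Field k] [IsAlgClosed k] [Finite σ]

lemma height_vanishingIdeal_singleton (x y : σ → k) :
    (MvPolynomial.vanishingIdeal k {x}).height = (MvPolynomial.vanishingIdeal k {y}).height := by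
  let f (z : σ → k) : MvPolynomial σ k →ₐ[k] MvPolynomial σ k :=
    MvPolynomial.aeval fun i => MvPolynomial.X i + MvPolynomial.C (z i)
  have hf : ∀ z, (f z).comp (f (-z)) = AlgHom.id k _ := fun z => by
    ext i
    simp [f]
  let e : MvPolynomial σ k ≃ₐ[k] MvPolynomial σ k :=
    AlgEquiv.ofAlgHom (f (y - x)) (f (x - y)) (by simpa using hf (y - x)) (by simpa using hf (x - y))
  rw [← RingEquiv.height_comap e.toRingEquiv]
  congr 1
  ext p
  rw [Ideal.mem_comap, MvPolynomial.mem_vanishingIdeal_singleton_iff,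
    MvPolynomial.mem_vanishingIdeal_singleton_iff]
  have : (MvPolynomial.aeval x).comp (f (y - x)) = (MvPolynomial.aeval y : _ →ₐ[k] k) := by
    ext i
    simp [f]
  rw [← this]
  rfl

lemma height_vanishingIdeal_zero (x : σ → k) :
    (MvPolynomial.vanishingIdeal k {x}).height = Nat.card σ := by
  have h1 : (⨆ (I : Ideal (MvPolynomial σ k)) (_ : I.IsMaximal), I.height) =
      (MvPolynomial.vanishingIdeal k {x}).height := by
    refine le_antisymm (iSup₂_le fun I hI => ?_) ?_
    · obtain ⟨y, rfl⟩ := MvPolynomial.isMaximal_iff_eq_vanishingIdeal_singleton.mp hI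
      exact (height_vanishingIdeal_singleton y x).le
    · exact le_iSup₂_of_le (MvPolynomial.vanishingIdeal k {x})
        (MvPolynomial.isMaximal_iff_eq_vanishingIdeal_singleton.mpr ⟨x, rfl⟩) le_rfl
  have h2 := Ideal.sup_isMaximal_height_eq_ringKrullDim (R := MvPolynomial σ k)
  rw [h1, MvPolynomial.ringKrullDim_of_isNoetherianRing, ringKrullDim_eq_zero_of_field,
    zero_add] at h2
  exact_mod_cast h2

/-- Polynomials without constant term over an algebraically closed field, fewer in number than the
variables, have a nontrivial common zero. -/
lemma exists_common_zero {ι : Type*} [Fintype ι] (P : ι → MvPolynomial σ k)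
    (h0 : ∀ i, MvPolynomial.eval 0 (P i) = 0) (hc : Fintype.card ι < Nat.card σ) :
    ∃ x : σ → k, x ≠ 0 ∧ ∀ i, MvPolynomial.eval x (P i) = 0 := by
  by_contra! hne
  set I := Ideal.span (Set.range P) with hI
  have hz : MvPolynomial.zeroLocus k I = {0} := by
    ext x
    rw [hI, MvPolynomial.zeroLocus_span]
    constructor
    · intro hx
      by_contra hx0
      obtain ⟨i, hi⟩ := hne x hx0
      exact hi (by simpa using hx _ ⟨i, rfl⟩)
    · rintro rfl _ ⟨i, rfl⟩
      simpa using h0 i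
  have hr : MvPolynomial.vanishingIdeal k ({0} : Set (σ → k)) = I.radical := by
    rw [← hz, MvPolynomial.vanishingIdeal_zeroLocus_eq_radical]
  have hp : (MvPolynomial.vanishingIdeal k ({0} : Set (σ → k))).IsPrime := inferInstance
  have hm : MvPolynomial.vanishingIdeal k ({0} : Set (σ → k)) ∈ I.minimalPrimes := by
    rw [← Ideal.radical_minimalPrimes, ← hr, Ideal.minimalPrimes_eq_subsingleton_self]
    rfl
  have := Ideal.height_le_card_of_mem_minimalPrimes_span (Set.finite_range P) hm
  rw [height_vanishingIdeal_zero] at this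
  have h2 : (Set.range P).ncard ≤ Fintype.card ι := by
    rw [← Set.image_univ, ← Nat.card_eq_fintype_card, ← Set.ncard_univ]
    exact Set.ncard_image_le
  have : Nat.card σ ≤ (Set.range P).ncard := by exact_mod_cast this
  omega

end Zero

section Growth

variable (k M : Type*) [Field k] [Field M] [Algebra k M]

/-- The growth condition satisfied by function fields of transcendence degree at most one. -/
def LinGrowth : Prop :=
  ∀ S : Submodule k M, S.FG → ∀ m : ℕ, 1 ≤ m → ∃ W : Submodule k M, W.FG ∧
    Module.finrank k ↥(S * W ^ m) < (m + 1) * Module.finrank k W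

variable {k M}

lemma mem_range_of_isAlgebraic [IsAlgClosed k] {a : M} (ha : IsAlgebraic k a) :
    a ∈ Set.range (algebraMap k M) := by
  have := IsAlgClosed.degree_eq_one_of_irreducible k (minpoly.irreducible ha.isIntegral)
  exact minpoly.mem_range_of_degree_eq_one k a this

lemma mem_degreeLT_succ {D : ℕ} {u : k[X]} : u ∈ degreeLT k (D + 1) ↔ u.natDegree ≤ D := by
  rw [mem_degreeLT]
  by_cases hu : u = 0
  · simp [hu]
  · rw [← natDegree_lt_iff_degree_lt hu]
    omega

lemma exists_common_denominator {a : M} (ha : IntermediateField.adjoin k {a} = ⊤)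
    {S : Submodule k M} (hS : S.FG) : ∃ (h : k[X]) (C : ℕ), aeval a h ≠ 0 ∧
      ∀ s ∈ S, ∃ p : k[X], p ∈ degreeLT k (C + 1) ∧ s * aeval a h = aeval a p := by
  induction S, hS using Submodule.fg_induction with
  | singleton x =>
    obtain ⟨r, s, hrs⟩ := IntermediateField.mem_adjoin_simple_iff k x |>.mp
      (ha ▸ IntermediateField.mem_top : x ∈ IntermediateField.adjoin k {a})
    by_cases hs : aeval a s = 0
    · refine ⟨1, 0, by simp, fun y hy => ⟨0, zero_mem _, ?_⟩⟩
      rw [hs, div_zero] at hrs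
      subst hrs
      obtain rfl : y = 0 := by simpa using hy
      simp
    · refine ⟨s, r.natDegree, hs, fun y hy => ?_⟩
      obtain ⟨c, rfl⟩ := Submodule.mem_span_singleton.mp hy
      refine ⟨c • r, Submodule.smul_mem _ _ ?_, ?_⟩
      · exact mem_degreeLT_succ.mpr le_rfl
      · rw [hrs, smul_mul_assoc, div_mul_cancel₀ _ hs, map_smul]
  | sup S T hS hT ihS ihT =>
    obtain ⟨h, C, hh, H⟩ := ihS
    obtain ⟨h', C', hh', H'⟩ := ihT
    refine ⟨h * h', C + C' + h.natDegree + h'.natDegree, by simp [hh, hh'], fun y hy => ?_⟩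
    obtain ⟨s, hs, t, ht, rfl⟩ := Submodule.mem_sup.mp hy
    obtain ⟨p, hp, hp'⟩ := H s hs
    obtain ⟨q, hq, hq'⟩ := H' t ht
    rw [mem_degreeLT_succ] at hp hq
    refine ⟨p * h' + q * h, mem_degreeLT_succ.mpr ?_, ?_⟩
    · refine (natDegree_add_le _ _).trans (max_le ?_ ?_)
      · exact natDegree_mul_le.trans (by omega)
      · exact natDegree_mul_le.trans (by omega)
    · rw [map_mul, map_add, map_mul, map_mul, ← hp', ← hq']
      ring

lemma finrank_degreeLT (n : ℕ) : Module.finrank k (degreeLT k n) = n := by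
  rw [(degreeLTEquiv k n).finrank_eq, Module.finrank_fin_fun]

instance (n : ℕ) : Module.Finite k (degreeLT k n) :=
  Module.Finite.equiv (degreeLTEquiv k n).symm

lemma linGrowth_of_adjoin_simple [IsAlgClosed k] {a : M}
    (ha : IntermediateField.adjoin k {a} = ⊤) : LinGrowth k M := by
  intro S hS m hm
  by_cases hal : IsAlgebraic k a
  · have hbij : Function.Surjective (algebraMap k M) := by
      obtain ⟨c, rfl⟩ := mem_range_of_isAlgebraic hal
      intro x
      have hx : x ∈ IntermediateField.adjoin k {algebraMap k M c} := ha ▸ IntermediateField.mem_top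
      rwa [IntermediateField.adjoin_simple_eq_bot_iff.mpr (algebraMap_mem _ _),
        IntermediateField.mem_bot] at hx
    have h1 : Module.finrank k M = 1 := by
      refine finrank_eq_one (1 : M) one_ne_zero fun w => ?_
      obtain ⟨c, rfl⟩ := hbij w
      exact ⟨c, by rw [Algebra.smul_def, mul_one]⟩
    have : FiniteDimensional k M := Module.finite_of_finrank_eq_succ h1
    refine ⟨⊤, IsNoetherian.noetherian _, ?_⟩
    rw [finrank_top, h1]
    exact (Submodule.finrank_le _).trans_lt (by omega)
  obtain ⟨h, C, hh, H⟩ := exists_common_denominator ha hS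
  have hinj : Function.Injective (aeval (R := k) a) := transcendental_iff_injective.mp hal
  set L : k[X] →ₗ[k] M := (aeval (R := k) a).toLinearMap with hL
  have hLinj : Function.Injective L := hinj
  have hpow : ∀ n, ((degreeLT k (C + 1)).map L) ^ n ≤ (degreeLT k (n * C + 1)).map L := by
    intro n
    induction n with
    | zero =>
      rw [pow_zero, Submodule.one_le]
      exact ⟨1, mem_degreeLT_succ.mpr (by simp), by simp [hL]⟩
    | succ n ih =>
      rw [pow_succ]
      refine (mul_le_mul_left ih _).trans (Submodule.mul_le.mpr ?_)
      rintro _ ⟨p, hp, rfl⟩ _ ⟨q, hq, rfl⟩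
      refine ⟨p * q, ?_, by simp [hL]⟩
      simp only [SetLike.mem_coe, mem_degreeLT_succ] at hp hq ⊢
      refine natDegree_mul_le.trans ?_
      have : (n + 1) * C = n * C + C := by ring
      omega
  refine ⟨(degreeLT k (C + 1)).map L, (Module.Finite.iff_fg.mp inferInstance).map _, ?_⟩
  rw [← (Submodule.equivMapOfInjective L hLinj _).finrank_eq, finrank_degreeLT]
  have hle : S * (degreeLT k (C + 1)).map L ^ m ≤ (degreeLT k (C + m * C + 1)).map
      ((LinearMap.mulLeft k (aeval a h)⁻¹).comp L) := by
    refine (mul_le_mul_right (hpow m) _).trans (Submodule.mul_le.mpr ?_)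
    rintro s hs _ ⟨q, hq, rfl⟩
    obtain ⟨p, hp, hp'⟩ := H s hs
    refine ⟨p * q, ?_, ?_⟩
    · simp only [SetLike.mem_coe, mem_degreeLT_succ] at hp hq ⊢
      exact natDegree_mul_le.trans (by omega)
    · simp only [LinearMap.comp_apply, LinearMap.mulLeft_apply, hL, AlgHom.toLinearMap_apply,
        map_mul, ← hp']
      field_simp
  have : Module.Finite k ↥((degreeLT k (C + m * C + 1)).map
      ((LinearMap.mulLeft k (aeval a h)⁻¹).comp L)) := inferInstance
  have h2 := (Submodule.finrank_mono hle).trans (Submodule.finrank_map_le _ _)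
  rw [finrank_degreeLT] at h2
  have : (m + 1) * (C + 1) = C + m * C + 1 + m := by ring
  omega

section Ext

variable {M₁ ι : Type*} [Field M₁] [Algebra k M₁] [Algebra M M₁] [IsScalarTower k M M₁] [Finite ι]
  (b : Module.Basis ι M M₁)

/-- The elements of an extension whose coordinates lie in a given subspace. -/
def coordSub (V : Submodule k M) : Submodule k M₁ where
  carrier := {x | ∀ i, b.repr x i ∈ V}
  add_mem' hx hy i := by
    rw [map_add, Finsupp.add_apply]
    exact V.add_mem (hx i) (hy i)
  zero_mem' i := by simp
  smul_mem' c x hx i := by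
    rw [← algebraMap_smul M c x, map_smul, Finsupp.smul_apply, algebraMap_smul]
    exact V.smul_mem c (hx i)

/-- The elements with coordinates in a given subspace are families of elements of it. -/
def coordSubEquiv (V : Submodule k M) : coordSub b V ≃ₗ[k] (ι → V) where
  toFun x i := ⟨b.repr x i, x.2 i⟩
  invFun f := ⟨b.equivFun.symm fun i => f i, fun i => by
    rw [← b.equivFun_apply, LinearEquiv.apply_symm_apply]
    exact (f i).2⟩
  left_inv x := by
    ext
    exact b.equivFun.symm_apply_apply (x : M₁)
  right_inv f := by
    ext i
    exact congrFun (b.equivFun.apply_symm_apply fun i => (f i : M)) i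
  map_add' x y := by ext; simp
  map_smul' c x := by
    ext i
    change b.repr (c • (x : M₁)) i = c • b.repr (x : M₁) i
    rw [← algebraMap_smul M c (x : M₁), map_smul, Finsupp.smul_apply, algebraMap_smul]

lemma finrank_coordSub {V : Submodule k M} (hV : V.FG) :
    Module.finrank k (coordSub b V) = Nat.card ι * Module.finrank k V := by
  have := Fintype.ofFinite ι
  have : Module.Finite k V := Module.Finite.iff_fg.mpr hV
  rw [(coordSubEquiv b V).finrank_eq, Module.finrank_pi_fintype]
  simp

lemma finite_coordSub {V : Submodule k M} (hV : V.FG) : (coordSub b V).FG := by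
  have : Module.Finite k V := Module.Finite.iff_fg.mpr hV
  rw [← Module.Finite.iff_fg]
  exact Module.Finite.equiv (coordSubEquiv b V).symm

variable (k) in
/-- The span of the structure constants. -/
def structSub : Submodule k M :=
  Submodule.span k (Set.range (fun i => b.repr 1 i) ∪
    Set.range fun p : ι × ι × ι => b.repr (b p.1 * b p.2.1) p.2.2)

lemma structSub_fg : (structSub k b).FG :=
  Submodule.fg_span ((Set.finite_range _).union (Set.finite_range _))

lemma one_mem_coordSub : 1 ∈ coordSub b (structSub k b) := fun i =>
  Submodule.subset_span (Or.inl ⟨i, rfl⟩)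

lemma coordSub_mul_le (V V' : Submodule k M) :
    coordSub b V * coordSub b V' ≤ coordSub b (structSub k b * (V * V')) := by
  have := Fintype.ofFinite ι
  refine Submodule.mul_le.mpr fun x hx y hy l => ?_
  have hxy : b.repr (x * y) l = ∑ i, ∑ j,
      b.repr (b i * b j) l * (b.repr x i * b.repr y j) := by
    conv_lhs => rw [← b.sum_repr x, ← b.sum_repr y, Finset.sum_mul_sum]
    simp only [map_sum, Finsupp.coe_finsetSum, Finset.sum_apply, smul_mul_smul_comm, map_smul,
      Finsupp.smul_apply, smul_eq_mul]
    exact Finset.sum_congr rfl fun i _ => Finset.sum_congr rfl fun j _ => mul_comm _ _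
  rw [hxy]
  refine Submodule.sum_mem _ fun i _ => Submodule.sum_mem _ fun j _ => ?_
  exact Submodule.mul_mem_mul (Submodule.subset_span (Or.inr ⟨(i, j, l), rfl⟩))
    (Submodule.mul_mem_mul (hx i) (hy j))

lemma coordSub_mono {V V' : Submodule k M} (h : V ≤ V') : coordSub b V ≤ coordSub b V' :=
  fun _ hx i => h (hx i)

lemma coordSub_pow_le (V : Submodule k M) (n : ℕ) :
    coordSub b V ^ n ≤ coordSub b (structSub k b ^ (n + 1) * V ^ n) := by
  induction n with
  | zero =>
    rw [pow_zero, Submodule.one_le]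
    simpa using one_mem_coordSub b
  | succ n ih =>
    rw [pow_succ]
    refine (mul_le_mul_left ih _).trans ((coordSub_mul_le b _ _).trans (coordSub_mono b ?_))
    exact le_of_eq (by ring)

lemma exists_le_coordSub {S : Submodule k M₁} (hS : S.FG) :
    ∃ S' : Submodule k M, S'.FG ∧ S ≤ coordSub b S' := by
  refine ⟨⨆ i, S.map ((b.coord i).restrictScalars k), ?_, fun x hx i => ?_⟩
  · exact Submodule.fg_iSup _ fun i => hS.map _
  · exact Submodule.mem_iSup_of_mem i ⟨x, hx, rfl⟩

lemma LinGrowth.of_basis [Nonempty ι] (b : Module.Basis ι M M₁) (h : LinGrowth k M) : LinGrowth k M₁ := by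
  intro S hS m hm
  obtain ⟨S', hS', hle⟩ := exists_le_coordSub b hS
  have hfg : (structSub k b * (S' * structSub k b ^ (m + 1))).FG :=
    (structSub_fg b).mul (hS'.mul ((structSub_fg b).pow _))
  obtain ⟨W, hW, hlt⟩ := h _ hfg m hm
  refine ⟨coordSub b W, finite_coordSub b hW, ?_⟩
  rw [finrank_coordSub b hW]
  have h1 : S * coordSub b W ^ m ≤
      coordSub b (structSub k b * (S' * structSub k b ^ (m + 1)) * W ^ m) := by
    refine (mul_le_mul' hle (coordSub_pow_le b W m)).trans
      ((coordSub_mul_le b _ _).trans (coordSub_mono b (le_of_eq (by ring))))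
  have h2 : Module.Finite k ↥(coordSub b (structSub k b * (S' * structSub k b ^ (m + 1)) * W ^ m)) :=
    Module.Finite.iff_fg.mpr (finite_coordSub (ι := ι) b (hfg.mul (hW.pow _)))
  refine (Submodule.finrank_mono h1).trans_lt ?_
  rw [finrank_coordSub (ι := ι) b (hfg.mul (hW.pow _)),
    mul_left_comm (m + 1)]
  exact Nat.mul_lt_mul_of_pos_left hlt (Nat.card_pos (α := ι))

end Ext

lemma LinGrowth.adjoinRoot (h : LinGrowth k M) {q : M[X]} [hq : Fact (Irreducible q)] :
    LinGrowth k (AdjoinRoot q) := by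
  have hpos : 0 < q.natDegree := hq.out.natDegree_pos
  have : Nonempty (Fin (AdjoinRoot.powerBasis hq.out.ne_zero).dim) := by
    rw [AdjoinRoot.powerBasis_dim]
    exact ⟨⟨0, hpos⟩⟩
  exact LinGrowth.of_basis (AdjoinRoot.powerBasis hq.out.ne_zero).basis h

end Growth

section Tsen

variable {k M τ : Type*} [Field k] [Field M] [Algebra k M]

/-- The polynomials all of whose coefficients lie in a given subspace. -/
def coefSub (τ : Type*) (U : Submodule k M) : Submodule k (MvPolynomial τ M) where
  carrier := {p | ∀ s, p.coeff s ∈ U}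
  add_mem' hp hq s := by
    rw [MvPolynomial.coeff_add]
    exact U.add_mem (hp s) (hq s)
  zero_mem' s := by simp
  smul_mem' c p hp s := by
    rw [MvPolynomial.coeff_smul]
    exact U.smul_mem c (hp s)

lemma coefSub_mul_mem {U V : Submodule k M} {p q : MvPolynomial τ M} (hp : p ∈ coefSub τ U)
    (hq : q ∈ coefSub τ V) : p * q ∈ coefSub τ (U * V) := by
  classical
  intro s
  rw [MvPolynomial.coeff_mul]
  exact Submodule.sum_mem _ fun x _ => Submodule.mul_mem_mul (hp _) (hq _)

lemma one_mem_coefSub : 1 ∈ coefSub τ (1 : Submodule k M) := by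
  classical
  intro s
  rw [MvPolynomial.coeff_one]
  split_ifs
  · exact Submodule.one_le.mp le_rfl
  · exact zero_mem _

lemma coefSub_prod_mem {ι : Type*} (s : Finset ι) {U : Submodule k M} {p : ι → MvPolynomial τ M}
    (hp : ∀ i ∈ s, p i ∈ coefSub τ U) : ∏ i ∈ s, p i ∈ coefSub τ (U ^ s.card) := by
  classical
  induction s using Finset.induction_on with
  | empty => simpa using one_mem_coefSub
  | insert i s hi ih =>
    rw [Finset.prod_insert hi, Finset.card_insert_of_notMem hi, pow_succ']
    exact coefSub_mul_mem (hp i (s.mem_insert_self i)) (ih fun j hj => hp j (s.mem_insert_of_mem hj))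

lemma coefSub_mono {U V : Submodule k M} (h : U ≤ V) : coefSub τ U ≤ coefSub τ V :=
  fun _ hp s => h (hp s)

lemma C_mem_coefSub {U : Submodule k M} {a : M} (ha : a ∈ U) : MvPolynomial.C a ∈ coefSub τ U := by
  classical
  intro s
  rw [MvPolynomial.coeff_C]
  split_ifs
  · exact ha
  · exact zero_mem _

lemma X_mul_C_mem_coefSub {U : Submodule k M} {a : M} (ha : a ∈ U) (i : τ) :
    MvPolynomial.C a * MvPolynomial.X i ∈ coefSub τ U := by
  classical
  intro s
  rw [MvPolynomial.coeff_C_mul, MvPolynomial.coeff_X]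
  split_ifs
  · simpa using ha
  · simp

lemma exists_zero_of_mem_coefSub [IsAlgClosed k] [Finite τ] {U : Submodule k M} (hU : U.FG)
    {f : MvPolynomial τ M} (hf : f ∈ coefSub τ U) (h0 : MvPolynomial.eval 0 f = 0)
    (hc : Module.finrank k U < Nat.card τ) :
    ∃ c : τ → k, c ≠ 0 ∧ MvPolynomial.eval (fun i => algebraMap k M (c i)) f = 0 := by
  have : Module.Finite k U := Module.Finite.iff_fg.mpr hU
  obtain ⟨Φ, hΦ⟩ := LinearMap.exists_extend (Module.finBasis k U).equivFun.toLinearMap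
  let P (u : Fin (Module.finrank k U)) : MvPolynomial τ k :=
    ∑ s ∈ f.support, MvPolynomial.monomial s (Φ (f.coeff s) u)
  have hev : ∀ u c, MvPolynomial.eval c (P u) =
      Φ (MvPolynomial.eval (fun i => algebraMap k M (c i)) f) u := by
    intro u c
    simp only [P]
    rw [map_sum, MvPolynomial.eval_eq, map_sum, Finset.sum_apply]
    refine Finset.sum_congr rfl fun s _ => ?_
    rw [MvPolynomial.eval_monomial, mul_comm (f.coeff s)]
    simp_rw [← map_pow]
    rw [← map_prod, ← Algebra.smul_def, map_smul, Pi.smul_apply, smul_eq_mul, mul_comm]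
    rfl
  obtain ⟨c, hc0, hc⟩ := exists_common_zero P (fun u => by
    rw [hev]
    have : (fun i : τ => algebraMap k M ((0 : τ → k) i)) = 0 := by ext; simp
    rw [this, h0]
    simp) (by simpa using hc)
  refine ⟨c, hc0, ?_⟩
  have hmem : MvPolynomial.eval (fun i => algebraMap k M (c i)) f ∈ U := by
    rw [MvPolynomial.eval_eq]
    refine Submodule.sum_mem _ fun s _ => ?_
    simp_rw [← map_pow]
    rw [← map_prod, mul_comm, ← Algebra.smul_def]
    exact U.smul_mem _ (hf s)
  have h1 : (Module.finBasis k U).equivFun ⟨_, hmem⟩ = 0 := by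
    have := LinearMap.congr_fun hΦ ⟨_, hmem⟩
    ext u
    rw [← LinearEquiv.coe_coe, ← this]
    exact (hev u c).symm.trans (hc u)
  have := (LinearEquiv.map_eq_zero_iff _).mp h1
  simpa using this

lemma resultant_mem_coefSub {U V : Submodule k M} {q g : (MvPolynomial τ M)[X]} (m n : ℕ)
    (hq : ∀ i, q.coeff i ∈ coefSub τ U) (hg : ∀ i, g.coeff i ∈ coefSub τ V) :
    q.resultant g m n ∈ coefSub τ (U ^ n * V ^ m) := by
  rw [resultant, Matrix.det_apply]
  refine Submodule.sum_mem _ fun σ _ => ?_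
  have : ∏ i, q.sylvester g m n (σ i) i ∈ coefSub τ (U ^ n * V ^ m) := by
    rw [Fin.prod_univ_add, mul_comm (U ^ n)]
    refine coefSub_mul_mem ?_ ?_
    · have := coefSub_prod_mem (τ := τ) (U := V) (Finset.univ : Finset (Fin m))
        (p := fun j => q.sylvester g m n (σ (Fin.castAdd n j)) (Fin.castAdd n j)) (fun j _ => by
          rw [sylvester, Matrix.of_apply, Fin.addCases_left]
          split_ifs
          · exact hg _
          · exact zero_mem _)
      simpa using this
    · have := coefSub_prod_mem (τ := τ) (U := U) (Finset.univ : Finset (Fin n))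
        (p := fun j => q.sylvester g m n (σ (Fin.natAdd m j)) (Fin.natAdd m j)) (fun j _ => by
          rw [sylvester, Matrix.of_apply, Fin.addCases_right]
          split_ifs
          · exact hq _
          · exact zero_mem _)
      simpa using this
  rcases Int.units_eq_one_or (Equiv.Perm.sign σ) with h | h <;> rw [h]
  · simpa using this
  · simpa using neg_mem this

/-- Norms from simple extensions are surjective over fields of linear growth. -/
theorem LinGrowth.exists_resultant_eq [IsAlgClosed k] (h : LinGrowth k M) {q : M[X]}
    (hq : q.Monic) (hqi : Irreducible q) {z : M} (hz : z ≠ 0) :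
    ∃ g : M[X], g.natDegree < q.natDegree ∧ q.resultant g = z := by
  obtain ⟨m, hm⟩ : ∃ m, q.natDegree = m + 1 := ⟨_, (Nat.succ_pred hqi.natDegree_pos.ne').symm⟩
  let S₀ : Submodule k M := Submodule.span k (Set.range fun i : Fin (m + 2) => q.coeff i)
  have hS₀ : S₀.FG := Submodule.fg_span (Set.finite_range _)
  have hqS : ∀ i, q.coeff i ∈ S₀ := fun i => by
    by_cases hi : i < m + 2
    · exact Submodule.subset_span ⟨⟨i, hi⟩, rfl⟩
    · rw [coeff_eq_zero_of_natDegree_lt (by omega)]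
      exact zero_mem _
  obtain ⟨W, hW, hlt⟩ := h (S₀ ^ m ⊔ Submodule.span k {z})
    ((hS₀.pow m).sup (Submodule.fg_span_singleton z)) (m + 1) (by omega)
  have : Module.Finite k W := Module.Finite.iff_fg.mpr hW
  let τ := Fin (m + 2) × Fin (Module.finrank k W)
  let w := Module.finBasis k W
  let x (i : Fin (m + 2)) : MvPolynomial τ M :=
    ∑ j, MvPolynomial.C ((w j : W) : M) * MvPolynomial.X (i, j)
  have hx : ∀ i, x i ∈ coefSub τ W := fun i =>
    Submodule.sum_mem _ fun j _ => X_mul_C_mem_coefSub (w j).2 _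
  let G : (MvPolynomial τ M)[X] := ∑ i : Fin (m + 1), monomial (i : ℕ) (x i.castSucc)
  let f : MvPolynomial τ M := (q.map MvPolynomial.C).resultant G (m + 1) m -
    MvPolynomial.C z * x (Fin.last _) ^ (m + 1)
  have hf : f ∈ coefSub τ ((S₀ ^ m ⊔ Submodule.span k {z}) * W ^ (m + 1)) := by
    refine Submodule.sub_mem _ ?_ ?_
    · refine coefSub_mono (mul_le_mul_left (le_sup_left) _) (resultant_mem_coefSub _ _ ?_ ?_)
      · intro i
        rw [coeff_map]
        exact C_mem_coefSub (hqS i)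
      · intro i
        rw [finsetSum_coeff]
        refine Submodule.sum_mem _ fun j _ => ?_
        rw [coeff_monomial]
        split_ifs
        · exact hx _
        · exact zero_mem _
    · refine coefSub_mul_mem (C_mem_coefSub (le_sup_right (a := S₀ ^ m)
        (Submodule.mem_span_singleton_self z))) ?_
      simpa using coefSub_prod_mem (Finset.univ : Finset (Fin (m + 1)))
        (p := fun _ => x (Fin.last _)) (fun _ _ => hx _)
  let y (c : τ → M) (i : Fin (m + 2)) : M := ∑ j, ((w j : W) : M) * c (i, j)
  let g (c : τ → M) : M[X] := ∑ i : Fin (m + 1), monomial (i : ℕ) (y c i.castSucc)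
  have hev : ∀ c : τ → M, MvPolynomial.eval c f =
      q.resultant (g c) (m + 1) m - z * y c (Fin.last _) ^ (m + 1) := by
    intro c
    have hxy : ∀ i, MvPolynomial.eval c (x i) = y c i := fun i => by simp [x, y]
    have hG : G.map (MvPolynomial.eval c) = g c := by
      simp [G, g, Polynomial.map_sum, hxy]
    rw [map_sub, ← resultant_map_map, hG, Polynomial.map_map, map_mul, map_pow, hxy, MvPolynomial.eval_C]
    congr 2
    convert Polynomial.map_id
    ext a
    simp
  obtain ⟨c, hc0, hc⟩ := exists_zero_of_mem_coefSub (((hS₀.pow m).sup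
    (Submodule.fg_span_singleton z)).mul (hW.pow (m + 1))) hf (by
      rw [hev]
      have hy : y 0 = 0 := by ext; simp [y]
      have hg : g 0 = 0 := by simp [g, hy]
      rw [hg, hy]
      simp) (by simpa [τ] using hlt)
  rw [hev] at hc
  set c' : τ → M := fun i => algebraMap k M (c i) with hc'
  have hgdeg : (g c').natDegree ≤ m :=
    natDegree_sum_le_of_forall_le _ _ fun i _ => (natDegree_monomial_le _).trans (by omega)
  have hres : q.resultant (g c') (m + 1) m = q.resultant (g c') := by
    obtain ⟨d, hd⟩ := Nat.exists_eq_add_of_le hgdeg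
    have := resultant_add_right_deg q (g c') (m + 1) (g c').natDegree d le_rfl
    rw [← hd] at this
    rw [this, ← hm, coeff_natDegree, hq.leadingCoeff, one_pow, one_mul]
  have hy0 : y c' (Fin.last _) ≠ 0 := by
    intro hy0
    rw [hy0, zero_pow (by omega), mul_zero, sub_zero, hres, resultant_eq_zero_iff] at hc
    have hdvd : q ∣ g c' := by
      by_contra hnd
      exact hc.2 ((hqi.coprime_iff_not_dvd).mpr hnd)
    have hg0 : g c' = 0 := eq_zero_of_dvd_of_natDegree_lt hdvd (by omega)
    have hy : ∀ i, y c' i = 0 := by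
      intro i
      refine Fin.lastCases hy0 (fun i => ?_) i
      have := congrArg (fun p => p.coeff i) hg0
      simpa [g, coeff_monomial, Fin.val_inj] using this
    refine hc0 (funext fun ⟨i, j⟩ => ?_)
    have hli := w.linearIndependent
    rw [Fintype.linearIndependent_iff] at hli
    refine hli (fun j => c (i, j)) ?_ j
    ext
    have := hy i
    simp only [y, hc'] at this
    simpa [Algebra.smul_def, mul_comm] using this
  refine ⟨C (y c' (Fin.last _))⁻¹ * g c', ?_, ?_⟩
  · exact (natDegree_C_mul_le _ _).trans_lt (by omega)
  · have hdeg : (C (y c' (Fin.last _))⁻¹ * g c').natDegree = (g c').natDegree :=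
      natDegree_C_mul (inv_ne_zero hy0)
    rw [hdeg, resultant_C_mul_right, ← hres, sub_eq_zero.mp hc, hm,
      mul_left_comm, ← mul_pow, inv_mul_cancel₀ hy0, one_pow, mul_one]

end Tsen

section Split

variable {ℓ : ℕ} {F : Type u} [Field F]

/-- An element of the Milnor ring of `F` that vanishes over every extension of `F` splitting some
fixed nonzero polynomial over the subfield `M`. -/
def SplitVanish {M : Type v} [Field M] (i : M →+* F) (β : MilnorRing ℓ F) : Prop :=
  ∃ h : M[X], h ≠ 0 ∧ ∀ (F' : Type u) [Field F'] (j : F →+* F'),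
    (h.map (j.comp i)).Splits → map ℓ j β = 0

lemma SplitVanish.map {M : Type v} {M₁ : Type*} [Field M] [Field M₁] {F₁ : Type u} [Field F₁]
    {i : M →+* F} {β : MilnorRing ℓ F} (hβ : SplitVanish i β) (φ : M →+* M₁) (j : F →+* F₁)
    (i₁ : M₁ →+* F₁) (hc : i₁.comp φ = j.comp i) : SplitVanish i₁ (map ℓ j β) := by
  obtain ⟨h, h0, H⟩ := hβ
  refine ⟨h.map φ, (Polynomial.map_ne_zero_iff φ.injective).mpr h0, fun F' _ j' hs => ?_⟩
  rw [map_map]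
  refine H F' _ ?_
  rwa [Polynomial.map_map, RingHom.comp_assoc, hc, ← RingHom.comp_assoc] at hs

lemma mul_sym_eq_zero_of_splits {k : Type*} [Field k] [IsAlgClosed k] (n : ℕ) :
    ∀ {M : Type v} [Field M] [Algebra k M], LinGrowth k M →
    ∀ {F : Type u} [Field F] [NegOnePow ℓ F] (i : M →+* F) (β : MilnorRing ℓ F) (h : M[X]),
      h.natDegree ≤ n → h ≠ 0 → (∀ (F' : Type u) [Field F'] (j : F →+* F'),
        (h.map (j.comp i)).Splits → MilnorRing.map ℓ j β = 0) →
      ∀ z : M, β * sym ℓ (i z) = 0 := by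
  induction n with
  | zero =>
    intro M _ _ hM F _ _ i β h hn h0 H z
    have := H F (RingHom.id F) (Splits.of_natDegree_eq_zero (by
      rw [natDegree_map]; omega))
    rw [map_id] at this
    rw [show β = 0 from this, zero_mul]
  | succ n ih =>
    intro M _ _ hM F _ _ i β h hn h0 H z
    by_cases hd : h.natDegree = 0
    · have := H F (RingHom.id F) (Splits.of_natDegree_eq_zero (by
        rw [natDegree_map]; omega))
      rw [map_id] at this
      rw [show β = 0 from this, zero_mul]
    by_cases hz : z = 0
    · rw [hz, map_zero, sym_zero, mul_zero]
    obtain ⟨q, hqm, hqi, hqh⟩ := exists_monic_irreducible_factor h fun hu =>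
      hd (natDegree_eq_zero_of_isUnit hu)
    obtain ⟨g, hg, hres⟩ := hM.exists_resultant_eq hqm hqi hz
    have hcop : IsCoprime q g := by
      by_contra hnc
      exact hz (hres ▸ resultant_eq_zero_iff.mpr ⟨Or.inl hqm.ne_zero, hnc⟩)
    have : Fact (Irreducible q) := ⟨hqi⟩
    have hroot : (h.map (AdjoinRoot.of q)).IsRoot (AdjoinRoot.root q) := by
      obtain ⟨h', rfl⟩ := hqh
      rw [Polynomial.map_mul]
      exact root_mul_right_of_isRoot _ (AdjoinRoot.isRoot_root q)
    obtain ⟨h₁, hh₁⟩ := dvd_iff_isRoot.mpr hroot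
    have h₁0 : h₁ ≠ 0 := by
      rintro rfl
      rw [mul_zero, Polynomial.map_eq_zero] at hh₁
      exact h0 hh₁
    have hdeg : h₁.natDegree ≤ n := by
      have := congrArg natDegree hh₁
      rw [natDegree_map, natDegree_mul (X_sub_C_ne_zero _) h₁0, natDegree_X_sub_C] at this
      omega
    have key := mul_sym_resultant_eq_zero (q := q.map i) (g := g.map i) (hqm.map i)
      (hcop.map (mapRingHom i)) β (fun ρ hρ hρm hρq => by
        have hlift : eval₂ ((AdjoinRoot.of ρ).comp i) (AdjoinRoot.root ρ) q = 0 := by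
          obtain ⟨s, hs⟩ := hρq
          rw [← eval₂_map, hs, eval₂_mul, AdjoinRoot.eval₂_root, zero_mul]
        have := ih (LinGrowth.adjoinRoot hM (q := q))
          (AdjoinRoot.lift ((AdjoinRoot.of ρ).comp i) (AdjoinRoot.root ρ) hlift)
          (MilnorRing.map ℓ (AdjoinRoot.of ρ) β) h₁ hdeg h₁0 (fun F' _ j hs => by
            rw [map_map]
            refine H F' _ ?_
            have he : ((j.comp (AdjoinRoot.lift ((AdjoinRoot.of ρ).comp i)
                (AdjoinRoot.root ρ) hlift)).comp (AdjoinRoot.of q)) =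
                (j.comp (AdjoinRoot.of ρ)).comp i := by
              ext x
              simp
            rw [← he, ← Polynomial.map_map, hh₁, Polynomial.map_mul]
            exact ((Splits.X_sub_C _).map _).mul hs) (AdjoinRoot.mk q g)
        rw [AdjoinRoot.lift_mk, ← eval₂_map] at this
        rwa [← AdjoinRoot.aeval_eq, aeval_def, AdjoinRoot.algebraMap_eq])
    rwa [resultant, natDegree_map, natDegree_map, ← resultant, resultant_map_map, hres] at key

theorem SplitVanish.mul_sym_eq_zero {k : Type*} [Field k] [IsAlgClosed k] {M : Type v} [Field M]
    [Algebra k M] (hM : LinGrowth k M) [NegOnePow ℓ F] {i : M →+* F} {β : MilnorRing ℓ F}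
    (hβ : SplitVanish i β) (z : M) : β * sym ℓ (i z) = 0 := by
  obtain ⟨h, h0, H⟩ := hβ
  exact mul_sym_eq_zero_of_splits _ hM i β h le_rfl h0 H z

end Split

section Compact

variable {ℓ : ℕ} {F Ω : Type*} [Field F] [Field Ω] [Algebra F Ω]

/-- Families indexed by finite subsets that vanish eventually. -/
def eventuallyZero (T : Set Ω) :
    Ideal (∀ S : {S : Finset Ω // (S : Set Ω) ⊆ T}, MilnorRing ℓ (IntermediateField.adjoin F (S.1 : Set Ω))) where
  carrier := {f | ∃ S₀ : Finset Ω, (S₀ : Set Ω) ⊆ T ∧ ∀ S, S₀ ⊆ S.1 → f S = 0}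
  add_mem' := by
    classical
    rintro f g ⟨S, hS, hf⟩ ⟨S', hS', hg⟩
    refine ⟨S ∪ S', by simp [hS, hS'], fun U hU => ?_⟩
    rw [Pi.add_apply, hf U (Finset.union_subset_left hU), hg U (Finset.union_subset_right hU),
      add_zero]
  zero_mem' := ⟨∅, by simp, fun _ _ => rfl⟩
  smul_mem' := by
    rintro c f ⟨S, hS, hf⟩
    refine ⟨S, hS, fun U hU => ?_⟩
    rw [smul_eq_mul, Pi.mul_apply, hf U hU, mul_zero]

instance (T : Set Ω) : (eventuallyZero (ℓ := ℓ) (F := F) T).IsTwoSided where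
  mul_mem_of_left := by
    rintro f c ⟨S, hS, hf⟩
    refine ⟨S, hS, fun U hU => ?_⟩
    rw [Pi.mul_apply, hf U hU, zero_mul]

open Classical in
/-- The symbol of an element of the big field in each of the finitely generated subfields. -/
def stageSym (ℓ : ℕ) (F : Type*) {Ω : Type*} [Field F] [Field Ω] [Algebra F Ω] (T : Set Ω) (a : Ω)
    (S : {S : Finset Ω // (S : Set Ω) ⊆ T}) :
    MilnorRing ℓ (IntermediateField.adjoin F (S.1 : Set Ω)) :=
  if h : a ∈ IntermediateField.adjoin F (S.1 : Set Ω) then sym ℓ ⟨a, h⟩ else 0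

lemma stageSym_of_mem {T : Set Ω} {a : Ω} {S : {S : Finset Ω // (S : Set Ω) ⊆ T}}
    (h : a ∈ IntermediateField.adjoin F (S.1 : Set Ω)) :
    stageSym ℓ F T a S = sym ℓ ⟨a, h⟩ := dif_pos h

lemma exists_stage {T : Set Ω} (a : IntermediateField.adjoin F T) :
    ∃ S₀ : Finset Ω, (S₀ : Set Ω) ⊆ T ∧ ∀ S : {S : Finset Ω // (S : Set Ω) ⊆ T}, S₀ ⊆ S.1 →
      (a : Ω) ∈ IntermediateField.adjoin F (S.1 : Set Ω) := by
  obtain ⟨S₀, h, h'⟩ := IntermediateField.exists_finset_of_mem_adjoin a.2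
  exact ⟨S₀, h, fun S hS => IntermediateField.adjoin.mono F _ _ (Finset.coe_subset.mpr hS) h'⟩

/-- The comparison from the Milnor ring of a compositum to the eventual families. -/
def stageHom (ℓ : ℕ) (F : Type*) {Ω : Type*} [Field F] [Field Ω] [Algebra F Ω] (T : Set Ω) :
    MilnorRing ℓ (IntermediateField.adjoin F T) →+*
      (∀ S : {S : Finset Ω // (S : Set Ω) ⊆ T}, MilnorRing ℓ (IntermediateField.adjoin F (S.1 : Set Ω))) ⧸
        eventuallyZero (ℓ := ℓ) (F := F) T :=
  lift (fun a => Ideal.Quotient.mk _ (stageSym ℓ F T ((a : IntermediateField.adjoin F T) : Ω)))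
    (fun a b => by
      classical
      rw [← map_add, Ideal.Quotient.mk_eq_mk_iff_sub_mem]
      obtain ⟨S, hS, h⟩ := exists_stage (a : IntermediateField.adjoin F T)
      obtain ⟨S', hS', h'⟩ := exists_stage (b : IntermediateField.adjoin F T)
      refine ⟨S ∪ S', by simp [hS, hS'], fun U hU => ?_⟩
      have ha := h U (Finset.union_subset_left hU)
      have hb := h' U (Finset.union_subset_right hU)
      have hab : (((a * b : (IntermediateField.adjoin F T)ˣ) : IntermediateField.adjoin F T) : Ω) ∈
          IntermediateField.adjoin F (U.1 : Set Ω) := by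
        simpa using mul_mem ha hb
      rw [Pi.sub_apply, Pi.add_apply, stageSym_of_mem ha, stageSym_of_mem hb, stageSym_of_mem hab,
        ← sym_mul, sub_eq_zero]
      · congr 1
      · simp [Subtype.ext_iff]
      · simp [Subtype.ext_iff])
    (fun a b hab => by
      classical
      rw [← map_mul, Ideal.Quotient.eq_zero_iff_mem]
      obtain ⟨S, hS, h⟩ := exists_stage (a : IntermediateField.adjoin F T)
      obtain ⟨S', hS', h'⟩ := exists_stage (b : IntermediateField.adjoin F T)
      refine ⟨S ∪ S', by simp [hS, hS'], fun U hU => ?_⟩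
      have ha := h U (Finset.union_subset_left hU)
      have hb := h' U (Finset.union_subset_right hU)
      rw [Pi.mul_apply, stageSym_of_mem ha, stageSym_of_mem hb,
        sym_of_ne (by simp [Subtype.ext_iff]), sym_of_ne (by simp [Subtype.ext_iff])]
      refine sy_steinberg ?_
      have := congrArg Subtype.val hab
      simpa [Subtype.ext_iff] using this)
    (by
      rw [← map_natCast (Ideal.Quotient.mk _), Ideal.Quotient.eq_zero_iff_mem]
      refine ⟨∅, by simp, fun U _ => ?_⟩
      exact natCast_self)

/-- An element vanishing over a compositum vanishes over a finitely generated piece of it. -/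
theorem exists_finset_map_eq_zero {T : Set Ω} {x : MilnorRing ℓ F}
    (hx : map ℓ (algebraMap F (IntermediateField.adjoin F T)) x = 0) :
    ∃ S : Finset Ω, (S : Set Ω) ⊆ T ∧
      map ℓ (algebraMap F (IntermediateField.adjoin F (S : Set Ω))) x = 0 := by
  have key : (stageHom ℓ F T).comp (map ℓ (algebraMap F (IntermediateField.adjoin F T))) =
      (Ideal.Quotient.mk (eventuallyZero (ℓ := ℓ) (F := F) T)).comp
        (RingHom.pi fun S : {S : Finset Ω // (S : Set Ω) ⊆ T} =>
          map ℓ (algebraMap F (IntermediateField.adjoin F (S.1 : Set Ω)))) := by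
    refine hom_ext fun a => ?_
    rw [RingHom.comp_apply, map_sy, stageHom, lift_sy, RingHom.comp_apply]
    congr 1
    funext S
    have hm : algebraMap F Ω a ∈ IntermediateField.adjoin F (S.1 : Set Ω) :=
      IntermediateField.algebraMap_mem _ _
    change stageSym ℓ F T (algebraMap F Ω a) S = map ℓ _ (sy ℓ a)
    rw [stageSym_of_mem hm, ← sym_coe, map_sym]
    rfl
  have h := RingHom.congr_fun key x
  rw [RingHom.comp_apply, hx, map_zero, RingHom.comp_apply, eq_comm,
    Ideal.Quotient.eq_zero_iff_mem] at h
  obtain ⟨S, hS, h⟩ := h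
  exact ⟨S, hS, h ⟨S, hS⟩ subset_rfl⟩

end Compact

section Upper

variable {ℓ : ℕ} {k : Type*} {F : Type u} [Field k] [Field F] [Algebra k F]

lemma adjoin_gen_eq_top {k E : Type*} [Field k] [Field E] [Algebra k E] (a : E) :
    IntermediateField.adjoin k {IntermediateField.AdjoinSimple.gen k a} = ⊤ := by
  apply IntermediateField.lift_injective
  rw [IntermediateField.lift_adjoin_simple, IntermediateField.lift_top]
  rfl

theorem SplitVanish.mul_sym [NegOnePow ℓ F] {M M' : IntermediateField k F} {a : F}
    (hM : ∀ x ∈ M, x ∈ IntermediateField.adjoin M' {a}) {β : MilnorRing ℓ F}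
    (hβ : SplitVanish (algebraMap M F) β) : SplitVanish (algebraMap M' F) (β * sym ℓ a) := by
  let Ω := AlgebraicClosure F
  let k' : IntermediateField M' Ω := algebraicClosure M' Ω
  have : IsAlgClosed k' := (algebraicClosure.isAlgClosure M' Ω).isAlgClosed
  let T : Set Ω := (k' : Set Ω)
  let E : IntermediateField F Ω := IntermediateField.adjoin F T
  let N : IntermediateField k' Ω := IntermediateField.adjoin k' {algebraMap F Ω a}
  have hN : LinGrowth k' N := linGrowth_of_adjoin_simple (adjoin_gen_eq_top _)
  have hNE : ∀ x : N, N.val.toRingHom x ∈ E := by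
    rintro ⟨x, hx⟩
    change x ∈ E
    induction hx using IntermediateField.adjoin_induction with
    | mem x hx =>
      obtain rfl := hx
      exact E.algebraMap_mem a
    | algebraMap x => exact IntermediateField.subset_adjoin _ _ x.2
    | add x y _ _ hx hy => exact add_mem hx hy
    | inv x _ hx => exact inv_mem hx
    | mul x y _ _ hx hy => exact mul_mem hx hy
  have hMN : ∀ x : M, (algebraMap F Ω).comp (algebraMap M F) x ∈ N := by
    rintro ⟨x, hx⟩
    change algebraMap F Ω x ∈ N
    replace hx := hM x hx
    clear hβ
    induction hx using IntermediateField.adjoin_induction with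
    | mem x hx =>
      obtain rfl := hx
      exact IntermediateField.subset_adjoin _ _ rfl
    | algebraMap x =>
      have : algebraMap F Ω (algebraMap M' F x) = algebraMap k' Ω (algebraMap M' k' x) := by
        rw [← IsScalarTower.algebraMap_apply, ← IsScalarTower.algebraMap_apply]
      rw [this]
      exact N.algebraMap_mem _
    | add x y _ _ hx hy => rw [map_add]; exact add_mem hx hy
    | inv x _ hx => rw [map_inv₀]; exact inv_mem hx
    | mul x y _ _ hx hy => rw [map_mul]; exact mul_mem hx hy
  have : NegOnePow ℓ E := NegOnePow.of_ringHom (algebraMap F E)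
  have h0 : MilnorRing.map ℓ (algebraMap F E) (β * sym ℓ a) = 0 := by
    have hv := hβ.map (((algebraMap F Ω).comp (algebraMap M F)).codRestrict N hMN)
      (algebraMap F E) (N.val.toRingHom.codRestrict E hNE) rfl
    have := hv.mul_sym_eq_zero hN ⟨algebraMap F Ω a, IntermediateField.subset_adjoin _ _ rfl⟩
    rw [map_mul, map_sym]
    exact this
  obtain ⟨S, hS, hS0⟩ := exists_finset_map_eq_zero h0
  have hint : ∀ s ∈ S, IsIntegral M' s := fun s hs =>
    (mem_algebraicClosure_iff.mp (hS hs)).isIntegral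
  refine ⟨∏ s ∈ S, minpoly M' s, Finset.prod_ne_zero_iff.mpr fun s hs =>
    minpoly.ne_zero (hint s hs), fun F' _ j hsp => ?_⟩
  let : Algebra F F' := j.toAlgebra
  have hsp' : ∀ s ∈ S, (Polynomial.map (algebraMap F F') (minpoly F s)).Splits := by
    intro s hs
    have hne : Polynomial.map (j.comp (algebraMap M' F)) (∏ s ∈ S, minpoly M' s) ≠ 0 :=
      (Polynomial.map_ne_zero_iff (RingHom.injective _)).mpr
        (Finset.prod_ne_zero_iff.mpr fun s hs => minpoly.ne_zero (hint s hs))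
    refine hsp.of_dvd hne ?_
    rw [← Polynomial.map_map]
    refine Polynomial.map_dvd _ ((minpoly.dvd_map_of_isScalarTower M' F s).trans
      (Polynomial.map_dvd _ (Finset.dvd_prod_of_mem _ hs)))
  obtain ⟨e⟩ := IntermediateField.nonempty_algHom_adjoin_of_splits (F := F) (K := F')
    (S := (S : Set Ω)) fun s hs => ⟨(hint s hs).tower_top, hsp' s hs⟩
  have : j = e.toRingHom.comp (algebraMap F (IntermediateField.adjoin F (S : Set Ω))) :=
    e.comp_algebraMap.symm
  rw [this, ← MilnorRing.map_map, hS0, map_zero]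

lemma mem_adjoin_of_mem_adjoin_cons {a : F} {l : List F} {x : F}
    (hx : x ∈ IntermediateField.adjoin k {x | x ∈ a :: l}) :
    x ∈ IntermediateField.adjoin (IntermediateField.adjoin k {x | x ∈ l}) {a} := by
  rw [← IntermediateField.mem_restrictScalars k, IntermediateField.adjoin_adjoin_left]
  refine IntermediateField.adjoin.mono k _ _ ?_ hx
  intro y hy
  rcases List.mem_cons.mp hy with h | h
  · exact Or.inr h
  · exact Or.inl h

lemma SplitVanish.mul_list_prod [IsAlgClosed k] [NegOnePow ℓ F] (l : List F) :
    ∀ β : MilnorRing ℓ F,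
      SplitVanish (algebraMap (IntermediateField.adjoin k {x | x ∈ l}) F) β →
        β * (l.map (sym ℓ)).prod = 0 := by
  induction l with
  | nil =>
    rintro β ⟨h, h0, H⟩
    have hs := H F (RingHom.id F) (by
      have hsurj : Function.Surjective
          (algebraMap k (IntermediateField.adjoin k {x : F | x ∈ ([] : List F)})) := by
        rintro ⟨x, hx⟩
        have hx' : x ∈ (⊥ : IntermediateField k F) := by simpa using hx
        obtain ⟨c, rfl⟩ := IntermediateField.mem_bot.mp hx'
        exact ⟨c, rfl⟩
      obtain ⟨p, rfl⟩ := Polynomial.map_surjective _ hsurj h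
      rw [Polynomial.map_map]
      exact (IsAlgClosed.splits p).map _)
    rw [map_id] at hs
    rw [show β = 0 from hs, zero_mul]
  | cons a l ih =>
    intro β hβ
    rw [List.map_cons, List.prod_cons, ← mul_assoc]
    exact ih _ (hβ.mul_sym fun x hx => mem_adjoin_of_mem_adjoin_cons hx)

/-- Symbols on elements, one of which is algebraic over the field generated by the others,
vanish. -/
theorem sym_mul_list_prod_eq_zero [IsAlgClosed k] [NegOnePow ℓ F] (hℓ : 0 < ℓ) {a : F} {l : List F}
    (ha : IsAlgebraic (IntermediateField.adjoin k {x | x ∈ l}) a) :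
    sym ℓ a * (l.map (sym ℓ)).prod = 0 := by
  refine SplitVanish.mul_list_prod (k := k) l _ ?_
  set M := IntermediateField.adjoin k {x | x ∈ l}
  obtain ⟨p, hp0, hp⟩ := ha
  refine ⟨p.comp (X ^ ℓ), fun h0 => ?_, fun F' _ j hs => ?_⟩
  · have h1 := (comp_eq_zero_iff.mp h0).resolve_left hp0
    have := congrArg natDegree h1.2
    rw [natDegree_X_pow, natDegree_C] at this
    omega
  · rw [map_sym]
    obtain ⟨s, hs'⟩ : X - C (j a) ∣ p.map (j.comp (algebraMap M F)) := by
      rw [dvd_iff_isRoot, IsRoot.def, eval_map, ← hom_eval₂, ← aeval_def, hp, map_zero]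
    have hdvd : X ^ ℓ - C (j a) ∣ (p.comp (X ^ ℓ)).map (j.comp (algebraMap M F)) := by
      refine ⟨s.comp (X ^ ℓ), ?_⟩
      rw [Polynomial.map_comp, Polynomial.map_pow, map_X, hs', mul_comp, sub_comp, X_comp, C_comp]
    have hne : (p.comp (X ^ ℓ)).map (j.comp (algebraMap M F)) ≠ 0 := by
      rw [Polynomial.map_comp, Polynomial.map_pow, map_X]
      intro h0
      have h1 := (comp_eq_zero_iff.mp h0).resolve_left
        ((Polynomial.map_ne_zero_iff (RingHom.injective _)).mpr hp0)
      have := congrArg natDegree h1.2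
      rw [natDegree_X_pow, natDegree_C] at this
      omega
    obtain ⟨y, hy⟩ := (hs.of_dvd hne hdvd).exists_eval_eq_zero (by
      rw [degree_X_pow_sub_C hℓ]
      exact_mod_cast hℓ.ne')
    refine sym_eq_zero_of_pow (y := y) ?_
    simpa [sub_eq_zero] using hy

end Upper

section Upper

variable {ℓ : ℕ} {k F : Type*} [Field k] [Field F] [Algebra k F]

lemma negOnePow_of_isAlgClosed [IsAlgClosed k] (hℓ : 0 < ℓ) (F : Type*) [Field F] [Algebra k F] :
    NegOnePow ℓ F := by
  have : NegOnePow ℓ k := by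
    obtain ⟨z, hz⟩ := IsAlgClosed.exists_pow_nat_eq (-1 : k) hℓ
    have hz0 : z ≠ 0 := by
      rintro rfl
      rw [zero_pow hℓ.ne'] at hz
      exact neg_ne_zero.mpr one_ne_zero hz.symm
    exact ⟨⟨Units.mk0 z hz0, by ext; simpa using hz⟩⟩
  exact .of_ringHom (algebraMap k F)

open scoped IntermediateField.algebraAdjoinAdjoin in
lemma isAlgebraic_adjoin_of_isAlgebraic_adjoin {s : Set F} {a : F}
    (h : IsAlgebraic (Algebra.adjoin k s) a) : IsAlgebraic (IntermediateField.adjoin k s) a :=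
  h.extendScalars (FaithfulSMul.algebraMap_injective _ _)

lemma prod_sym_eq_zero_of_not_algebraicIndependent [IsAlgClosed k] (hℓ : 0 < ℓ) {n : ℕ}
    (a : Fin n → F) (ha : ¬ AlgebraicIndependent k a) :
    (List.ofFn fun i => sym ℓ (a i)).prod = 0 := by
  have := negOnePow_of_isAlgClosed (k := k) hℓ F
  induction n with
  | zero =>
    exact absurd ((algebraicIndependent_empty_type_iff).mpr (algebraMap k F).injective) ha
  | succ n ih =>
    rw [List.ofFn_succ, List.prod_cons]
    by_cases hi : AlgebraicIndependent k fun i : Fin n => a i.succ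
    · have h1 : ¬ Transcendental (Algebra.adjoin k (Set.range fun i : Fin n => a i.succ)) (a 0) := by
        rw [← hi.option_iff_transcendental]
        intro h
        refine ha ?_
        rw [← algebraicIndependent_equiv (finSuccEquiv n).symm]
        convert h using 1
        funext o
        cases o <;> simp
      rw [Transcendental, not_not] at h1
      have h2 := sym_mul_list_prod_eq_zero (k := k) hℓ (a := a 0)
        (l := List.ofFn fun i : Fin n => a i.succ) (by
          have : {x | x ∈ List.ofFn fun i : Fin n => a i.succ} =
              Set.range fun i : Fin n => a i.succ := by
            ext
            simp [List.mem_ofFn]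
          rw [this]
          exact isAlgebraic_adjoin_of_isAlgebraic_adjoin h1)
      rwa [List.map_ofFn] at h2
    · rw [ih _ hi, mul_zero]

/-- Symbols in algebraically dependent elements vanish. -/
theorem milnorSymbol_eq_zero_of_not_algebraicIndependent [IsAlgClosed k] (hℓ : 0 < ℓ) {n : ℕ}
    (a : Fin n → Fˣ) (ha : ¬ AlgebraicIndependent k fun i => (a i : F)) :
    milnorSymbol ℓ a = 0 := by
  refine milnorSymbol_eq_zero_of_prod ℓ a ?_
  have h := prod_sym_eq_zero_of_not_algebraicIndependent hℓ _ ha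
  simp only [sym_coe] at h
  exact h

end Upper

section Embedding

lemma exists_bezout_of_separable {R E : Type*} [CommRing R] [IsDomain R] [Field E] [Algebra R E]
    [IsFractionRing R E] {p : R[X]} (hp : (p.map (algebraMap R E)).Separable) :
    ∃ A B : R[X], ∃ D : R, D ≠ 0 ∧ A * p + B * derivative p = C D := by
  obtain ⟨u, v, huv⟩ := hp
  obtain ⟨b, hb, hbu⟩ := IsLocalization.integerNormalization_spec (nonZeroDivisors R) u
  obtain ⟨d, hd, hdv⟩ := IsLocalization.integerNormalization_spec (nonZeroDivisors R) v
  refine ⟨C d * IsLocalization.integerNormalization (nonZeroDivisors R) u,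
    C b * IsLocalization.integerNormalization (nonZeroDivisors R) v, b * d,
    mul_ne_zero (nonZeroDivisors.ne_zero hb) (nonZeroDivisors.ne_zero hd), ?_⟩
  apply Polynomial.map_injective _ (IsFractionRing.injective R E)
  simp only [Polynomial.map_add, Polynomial.map_mul, map_C, hbu, hdv, ← derivative_map,
    Algebra.smul_def, Polynomial.algebraMap_apply, _root_.map_mul] at huv ⊢
  linear_combination (C ((algebraMap R E) b) * C ((algebraMap R E) d)) * huv

lemma exists_integral_primitive (R E K : Type*) [CommRing R] [IsDomain R] [Field E]
    [Algebra R E] [IsFractionRing R E] [Field K] [Algebra E K] [Algebra R K] [IsScalarTower R E K]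
    [FiniteDimensional E K] [Algebra.IsSeparable E K] :
    ∃ y : K, IsIntegral R y ∧ IntermediateField.adjoin E {y} = ⊤ := by
  obtain ⟨y, hy⟩ := Field.exists_primitive_element E K
  have hyR : IsAlgebraic R y :=
    (IsFractionRing.isAlgebraic_iff R E K).mpr (Algebra.IsAlgebraic.isAlgebraic y)
  obtain ⟨d, hd, hdy⟩ := hyR.exists_integral_multiple
  refine ⟨d • y, hdy, ?_⟩
  rw [eq_top_iff, ← hy, IntermediateField.adjoin_simple_le_iff]
  have h1 : d • y ∈ IntermediateField.adjoin E {d • y} :=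
    IntermediateField.mem_adjoin_simple_self E _
  have hd' : algebraMap R E d ≠ 0 := by
    simpa using hd
  have h2 : y = (algebraMap R E d)⁻¹ • d • y := by
    rw [← algebraMap_smul E d y, smul_smul, inv_mul_cancel₀ hd', one_smul]
  have h3 := IntermediateField.smul_mem _ (x := (algebraMap R E d)⁻¹) h1
  rwa [← h2] at h3

lemma exists_algebraMap_eval_ne_zero (k : Type*) {E : Type*} [Field k] [Infinite k] [Field E]
    [Algebra k E] {D : E[X]} (hD : D ≠ 0) : ∃ c : k, D.eval (algebraMap k E c) ≠ 0 := by
  by_contra! h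
  refine hD (Polynomial.eq_zero_of_infinite_isRoot D ?_)
  refine (Set.infinite_range_of_injective (algebraMap k E).injective).mono ?_
  rintro _ ⟨c, rfl⟩
  exact h c

/-- Expansion of polynomials around `c` as power series. -/
def expand {E : Type*} (E₁ : Type*) [Field E] [Field E₁] [Algebra E E₁] (c : E) :
    E[X] →+* PowerSeries E₁ :=
  (Polynomial.coeToPowerSeries.ringHom.comp (mapRingHom (algebraMap E E₁))).comp
    (taylorAlgHom c : E[X] →ₐ[E] E[X]).toRingHom

section

variable {E E₁ : Type*} [Field E] [Field E₁] [Algebra E E₁] (c : E)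

lemma expand_apply (f : E[X]) :
    expand E₁ c f = ((taylor c f).map (algebraMap E E₁) : E₁[X]) := rfl

lemma expand_injective : Function.Injective (expand E₁ c) := by
  intro f g h
  rw [expand_apply, expand_apply] at h
  exact taylor_injective c (Polynomial.map_injective _ (algebraMap E E₁).injective
    (Polynomial.coe_injective _ h))

lemma expand_X : expand E₁ c X = PowerSeries.X + PowerSeries.C (algebraMap E E₁ c) := by
  simp [expand_apply]

lemma expand_C (e : E) : expand E₁ c (C e) = PowerSeries.C (algebraMap E E₁ e) := by
  simp [expand_apply]

lemma constantCoeff_comp_expand :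
    (PowerSeries.constantCoeff (R := E₁)).comp (expand E₁ c) =
      (algebraMap E E₁).comp (evalRingHom c) := by
  ext f
  · simp [expand_C]
  · simp [expand_X]

end

lemma isSeparable_adjoinRoot {E : Type*} [Field E] {g : E[X]} [Fact (Irreducible g)]
    (hg : g.Separable) : Algebra.IsSeparable E (AdjoinRoot g) := by
  have hg0 : g ≠ 0 := (Fact.out : Irreducible g).ne_zero
  have h1 : IsSeparable E (AdjoinRoot.root g) := by
    refine hg.of_dvd (minpoly.dvd _ _ ?_)
    rw [AdjoinRoot.aeval_eq, AdjoinRoot.mk_self]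
  have h2 : IntermediateField.adjoin E {AdjoinRoot.root g} = ⊤ :=
    IntermediateField.adjoin_eq_top_of_algebra _ _ (AdjoinRoot.adjoinRoot_eq_top (f := g))
  have h3 := (IntermediateField.isSeparable_adjoin_simple_iff_isSeparable E (AdjoinRoot g)).mpr h1
  rw [h2] at h3
  exact Algebra.IsSeparable.of_algHom _ _
    (IntermediateField.topEquiv (F := E) (E := AdjoinRoot g)).symm.toAlgHom

lemma exists_root_hensel {E E₁ : Type*} [Field E] [Field E₁] [Algebra E E₁] (c : E)
    {p : E[X][X]} (hp : p.Monic) (α : E₁)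
    (h0 : aeval α (p.map (evalRingHom c)) = 0)
    (h1 : aeval α (derivative (p.map (evalRingHom c))) ≠ 0) :
    ∃ b : PowerSeries E₁, (p.map (expand E₁ c)).eval b = 0 := by
  have key : ∀ q : E[X][X], PowerSeries.constantCoeff
      ((q.map (expand E₁ c)).eval (PowerSeries.C α)) = aeval α (q.map (evalRingHom c)) := by
    intro q
    rw [eval_map, hom_eval₂, constantCoeff_comp_expand, aeval_def, eval₂_map]
    simp
  have hens := IsAdicComplete.henselianRing (PowerSeries E₁)
    (Ideal.span {(PowerSeries.X : PowerSeries E₁)})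
  obtain ⟨b, hb, -⟩ := hens.is_henselian (p.map (expand E₁ c)) (hp.map _) (PowerSeries.C α)
    (by rw [Ideal.mem_span_singleton, PowerSeries.X_dvd_iff, key, h0])
    (by
      apply IsUnit.map
      rw [PowerSeries.isUnit_iff_constantCoeff, derivative_map, key, ← derivative_map]
      exact h1.isUnit)
  exact ⟨b, hb⟩

theorem exists_laurent_embedding {k : Type*} {E' E K : Type u} [Field k] [Infinite k] [Field E']
    [Algebra k E'] [Field E] [Algebra E'[X] E] [IsFractionRing E'[X] E] [Field K] [Algebra E K]
    [FiniteDimensional E K] [Algebra.IsSeparable E K] :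
    ∃ (c : k) (E₁ : Type u) (_ : Field E₁) (_ : Algebra E' E₁) (_ : FiniteDimensional E' E₁)
      (_ : Algebra.IsSeparable E' E₁) (φ : K →+* LaurentSeries E₁), ∀ f : E'[X],
      φ (algebraMap E K (algebraMap E'[X] E f)) =
        HahnSeries.ofPowerSeries ℤ E₁ (expand E₁ (algebraMap k E' c) f) := by
  let : Algebra E'[X] K := ((algebraMap E K).comp (algebraMap E'[X] E)).toAlgebra
  have : IsScalarTower E'[X] E K := .of_algebraMap_eq fun _ => rfl
  obtain ⟨y, hy, hytop⟩ := exists_integral_primitive E'[X] E K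
  set p := minpoly E'[X] y with hpdef
  have hpm : p.Monic := minpoly.monic hy
  have hpE : minpoly E y = p.map (algebraMap E'[X] E) :=
    minpoly.isIntegrallyClosed_eq_field_fractions E K hy
  have hsep : (p.map (algebraMap E'[X] E)).Separable := by
    rw [← hpE]
    exact Algebra.IsSeparable.isSeparable E y
  obtain ⟨A, B, D, hD, hAB⟩ := exists_bezout_of_separable hsep
  obtain ⟨c, hc⟩ := exists_algebraMap_eval_ne_zero k hD
  set c' := algebraMap k E' c
  set q := p.map (evalRingHom c') with hq
  have hqm : q.Monic := hpm.map _
  have hqsep : q.Separable := by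
    have h := congrArg (Polynomial.map (evalRingHom c')) hAB
    simp only [Polynomial.map_add, Polynomial.map_mul, map_C, ← derivative_map, ← hq,
      coe_evalRingHom] at h
    refine ⟨C (eval c' D)⁻¹ * A.map (evalRingHom c'), C (eval c' D)⁻¹ * B.map (evalRingHom c'), ?_⟩
    rw [mul_assoc, mul_assoc, ← mul_add, h, ← C_mul, inv_mul_cancel₀ hc, C_1]
  have hqnu : ¬ IsUnit q := by
    rw [hqm.isUnit_iff]
    intro h
    have : q.natDegree = 0 := by rw [h, natDegree_one]
    rw [hq, hpm.natDegree_map] at this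
    exact (minpoly.natDegree_pos hy).ne' this
  obtain ⟨g, hgirr, hgq⟩ := WfDvdMonoid.exists_irreducible_factor hqnu hqm.ne_zero
  have : Fact (Irreducible g) := ⟨hgirr⟩
  have hroot : aeval (AdjoinRoot.root g) q = 0 := by
    obtain ⟨h, hgh⟩ := hgq
    rw [hgh, _root_.map_mul, AdjoinRoot.aeval_eq, AdjoinRoot.mk_self, zero_mul]
  obtain ⟨b, hb⟩ := exists_root_hensel c' hpm (AdjoinRoot.root g) hroot
    (hqsep.aeval_derivative_ne_zero hroot)
  have hinj : Function.Injective
      ((HahnSeries.ofPowerSeries ℤ (AdjoinRoot g)).comp (expand (AdjoinRoot g) c')) :=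
    HahnSeries.ofPowerSeries_injective.comp (expand_injective c')
  let ψ : E →+* LaurentSeries (AdjoinRoot g) := IsFractionRing.lift hinj
  have hψ : ∀ f : E'[X], ψ (algebraMap E'[X] E f) =
      HahnSeries.ofPowerSeries ℤ _ (expand (AdjoinRoot g) c' f) :=
    fun f => IsFractionRing.lift_algebraMap hinj f
  let : Algebra E (LaurentSeries (AdjoinRoot g)) := ψ.toAlgebra
  have hyE : IsIntegral E y := Algebra.IsIntegral.isIntegral y
  let ρ := (IntermediateField.algHomAdjoinIntegralEquiv E (K := LaurentSeries (AdjoinRoot g))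
    hyE).symm ⟨HahnSeries.ofPowerSeries ℤ _ b, by
      rw [mem_aroots]
      refine ⟨minpoly.ne_zero hyE, ?_⟩
      have h := congrArg (HahnSeries.ofPowerSeries ℤ (AdjoinRoot g)) hb
      rw [eval_map, hom_eval₂, _root_.map_zero] at h
      rw [hpE, aeval_def, eval₂_map, ← h]
      congr 1
      exact RingHom.ext hψ⟩
  let φ : K →ₐ[E] LaurentSeries (AdjoinRoot g) :=
    (ρ.comp (IntermediateField.equivOfEq hytop.symm).toAlgHom).comp
      (IntermediateField.topEquiv (F := E) (E := K)).symm.toAlgHom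
  refine ⟨c, AdjoinRoot g, inferInstance, inferInstance,
    (AdjoinRoot.powerBasis hgirr.ne_zero).finite, isSeparable_adjoinRoot (hqsep.of_dvd hgq),
    φ.toRingHom, fun f => ?_⟩
  exact (φ.commutes _).trans (hψ f)

end Embedding

/-- A multiplicative map to `ℤ^d` that is compatible with the Steinberg relation. -/
structure IsWeight {F : Type*} [Field F] {d : ℕ} (w : Fˣ → Fin d → ℤ) : Prop where
  mul : ∀ a b, w (a * b) = w a + w b
  steinberg : ∀ a b : Fˣ, (a : F) + b = 1 → w a = 0 ∨ w b = 0 ∨ w a = w b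

namespace IsWeight

variable {F G : Type*} [Field F] [Field G] {d : ℕ} {w : Fˣ → Fin d → ℤ}

lemma one (hw : IsWeight w) : w 1 = 0 := by
  simpa using hw.mul 1 1

lemma neg (hw : IsWeight w) (a : Fˣ) : w (-a) = w a := by
  have h1 : w (-1) + w (-1) = 0 := by rw [← hw.mul, neg_mul_neg, one_mul, hw.one]
  have h2 : w (-1) = 0 := by
    funext i
    have := congrFun h1 i
    simp only [Pi.add_apply, Pi.zero_apply] at this ⊢
    omega
  rw [← neg_one_mul, hw.mul, h2, zero_add]

lemma pow (hw : IsWeight w) (a : Fˣ) (n : ℕ) : w (a ^ n) = n • w a := by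
  induction n with
  | zero => simp [hw.one]
  | succ n ih => rw [pow_succ, hw.mul, ih, succ_nsmul]

lemma comap (hw : IsWeight w) (φ : G →+* F) : IsWeight fun u => w (Units.map (φ : G →* F) u) where
  mul a b := by rw [_root_.map_mul, hw.mul]
  steinberg a b h := hw.steinberg _ _ (by simpa using congrArg φ h)

lemma restrict (hw : IsWeight w) {e : ℕ} (ι : Fin e → Fin d) : IsWeight fun u => w u ∘ ι where
  mul a b := by
    rw [hw.mul]
    rfl
  steinberg a b h := by
    rcases hw.steinberg a b h with h | h | h
    · left; rw [h]; rfl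
    · right; left; rw [h]; rfl
    · right; right; rw [h]

/-- The leading coefficient of an invertible Laurent series. -/
def lcUnit (u : (LaurentSeries F)ˣ) : Fˣ :=
  Units.mk0 (HahnSeries.leadingCoeff (u : LaurentSeries F))
    (HahnSeries.leadingCoeff_ne_zero.mpr u.ne_zero)

lemma laurent (hw : IsWeight w) : IsWeight fun u : (LaurentSeries F)ˣ =>
    (Fin.cons (HahnSeries.order (u : LaurentSeries F)) (w (lcUnit u)) : Fin (d + 1) → ℤ) where
  mul a b := by
    have h1 : lcUnit (a * b) = lcUnit a * lcUnit b := by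
      ext
      simp [lcUnit]
    have h2 : HahnSeries.order ((a * b : (LaurentSeries F)ˣ) : LaurentSeries F) =
        HahnSeries.order (a : LaurentSeries F) + HahnSeries.order (b : LaurentSeries F) := by
      rw [Units.val_mul, HahnSeries.order_mul a.ne_zero b.ne_zero]
    rw [h1, h2, hw.mul]
    funext i
    refine Fin.cases ?_ (fun j => ?_) i <;> simp
  steinberg a b h := by
    have hc : ∀ n : ℤ, HahnSeries.coeff (a : LaurentSeries F) n +
        HahnSeries.coeff (b : LaurentSeries F) n = if n = 0 then 1 else 0 := by
      intro n
      rw [← HahnSeries.coeff_add, h, HahnSeries.coeff_one]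
      congr
    have key : ∀ u : (LaurentSeries F)ˣ, ∀ n : ℤ, HahnSeries.coeff (u : LaurentSeries F) n ≠ 0 →
        HahnSeries.order (u : LaurentSeries F) ≤ n := by
      intro u n hn
      by_contra! hlt
      exact hn (HahnSeries.coeff_eq_zero_of_lt_order hlt)
    have hlc : ∀ u : (LaurentSeries F)ˣ, ((lcUnit u : Fˣ) : F) =
        HahnSeries.coeff (u : LaurentSeries F) (HahnSeries.order (u : LaurentSeries F)) :=
      fun u => HahnSeries.leadingCoeff_eq
    have hne : ∀ u : (LaurentSeries F)ˣ,
        HahnSeries.coeff (u : LaurentSeries F) (HahnSeries.order (u : LaurentSeries F)) ≠ 0 :=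
      fun u => by rw [← hlc]; exact (lcUnit u).ne_zero
    have hpos : ∀ u v : (LaurentSeries F)ˣ, (∀ n : ℤ, HahnSeries.coeff (u : LaurentSeries F) n +
        HahnSeries.coeff (v : LaurentSeries F) n = if n = 0 then 1 else 0) →
        0 < HahnSeries.order (u : LaurentSeries F) →
        (Fin.cons (HahnSeries.order (v : LaurentSeries F)) (w (lcUnit v)) : Fin (d + 1) → ℤ)
          = 0 := by
      intro u v huv hu
      have h0 : HahnSeries.coeff (v : LaurentSeries F) 0 = 1 := by
        have := huv 0
        rwa [HahnSeries.coeff_eq_zero_of_lt_order hu, zero_add, if_pos rfl] at this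
      have h1 : HahnSeries.order (v : LaurentSeries F) ≤ 0 := key v 0 (by rw [h0]; exact one_ne_zero)
      have h2 : HahnSeries.order (v : LaurentSeries F) = 0 := by
        by_contra hv
        have := huv (HahnSeries.order (v : LaurentSeries F))
        rw [if_neg hv, HahnSeries.coeff_eq_zero_of_lt_order (by omega), zero_add] at this
        exact hne v this
      have h3 : lcUnit v = 1 := by
        ext
        rw [hlc, h2, h0, Units.val_one]
      rw [h2, h3, hw.one]
      funext i
      refine Fin.cases ?_ (fun j => ?_) i <;> simp
    have hneg : ∀ u v : (LaurentSeries F)ˣ, (∀ n : ℤ, HahnSeries.coeff (u : LaurentSeries F) n +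
        HahnSeries.coeff (v : LaurentSeries F) n = if n = 0 then 1 else 0) →
        HahnSeries.order (u : LaurentSeries F) < 0 →
        HahnSeries.order (v : LaurentSeries F) ≤ HahnSeries.order (u : LaurentSeries F) := by
      intro u v huv hu
      refine key v _ fun h0 => hne u ?_
      have := huv (HahnSeries.order (u : LaurentSeries F))
      rwa [h0, add_zero, if_neg hu.ne] at this
    have hc' : ∀ n : ℤ, HahnSeries.coeff (b : LaurentSeries F) n +
        HahnSeries.coeff (a : LaurentSeries F) n = if n = 0 then 1 else 0 := by
      intro n
      rw [add_comm, hc]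
    rcases lt_trichotomy 0 (HahnSeries.order (a : LaurentSeries F)) with ha | ha | ha
    · exact Or.inr (Or.inl (hpos a b hc ha))
    · rcases lt_trichotomy 0 (HahnSeries.order (b : LaurentSeries F)) with hb | hb | hb
      · exact Or.inl (hpos b a hc' hb)
      · have h1 : ((lcUnit a : Fˣ) : F) + lcUnit b = 1 := by
          rw [hlc, hlc, ← ha, ← hb, hc, if_pos rfl]
        rw [← ha, ← hb]
        rcases hw.steinberg _ _ h1 with h2 | h2 | h2
        · left
          rw [h2]
          funext i
          refine Fin.cases ?_ (fun j => ?_) i <;> simp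
        · right; left
          rw [h2]
          funext i
          refine Fin.cases ?_ (fun j => ?_) i <;> simp
        · right; right
          rw [h2]
      · have := hneg b a hc' hb
        omega
    · have h1 := hneg a b hc ha
      have h2 := hneg b a hc' (by omega)
      have h3 := le_antisymm h1 h2
      have h4 : lcUnit b = -lcUnit a := by
        ext
        have := hc (HahnSeries.order (a : LaurentSeries F))
        rw [if_neg ha.ne] at this
        rw [Units.val_neg, hlc, hlc, h3]
        linear_combination this
      right; right
      rw [h3, h4, hw.neg]

end IsWeight

open scoped IntermediateField.algebraAdjoinAdjoin in
lemma isAlgebraic_adjoin_iff {k F : Type*} [Field k] [Field F] [Algebra k F] {s : Set F} {a : F} :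
    IsAlgebraic (IntermediateField.adjoin k s) a ↔ IsAlgebraic (Algebra.adjoin k s) a :=
  (IsFractionRing.isAlgebraic_iff (Algebra.adjoin k s) (IntermediateField.adjoin k s) F).symm

lemma algebraicIndependent_cons_iff {k F : Type*} [Field k] [Field F] [Algebra k F] {n : ℕ}
    {a : F} {x : Fin n → F} (hx : AlgebraicIndependent k x) :
    AlgebraicIndependent k (Fin.cons a x : Fin (n + 1) → F) ↔
      Transcendental (IntermediateField.adjoin k (Set.range x)) a := by
  rw [Transcendental, isAlgebraic_adjoin_iff, ← Transcendental, ← hx.option_iff_transcendental,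
    ← algebraicIndependent_equiv (finSuccEquiv n)]
  apply iff_of_eq
  congr 1
  funext i
  refine Fin.cases ?_ (fun j => ?_) i <;> simp

lemma adjoin_preimage_eq_top {k F : Type*} [Field k] [Field F] [Algebra k F] (s : Set F)
    (t : Set (IntermediateField.adjoin k s)) (ht : Subtype.val '' t = s) :
    IntermediateField.adjoin k t = ⊤ := by
  apply IntermediateField.lift_injective
  rw [IntermediateField.lift_adjoin, IntermediateField.lift_top, ht]

theorem exists_weight {k : Type*} [Field k] [Infinite k] (d : ℕ) :
    ∀ (E K : Type u) [Field E] [Algebra k E] [Field K] [Algebra E K] [FiniteDimensional E K]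
      [Algebra.IsSeparable E K] (x : Fin d → E), AlgebraicIndependent k x →
      IntermediateField.adjoin k (Set.range x) = ⊤ →
      ∃ (c : Fin d → k) (w : Kˣ → Fin d → ℤ), IsWeight w ∧ ∀ i (u : Kˣ),
        (u : K) = algebraMap E K (x i - algebraMap k E (c i)) → w u = Pi.single i 1 := by
  induction d with
  | zero =>
    intro E K _ _ _ _ _ _ x _ _
    exact ⟨finZeroElim, fun _ => 0, ⟨fun a b => by simp, fun a b _ => by simp⟩,
      fun i => i.elim0⟩
  | succ d ih =>
    intro E K _ _ _ _ _ _ x hx hxtop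
    obtain ⟨t, y, rfl⟩ : ∃ t y, x = (Fin.cons t y : Fin (d + 1) → E) :=
      ⟨x 0, Fin.tail x, (Fin.cons_self_tail x).symm⟩
    have hy : AlgebraicIndependent k y := by
      have := hx.comp Fin.succ (Fin.succ_injective d)
      rwa [Fin.cons_comp_succ] at this
    have ht := (algebraicIndependent_cons_iff hy).mp hx
    let E' := IntermediateField.adjoin k (Set.range y)
    let : Algebra E'[X] E := (aeval (R := E') t).toAlgebra
    have hinj : Function.Injective (algebraMap E'[X] E) := transcendental_iff_injective.mp ht
    have : FaithfulSMul E'[X] E := (faithfulSMul_iff_algebraMap_injective _ _).mpr hinj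
    have htop : IntermediateField.adjoin E' {t} = ⊤ := by
      apply IntermediateField.restrictScalars_injective k
      rw [IntermediateField.adjoin_adjoin_left, IntermediateField.restrictScalars_top, ← hxtop,
        Fin.range_cons, Set.union_comm, Set.insert_eq]
    have : IsFractionRing E'[X] E := .of_field _ _ fun z => by
      have hz : z ∈ IntermediateField.adjoin E' {t} := htop ▸ IntermediateField.mem_top
      exact IntermediateField.mem_adjoin_simple_iff E' z |>.mp hz
    obtain ⟨c₀, E₁, _, _, _, _, φ, hφ⟩ :=
      exists_laurent_embedding (k := k) (E' := E') (E := E) (K := K)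
    let y' : Fin d → E' := fun i => ⟨y i, IntermediateField.subset_adjoin _ _ ⟨i, rfl⟩⟩
    have hy' : AlgebraicIndependent k y' := hy.of_comp E'.val
    have hytop' : IntermediateField.adjoin k (Set.range y') = ⊤ := by
      apply adjoin_preimage_eq_top
      rw [← Set.range_comp]
      rfl
    obtain ⟨c, w, hw, hwu⟩ := ih E' E₁ y' hy' hytop'
    refine ⟨Fin.cons c₀ c, _, hw.laurent.comap φ, fun i u => ?_⟩
    refine Fin.cases (fun hu => ?_) (fun j hu => ?_) i
    · have h1 : φ u = HahnSeries.single (1 : ℤ) (1 : E₁) := by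
        have h := hφ (X - C (algebraMap k E' c₀))
        rw [_root_.map_sub (expand _ _), expand_X, expand_C, add_sub_cancel_right,
          HahnSeries.ofPowerSeries_X] at h
        rw [← h, hu]
        congr 1
        change _ = (algebraMap E K) (aeval t (X - C (algebraMap k E' c₀)))
        rw [_root_.map_sub (aeval (R := E') t), aeval_X, aeval_C]
        rfl
      have h2 : IsWeight.lcUnit (Units.map (φ : K →* LaurentSeries E₁) u) = 1 := by
        ext
        simp [IsWeight.lcUnit, h1]
      have h3 : HahnSeries.order (Units.map (φ : K →* LaurentSeries E₁) u : LaurentSeries E₁) =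
          1 := by
        simp [h1]
      funext i
      simp only [h2, h3, hw.one]
      refine Fin.cases ?_ (fun j => ?_) i <;> simp
    · have h1 : φ u = HahnSeries.C (algebraMap E' E₁ (y' j - algebraMap k E' (c j))) := by
        have h := hφ (C (y' j - algebraMap k E' (c j)))
        rw [expand_C, HahnSeries.ofPowerSeries_C] at h
        rw [← h, hu]
        congr 1
        change _ = (algebraMap E K) (aeval t (C (y' j - algebraMap k E' (c j))))
        rw [aeval_C]
        rfl
      have h2 := hwu j (IsWeight.lcUnit (Units.map (φ : K →* LaurentSeries E₁) u)) (by
        change HahnSeries.leadingCoeff (φ u) = _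
        rw [h1, HahnSeries.C_apply, HahnSeries.leadingCoeff_of_single])
      have h3 : HahnSeries.order (Units.map (φ : K →* LaurentSeries E₁) u : LaurentSeries E₁) =
          0 := by
        change HahnSeries.order (φ u) = 0
        rw [h1, HahnSeries.order_C]
      funext i
      simp only [h2, h3]
      refine Fin.cases ?_ (fun j => ?_) i <;> simp [Pi.single_apply]

theorem milnorSymbol_ne_zero_of_isWeight {ℓ d : ℕ} {F : Type*} [Field F] {w : Fˣ → Fin d → ℤ}
    (hw : IsWeight w) (a : Fin d → Fˣ)
    (ha : ((Matrix.det (Matrix.of fun i => w (a i)) : ℤ) : ZMod ℓ) ≠ 0) :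
    milnorSymbol ℓ a ≠ 0 := by
  let wl : Additive Fˣ →ₗ[ℤ] (Fin d → ℤ) := AddMonoidHom.toIntLinearMap
    { toFun := fun u => w u.toMul
      map_zero' := hw.one
      map_add' := fun u v => hw.mul _ _ }
  let f : MultilinearMap ℤ (fun _ : Fin d => Additive Fˣ) (ZMod ℓ) :=
    (Int.castAddHom (ZMod ℓ)).toIntLinearMap.compMultilinearMap
      ((Matrix.detRowAlternating (R := ℤ) (n := Fin d)).toMultilinearMap.compLinearMap
        fun _ => wl)
  have hf : ∀ b : Fin d → Fˣ, f (fun i => Additive.ofMul (b i)) =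
      ((Matrix.det (Matrix.of fun i => w (b i)) : ℤ) : ZMod ℓ) := fun b => rfl
  intro h
  have h2 := milnorLift_symbol ℓ f (by
    intro b i j hij hb
    rw [hf]
    have : Matrix.det (Matrix.of fun i => w (b i)) = 0 := by
      rcases hw.steinberg _ _ hb with h | h | h
      · exact Matrix.det_eq_zero_of_row_eq_zero i fun j => congrFun h j
      · exact Matrix.det_eq_zero_of_row_eq_zero j fun i => congrFun h i
      · exact Matrix.det_zero_of_row_eq hij.ne h
    rw [this, Int.cast_zero]) (by
    intro x
    rw [zsmul_eq_mul]
    simp) a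
  rw [h, _root_.map_zero, hf] at h2
  exact ha h2.symm

section

variable {k K : Type*} [Field k] [Field K] [Algebra k K]

lemma _root_.IsFunctionField.finiteDimensional (hK : IsFunctionField k K) (E : IntermediateField k K)
    [Algebra.IsAlgebraic E K] : FiniteDimensional E K := by
  obtain ⟨s, hs⟩ := hK
  have h1 : FiniteDimensional E (IntermediateField.adjoin E (s : Set K)) :=
    IntermediateField.finiteDimensional_adjoin fun x _ => Algebra.IsIntegral.isIntegral x
  have h2 : IntermediateField.adjoin E (s : Set K) = ⊤ := by
    apply IntermediateField.restrictScalars_injective k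
    rw [IntermediateField.restrictScalars_top, eq_top_iff, ← hs,
      IntermediateField.adjoin_le_iff]
    exact IntermediateField.subset_adjoin E (s : Set K)
  rw [h2] at h1
  exact IntermediateField.topEquiv.toLinearEquiv.finiteDimensional

lemma exists_isTranscendenceBasis_extending (hK : IsFunctionField k K) {r : ℕ} (x : Fin r → K)
    (hx : AlgebraicIndependent k x) :
    ∃ (d : ℕ) (y : Fin d → K) (ι : Fin r → Fin d), IsTranscendenceBasis k y ∧
      Function.Injective ι ∧ ∀ i, y (ι i) = x i := by
  obtain ⟨s, hs⟩ := hK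
  have halg : Algebra.IsAlgebraic (Algebra.adjoin k (Set.range x ∪ s)) K := by
    refine ⟨fun z => isAlgebraic_adjoin_iff.mp ?_⟩
    have : IntermediateField.adjoin k (Set.range x ∪ (s : Set K)) = ⊤ := by
      rw [eq_top_iff, ← hs]
      exact IntermediateField.adjoin.mono _ _ _ Set.subset_union_right
    rw [this]
    exact isAlgebraic_algebraMap (⟨z, IntermediateField.mem_top⟩ : (⊤ : IntermediateField k K))
  obtain ⟨u, hxu, hut, hu⟩ := exists_isTranscendenceBasis_between (R := k) (Set.range x)
    (Set.range x ∪ s) Set.subset_union_left hx.to_subtype_range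
  have hfin : Finite u := ((Set.finite_range x).union s.finite_toSet).subset hut
  obtain ⟨d, ⟨e⟩⟩ := Finite.exists_equiv_fin u
  refine ⟨d, fun i => (e.symm i : K), fun i => e ⟨x i, hxu ⟨i, rfl⟩⟩, ?_, ?_, ?_⟩
  · exact (isTranscendenceBasis_equiv e.symm).mpr hu
  · intro i j h
    exact hx.injective (congrArg Subtype.val (e.injective h))
  · intro i
    simp

theorem exists_weight_of_algebraicIndependent [Infinite k] (hK : IsFunctionField k K) {r : ℕ}
    (x : Fin r → K) (hx : AlgebraicIndependent k x) :
    ∃ (c : Fin r → k) (w : Kˣ → Fin r → ℤ) (n : ℕ), IsWeight w ∧ ∀ i (u : Kˣ),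
      (u : K) = x i - algebraMap k K (c i) → w u = ringExpChar k ^ n • Pi.single i 1 := by
  obtain ⟨d, y, ι, hy, hι, hyx⟩ := exists_isTranscendenceBasis_extending hK x hx
  let E := IntermediateField.adjoin k (Set.range y)
  have : Algebra.IsAlgebraic E K := hy.isAlgebraic_field
  have := IsFunctionField.finiteDimensional hK E
  let Es := separableClosure E K
  have : FiniteDimensional E Es := inferInstance
  let y' : Fin d → E := fun i => ⟨y i, IntermediateField.subset_adjoin _ _ ⟨i, rfl⟩⟩
  have hy' : AlgebraicIndependent k y' := hy.1.of_comp E.val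
  have hytop' : IntermediateField.adjoin k (Set.range y') = ⊤ := by
    apply adjoin_preimage_eq_top
    rw [← Set.range_comp]
    rfl
  obtain ⟨c, w, hw, hwu⟩ := exists_weight d E Es y' hy' hytop'
  have : ExpChar Es (ringExpChar k) := expChar_of_injective_algebraMap
    ((algebraMap E Es).comp (algebraMap k E)).injective _
  let n := IsPurelyInseparable.exponent Es K
  let φ := IsPurelyInseparable.iterateFrobenius Es K (ringExpChar k) (le_refl n)
  have hφ : ∀ a, algebraMap Es K (φ a) = a ^ ringExpChar k ^ n :=
    IsPurelyInseparable.algebraMap_iterateFrobenius Es (ringExpChar k) (le_refl n)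
  refine ⟨c ∘ ι, _, n, (hw.comap φ).restrict ι, fun i u hu => ?_⟩
  have hu' : (u : K) = algebraMap Es K (algebraMap E Es (y' (ι i) - algebraMap k E (c (ι i)))) := by
    rw [hu, ← hyx i]
    rfl
  have hne : algebraMap E Es (y' (ι i) - algebraMap k E (c (ι i))) ≠ 0 := by
    intro h0
    rw [h0, _root_.map_zero] at hu'
    exact u.ne_zero hu'
  have h1 : Units.map (φ : K →* Es) u = Units.mk0 _ hne ^ ringExpChar k ^ n := by
    ext
    have h := hφ u
    rw [hu', ← _root_.map_pow] at h
    have h2 := (algebraMap Es K).injective h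
    rw [← hu'] at h2
    simp only [Units.coe_map, Units.val_pow_eq_pow_val, Units.val_mk0]
    exact congrArg Subtype.val h2
  have h2 := hwu (ι i) (Units.mk0 _ hne) rfl
  simp only [h1, hw.pow, h2]
  funext j
  simp [Pi.single_apply, hι.eq_iff]

/-- Suitable translates of algebraically independent elements have a nonzero symbol. -/
theorem exists_milnorSymbol_ne_zero {ℓ : ℕ} (hℓ : ℓ.Prime) [Infinite k] (hchar : ringChar k ≠ ℓ)
    (hK : IsFunctionField k K) {r : ℕ} (x : Fin r → K) (hx : AlgebraicIndependent k x) :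
    ∃ (c : Fin r → k) (a : Fin r → Kˣ), (∀ i, (a i : K) = x i - algebraMap k K (c i)) ∧
      milnorSymbol ℓ a ≠ 0 := by
  obtain ⟨c, w, n, hw, hwu⟩ := exists_weight_of_algebraicIndependent hK x hx
  have hne : ∀ i, x i - algebraMap k K (c i) ≠ 0 := by
    intro i h
    refine (hx.transcendental i) ?_
    rw [sub_eq_zero.mp h]
    exact isAlgebraic_algebraMap _
  refine ⟨c, fun i => Units.mk0 _ (hne i), fun i => rfl, ?_⟩
  refine milnorSymbol_ne_zero_of_isWeight hw _ ?_
  have hM : (Matrix.of fun i => w (Units.mk0 _ (hne i))) =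
      Matrix.diagonal fun _ : Fin r => ((ringExpChar k ^ n : ℕ) : ℤ) := by
    ext i j
    rw [Matrix.of_apply, hwu i (Units.mk0 _ (hne i)) rfl]
    by_cases hij : i = j
    · subst hij
      simp
    · simp [Matrix.diagonal_apply_ne _ hij, Ne.symm hij]
  have : Fact ℓ.Prime := ⟨hℓ⟩
  rw [hM, Matrix.det_diagonal, Finset.prod_const, Int.cast_pow, Int.cast_natCast, Nat.cast_pow]
  refine pow_ne_zero _ (pow_ne_zero _ ?_)
  rw [Ne, ZMod.natCast_eq_zero_iff]
  intro hdvd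
  have hp : ringExpChar k = max (ringChar k) 1 := rfl
  rcases expChar_is_prime_or_one k (ringExpChar k) with h | h
  · have := (Nat.prime_dvd_prime_iff_eq hℓ h).mp hdvd
    rw [hp] at this
    rcases max_choice (ringChar k) 1 with h' | h'
    · exact hchar (by rw [this, h'])
    · rw [h'] at this
      exact hℓ.one_lt.ne' this
  · rw [h] at hdvd
    exact hℓ.one_lt.ne' (Nat.dvd_one.mp hdvd)

end

section

variable {k K : Type*} [Field k] [Field K] [Algebra k K]

attribute [local instance] Polynomial.algebra

lemma mem_adjoin_simple_of_isAlgebraic [IsAlgClosed k] (C₀ : IntermediateField k K) {t z : K}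
    (ht : Transcendental C₀ t) (hz : z ∈ IntermediateField.adjoin C₀ {t})
    (hzt : IsAlgebraic (IntermediateField.adjoin k {t}) z) :
    z ∈ IntermediateField.adjoin k {t} := by
  let : Algebra C₀[X] K := (aeval (R := C₀) t).toAlgebra
  have hinj : Function.Injective (algebraMap C₀[X] K) := transcendental_iff_injective.mp ht
  have htk : Transcendental k t := ht.restrictScalars (algebraMap k C₀).injective
  let : Algebra k[X] K := (aeval (R := k) t).toAlgebra
  have hinjk : Function.Injective (algebraMap k[X] K) := transcendental_iff_injective.mp htk
  have : IsScalarTower k[X] C₀[X] K := .of_algebraMap_eq' <| by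
    ext x
    · change aeval t (C x) = aeval t (Polynomial.map (algebraMap k C₀) (C x))
      simp
    · change aeval t X = aeval t (Polynomial.map (algebraMap k C₀) X)
      simp
  obtain ⟨d, hd, hdz⟩ : ∃ d : k[X], d ≠ 0 ∧ IsIntegral k[X] (d • z) := by
    refine IsAlgebraic.exists_integral_multiple ?_
    let f : k[X] →+* Algebra.adjoin k {t} :=
      ((aeval (R := k) (⟨t, Algebra.self_mem_adjoin_singleton k t⟩ : Algebra.adjoin k {t})) :
        k[X] →+* Algebra.adjoin k {t})
    have hf : Function.Surjective f := by
      rintro ⟨w, hw⟩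
      rw [Algebra.adjoin_singleton_eq_range_aeval] at hw
      obtain ⟨q, rfl⟩ := hw
      refine ⟨q, Subtype.ext ?_⟩
      exact (Polynomial.aeval_algebraMap_apply K
        (⟨t, Algebra.self_mem_adjoin_singleton k t⟩ : Algebra.adjoin k {t}) q).symm
    refine IsAlgebraic.of_ringHom_of_comp_eq f (RingHom.id K)
      (isAlgebraic_adjoin_iff.mp hzt) hf Function.injective_id ?_
    refine RingHom.ext fun q => ?_
    exact (Polynomial.aeval_algebraMap_apply K
        (⟨t, Algebra.self_mem_adjoin_singleton k t⟩ : Algebra.adjoin k {t}) q).symm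
  obtain ⟨f, g, hfg⟩ := (IntermediateField.mem_adjoin_simple_iff C₀ z).mp hz
  have : FaithfulSMul C₀[X] K := (faithfulSMul_iff_algebraMap_injective _ _).mpr hinj
  obtain ⟨h, hh⟩ : ∃ h : C₀[X], algebraMap C₀[X] K h = d • z := by
    let φ : FractionRing C₀[X] →ₐ[C₀[X]] K := IsFractionRing.liftAlgHom (g := Algebra.ofId C₀[X] K) hinj
    have hz' : z = φ (algebraMap _ _ f / algebraMap _ _ g) := by
      rw [map_div₀, AlgHom.commutes, AlgHom.commutes]
      exact hfg
    have hd' : d • z = φ (algebraMap C₀[X] _ (d.map (algebraMap k C₀)) *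
        (algebraMap _ _ f / algebraMap _ _ g)) := by
      rw [_root_.map_mul, ← hz', AlgHom.commutes, Algebra.smul_def,
        IsScalarTower.algebraMap_apply k[X] C₀[X] K]
      rfl
    have h1 : IsIntegral C₀[X] (d • z) := hdz.tower_top
    rw [hd', isIntegral_algHom_iff φ φ.injective, IsIntegrallyClosed.isIntegral_iff] at h1
    obtain ⟨h, hh⟩ := h1
    exact ⟨h, by rw [hd', ← hh, AlgHom.commutes]⟩
  have hint : IsIntegral k[X] h := by
    rw [← isIntegral_algebraMap_iff hinj, hh]
    exact hdz
  have hcoeff : ∀ n, h.coeff n ∈ (algebraMap k C₀).range := fun n =>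
    mem_range_of_isAlgebraic (Polynomial.isIntegral_iff_isIntegral_coeff.mp hint n).isAlgebraic
  obtain ⟨h₀, rfl⟩ : ∃ h₀ : k[X], h₀.map (algebraMap k C₀) = h :=
    (Polynomial.lifts_iff_coeff_lifts h).mpr hcoeff
  refine (IntermediateField.mem_adjoin_simple_iff k z).mpr ⟨h₀, d, ?_⟩
  have h2 : aeval t d ≠ 0 := fun h0 => hd (hinjk (by rw [_root_.map_zero]; exact h0))
  rw [eq_div_iff h2, mul_comm]
  have h3 : aeval t d * z = d • z := (Algebra.smul_def d z).symm
  rw [h3, ← hh]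
  exact Polynomial.aeval_map_algebraMap C₀ t h₀

end

section

variable {k K : Type*} [Field k] [Field K] [Algebra k K]

variable (k) in
/-- The relative algebraic closure in `K` of the field generated over `k` by `s`. -/
def algClosureOf (s : Set K) : IntermediateField k K :=
  (algebraicClosure (IntermediateField.adjoin k s) K).restrictScalars k

lemma mem_algClosureOf {s : Set K} {a : K} :
    a ∈ algClosureOf k s ↔ IsAlgebraic (IntermediateField.adjoin k s) a := by
  rw [algClosureOf, IntermediateField.mem_restrictScalars, mem_algebraicClosure_iff]

lemma mem_matroid_closure {s : Set K} {a : K} :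
    a ∈ (AlgebraicIndependent.matroid k K).closure s ↔ a ∈ algClosureOf k s := by
  rw [AlgebraicIndependent.matroid_closure_eq, mem_algClosureOf, isAlgebraic_adjoin_iff]
  exact Iff.rfl

lemma adjoin_le_algClosureOf (s : Set K) : IntermediateField.adjoin k s ≤ algClosureOf k s :=
  fun a ha => mem_algClosureOf.mpr
    (isAlgebraic_algebraMap (⟨a, ha⟩ : IntermediateField.adjoin k s))

lemma subset_algClosureOf (s : Set K) : s ⊆ algClosureOf k s :=
  (IntermediateField.subset_adjoin k s).trans (adjoin_le_algClosureOf s)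

lemma algClosureOf_mono {s t : Set K} (h : s ⊆ t) : algClosureOf k s ≤ algClosureOf k t := by
  intro a ha
  rw [← mem_matroid_closure] at ha ⊢
  exact (AlgebraicIndependent.matroid k K).closure_subset_closure h ha

lemma algClosureOf_le {s t : Set K} (h : s ⊆ algClosureOf k t) :
    algClosureOf k s ≤ algClosureOf k t := by
  intro a ha
  rw [← mem_matroid_closure] at ha ⊢
  refine (AlgebraicIndependent.matroid k K).closure_subset_closure_of_subset_closure
    (fun b hb => ?_) ha
  rw [mem_matroid_closure]
  exact h hb

lemma mem_algClosureOf_insert {s : Set K} {e f : K} (he : e ∉ algClosureOf k s)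
    (hef : e ∈ algClosureOf k (insert f s)) : f ∈ algClosureOf k (insert e s) := by
  rw [← mem_matroid_closure] at he hef ⊢
  exact (AlgebraicIndependent.matroid k K).mem_closure_insert he hef

lemma relAlgClosed_algClosureOf (s : Set K) : RelAlgClosed (algClosureOf k s) := by
  intro a ha
  have h1 : IsAlgebraic (algebraicClosure (IntermediateField.adjoin k s) K) a := ha
  rw [mem_algClosureOf]
  exact IsAlgebraic.restrictScalars (IntermediateField.adjoin k s) h1

lemma _root_.RelAlgClosed.algClosureOf_le {L : IntermediateField k K} (hL : RelAlgClosed L)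
    {s : Set K} (hs : s ⊆ L) : algClosureOf k s ≤ L := by
  intro a ha
  rw [mem_algClosureOf] at ha
  refine hL a ?_
  have hle : IntermediateField.adjoin k s ≤ L := IntermediateField.adjoin_le_iff.mpr hs
  exact ha.ringHom_of_comp_eq (IntermediateField.inclusion hle : _ →+* L) (RingHom.id K)
    (IntermediateField.inclusion hle).injective rfl

/-- Distinct members of the pencil `x + c y` cannot acquire the same separable extension. -/
lemma finite_setOf_exists_isSeparable [IsAlgClosed k] (hK : IsFunctionField k K) {x y : K}
    (hy : y ∉ algClosureOf k ∅) (hx : x ∉ algClosureOf k {y}) :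
    {c : k | ∃ z : K, IsSeparable (IntermediateField.adjoin k {x + algebraMap k K c * y}) z ∧
      z ∉ IntermediateField.adjoin k {x + algebraMap k K c * y}}.Finite := by
  let M := AlgebraicIndependent.matroid k K
  have hxy : M.Indep {x, y} := by
    rw [Matroid.insert_indep_iff]
    refine ⟨?_, fun _ => ⟨Set.mem_univ x, fun h => hx (mem_matroid_closure.mp h)⟩⟩
    rw [← insert_empty_eq, Matroid.insert_indep_iff]
    exact ⟨M.empty_indep, fun _ => ⟨Set.mem_univ y, fun h => hy (mem_matroid_closure.mp h)⟩⟩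
  have hne : x ≠ y := by
    rintro rfl
    exact hx (subset_algClosureOf _ rfl)
  obtain ⟨B, hB, hxyB⟩ := hxy.exists_isBase_superset
  let M' := IntermediateField.adjoin k B
  have : Algebra.IsAlgebraic M' K := ⟨fun a => by
    rw [← mem_algClosureOf, ← mem_matroid_closure, hB.closure_eq]
    exact Set.mem_univ a⟩
  have : FiniteDimensional M' K := IsFunctionField.finiteDimensional hK M'
  have hfin : Finite (IntermediateField M' (separableClosure M' K)) :=
    Field.exists_primitive_element_iff_finite_intermediateField _ _ |>.mp
      ⟨inferInstance, Field.exists_primitive_element _ _⟩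
  by_contra hinf
  choose! z hzs hzn using fun c (hc : c ∈ {c : k | ∃ z : K,
    IsSeparable (IntermediateField.adjoin k {x + algebraMap k K c * y}) z ∧
      z ∉ IntermediateField.adjoin k {x + algebraMap k K c * y}}) => hc
  have hxB : x ∈ M' := IntermediateField.subset_adjoin k B (hxyB (by simp))
  have hyB : y ∈ M' := IntermediateField.subset_adjoin k B (hxyB (by simp))
  have hle : ∀ c : k, IntermediateField.adjoin k {x + algebraMap k K c * y} ≤ M' := by
    intro c
    rw [IntermediateField.adjoin_le_iff, Set.singleton_subset_iff]
    exact add_mem hxB (mul_mem (algebraMap_mem M' c) hyB)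
  have hzF : ∀ c ∈ {c : k | ∃ z : K,
      IsSeparable (IntermediateField.adjoin k {x + algebraMap k K c * y}) z ∧
      z ∉ IntermediateField.adjoin k {x + algebraMap k K c * y}},
      z c ∈ separableClosure M' K := by
    intro c hc
    rw [mem_separableClosure_iff]
    let : Algebra (IntermediateField.adjoin k {x + algebraMap k K c * y}) M' :=
      (IntermediateField.inclusion (hle c)).toRingHom.toAlgebra
    have : IsScalarTower (IntermediateField.adjoin k {x + algebraMap k K c * y}) M' K :=
      .of_algebraMap_eq' rfl
    exact (hzs c hc).tower_top M'
  have hinf' := Set.infinite_coe_iff.mpr hinf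
  obtain ⟨⟨c, hc⟩, ⟨c', hc'⟩, hcc, hadj⟩ := Finite.exists_ne_map_eq_of_infinite
    (fun c : {c : k | ∃ z : K,
      IsSeparable (IntermediateField.adjoin k {x + algebraMap k K c * y}) z ∧
      z ∉ IntermediateField.adjoin k {x + algebraMap k K c * y}} =>
      IntermediateField.adjoin M' {(⟨z c, hzF c c.2⟩ : separableClosure M' K)})
  replace hcc : c ≠ c' := fun h => hcc (Subtype.ext h)
  have hadj' : IntermediateField.adjoin M' {z c} = IntermediateField.adjoin M' {z c'} := by
    have := congrArg (IntermediateField.map (separableClosure M' K).val) hadj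
    simpa [IntermediateField.adjoin_map] using this
  set u := x + algebraMap k K c * y with hu
  set u' := x + algebraMap k K c' * y with hu'
  set R := B \ {x, y} with hR
  have hBR : B = insert x (insert y R) := by
    ext a
    have h1 := hxyB (show x ∈ {x, y} by simp)
    have h2 := hxyB (show y ∈ {x, y} by simp)
    simp only [hR, Set.mem_insert_iff, Set.mem_sdiff, Set.mem_singleton_iff]
    constructor
    · tauto
    · rintro (rfl | rfl | h)
      exacts [h1, h2, h.1]
  have hcc0 : algebraMap k K c - algebraMap k K c' ≠ 0 := fun h =>
    hcc ((algebraMap k K).injective (sub_eq_zero.mp h))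
  have hspan : ∀ L : IntermediateField k K, u ∈ L → u' ∈ L → x ∈ L ∧ y ∈ L := by
    intro L h1 h2
    have h3 : y ∈ L := by
      have : y = (u - u') / (algebraMap k K c - algebraMap k K c') := by
        rw [hu, hu']
        field_simp
        ring
      rw [this]
      exact div_mem (sub_mem h1 h2) (sub_mem (algebraMap_mem L c) (algebraMap_mem L c'))
    refine ⟨?_, h3⟩
    have : x = u - algebraMap k K c * y := by rw [hu]; ring
    rw [this]
    exact sub_mem h1 (mul_mem (algebraMap_mem L c) h3)
  let C₀ := IntermediateField.adjoin k (insert u (insert (z c) R))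
  have htr : Transcendental C₀ u' := by
    intro halg
    rw [← mem_algClosureOf] at halg
    have hle' : algClosureOf k (insert u (insert (z c) R)) ≤ algClosureOf k (insert u R) := by
      refine algClosureOf_le ?_
      rintro a (rfl | rfl | ha)
      · exact subset_algClosureOf _ (by simp)
      · refine algClosureOf_mono (s := {u}) (by simp) ?_
        rw [mem_algClosureOf]
        exact (hzs c hc).isIntegral.isAlgebraic
      · exact subset_algClosureOf _ (Set.mem_insert_of_mem _ ha)
    obtain ⟨hx1, hy1⟩ := hspan _ (subset_algClosureOf _ (Set.mem_insert _ _)) (hle' halg)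
    have hxn : x ∉ algClosureOf k (insert y R) := by
      have := hB.indep.notMem_closure_sdiff_of_mem (hxyB (show x ∈ {x, y} by simp))
      rw [mem_matroid_closure] at this
      refine fun h => this (algClosureOf_mono ?_ h)
      rintro a (rfl | ha)
      · exact ⟨hxyB (by simp), hne.symm⟩
      · exact ⟨ha.1, fun h => ha.2 (Or.inl h)⟩
    have hyn : y ∉ algClosureOf k R := by
      have := hB.indep.notMem_closure_sdiff_of_mem (hxyB (show y ∈ {x, y} by simp))
      rw [mem_matroid_closure] at this
      refine fun h => this (algClosureOf_mono ?_ h)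
      exact fun a ha => ⟨ha.1, fun h => ha.2 (Or.inr h)⟩
    have hu1 := mem_algClosureOf_insert hyn hy1
    refine hxn ?_
    have : x = u - algebraMap k K c * y := by rw [hu]; ring
    rw [this]
    exact sub_mem hu1 (mul_mem (algebraMap_mem _ c) (subset_algClosureOf _ (Set.mem_insert _ _)))
  refine hzn c' hc' (mem_adjoin_simple_of_isAlgebraic C₀ htr ?_ (hzs c' hc').isIntegral.isAlgebraic)
  have hle2 : (IntermediateField.adjoin M' {z c}).restrictScalars k ≤
      (IntermediateField.adjoin C₀ {u'}).restrictScalars k := by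
    rw [IntermediateField.adjoin_adjoin_left, IntermediateField.adjoin_adjoin_left,
      IntermediateField.adjoin_le_iff]
    have hsub := IntermediateField.subset_adjoin k (insert u (insert (z c) R) ∪ {u'})
    obtain ⟨hx1, hy1⟩ := hspan (IntermediateField.adjoin k (insert u (insert (z c) R) ∪ {u'}))
      (hsub (by simp)) (hsub (by simp))
    rw [hBR]
    rintro a ((rfl | rfl | ha) | rfl)
    · exact hx1
    · exact hy1
    · exact hsub (by simp [ha])
    · exact hsub (by simp)
  refine hle2 ?_
  rw [hadj']
  exact IntermediateField.mem_adjoin_simple_self M' (z c')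

end

section

variable {k K : Type*} [Field k] [Field K] [Algebra k K]

/-- The `p`-th powers of the elements of an intermediate field in characteristic `p`. -/
def pthPowers [IsAlgClosed k] (p : ℕ) [Fact p.Prime] [CharP K p] (L : IntermediateField k K) :
    IntermediateField k K where
  carrier := {a | ∃ b ∈ L, b ^ p = a}
  mul_mem' := by
    rintro _ _ ⟨b, hb, rfl⟩ ⟨c, hc, rfl⟩
    exact ⟨b * c, mul_mem hb hc, mul_pow b c p⟩
  add_mem' := by
    rintro _ _ ⟨b, hb, rfl⟩ ⟨c, hc, rfl⟩
    exact ⟨b + c, add_mem hb hc, map_add (frobenius K p) b c⟩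
  algebraMap_mem' c := by
    obtain ⟨b, hb⟩ := IsAlgClosed.exists_pow_nat_eq c (Fact.out : p.Prime).pos
    exact ⟨algebraMap k K b, algebraMap_mem L b, by rw [← _root_.map_pow, hb]⟩
  inv_mem' := by
    rintro _ ⟨b, hb, rfl⟩
    exact ⟨b⁻¹, inv_mem hb, inv_pow b p⟩

lemma mem_adjoin_simple_of_pow_mem [IsAlgClosed k] (p : ℕ) [Fact p.Prime] [CharP K p] {u w : K}
    (hu : ¬∃ y : K, y ^ p = u) (hw : w ^ p ∈ IntermediateField.adjoin k {u}) :
    w ∈ IntermediateField.adjoin k {u} := by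
  by_contra hwu
  have hp : p.Prime := Fact.out
  let E₁ := IntermediateField.adjoin k {u ^ p}
  have hu1 : u ^ p ∈ E₁ := IntermediateField.mem_adjoin_simple_self k _
  have hE₁ : E₁ ≤ pthPowers p (IntermediateField.adjoin k {u}) := by
    rw [IntermediateField.adjoin_le_iff, Set.singleton_subset_iff]
    exact ⟨u, IntermediateField.mem_adjoin_simple_self k u, rfl⟩
  have hwE₁ : w ^ p ∉ E₁ := by
    intro h
    obtain ⟨b, hb, hbw⟩ := hE₁ h
    rw [← frobenius_inj K p hbw] at hwu
    exact hwu hb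
  have huE₁ : u ∉ E₁ := fun h => by
    obtain ⟨b, hb, hbw⟩ := hE₁ h
    exact hu ⟨b, hbw⟩
  have hirr : Irreducible (X ^ p - C (⟨u ^ p, hu1⟩ : E₁)) := by
    rw [X_pow_sub_C_irreducible_iff_of_prime hp]
    intro b hb
    have : (b : K) ^ p = u ^ p := congrArg Subtype.val hb
    rw [← frobenius_inj K p this] at huE₁
    exact huE₁ b.2
  have hmin : minpoly E₁ u = X ^ p - C (⟨u ^ p, hu1⟩ : E₁) := by
    refine (minpoly.eq_of_irreducible_of_monic hirr ?_ (monic_X_pow_sub_C _ hp.ne_zero)).symm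
    simp [IntermediateField.algebraMap_apply]
  have hint : IsIntegral E₁ u := ⟨_, monic_X_pow_sub_C (⟨u ^ p, hu1⟩ : E₁) hp.ne_zero, by
    simp [IntermediateField.algebraMap_apply]⟩
  have hrank : Module.finrank E₁ (IntermediateField.adjoin E₁ {u}) = p := by
    rw [IntermediateField.adjoin.finrank hint, hmin, natDegree_X_pow_sub_C]
  have hle : IntermediateField.adjoin k {u} ≤ (IntermediateField.adjoin E₁ {u}).restrictScalars k := by
    rw [IntermediateField.adjoin_le_iff, Set.singleton_subset_iff]
    exact IntermediateField.mem_adjoin_simple_self E₁ u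
  have := IntermediateField.isSimpleOrder_of_finrank_prime E₁ (IntermediateField.adjoin E₁ {u})
    (hrank ▸ hp)
  let v : IntermediateField.adjoin E₁ {u} := ⟨w ^ p, hle hw⟩
  have hpow : (IntermediateField.adjoin E₁ {w ^ p}).restrictScalars k ≤ pthPowers p ⊤ := by
    rw [IntermediateField.adjoin_adjoin_left, IntermediateField.adjoin_le_iff]
    rintro a (rfl | rfl)
    · exact ⟨u, trivial, rfl⟩
    · exact ⟨w, trivial, rfl⟩
  rcases eq_bot_or_eq_top (IntermediateField.adjoin E₁ {v}) with h | h
  · rw [IntermediateField.adjoin_simple_eq_bot_iff, IntermediateField.mem_bot] at h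
    obtain ⟨b, hb⟩ := h
    refine hwE₁ ?_
    have : (b : K) = w ^ p := congrArg Subtype.val hb
    rw [← this]
    exact b.2
  · have h1 : (⟨u, IntermediateField.mem_adjoin_simple_self E₁ u⟩ : IntermediateField.adjoin E₁ {u}) ∈
        IntermediateField.adjoin E₁ {v} := h ▸ IntermediateField.mem_top
    have h2 : u ∈ IntermediateField.adjoin E₁ {w ^ p} := by
      have : u ∈ (IntermediateField.adjoin E₁ {v}).map (IntermediateField.adjoin E₁ {u}).val :=
        ⟨_, h1, rfl⟩
      rw [IntermediateField.adjoin_map, Set.image_singleton] at this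
      exact this
    obtain ⟨b, -, hb⟩ := hpow h2
    exact hu ⟨b, hb⟩

lemma relAlgClosed_of_isSeparable [IsAlgClosed k] {u : K} (hu : IsSeparableIn K u)
    (hsep : ∀ z : K, IsSeparable (IntermediateField.adjoin k {u}) z →
      z ∈ IntermediateField.adjoin k {u}) : RelAlgClosed (IntermediateField.adjoin k {u}) := by
  intro z hz
  obtain ⟨q, hq⟩ := ExpChar.exists K
  cases hq with
  | zero =>
    have : CharZero (IntermediateField.adjoin k {u}) := inferInstance
    exact hsep z (minpoly.irreducible hz.isIntegral).separable
  | prime hp =>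
    have : Fact q.Prime := ⟨hp⟩
    have : CharP (IntermediateField.adjoin k {u}) q := inferInstance
    have : ExpChar (IntermediateField.adjoin k {u}) q := .prime hp
    obtain ⟨g, hg, m, hm⟩ := (minpoly.irreducible hz.isIntegral).hasSeparableContraction q
    have hroot : aeval (z ^ q ^ m) g = 0 := by
      rw [← expand_aeval, hm, minpoly.aeval]
    have hmem := hsep _ (hg.of_dvd (minpoly.dvd _ _ hroot))
    clear hm hroot
    induction m with
    | zero => simpa using hmem
    | succ m ih =>
      rw [pow_succ, pow_mul] at hmem
      exact ih (mem_adjoin_simple_of_pow_mem q (hu q hp inferInstance) hmem)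

/-- A theorem of Bertini type: almost all members of a pencil are general elements. -/
theorem finite_setOf_not_isGeneralElement [IsAlgClosed k] (hK : IsFunctionField k K) {x y : K}
    (hy : y ∉ algClosureOf k ∅) (hx : x ∉ algClosureOf k {y}) (hys : IsSeparableIn K y) :
    {c : k | ¬IsGeneralElement k (x + algebraMap k K c * y)}.Finite := by
  have hsub : {c : k | ¬IsSeparableIn K (x + algebraMap k K c * y)}.Subsingleton := by
    intro c hc c' hc'
    by_contra hne
    simp only [IsSeparableIn, Set.mem_ofPred_eq, not_forall, not_not] at hc hc'
    obtain ⟨p, hp, hchar, h1⟩ := hc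
    obtain ⟨p', hp', hchar', h2⟩ := hc'
    obtain rfl := CharP.eq K hchar hchar'
    have : Fact p.Prime := ⟨hp⟩
    have h3 : x + algebraMap k K c * y ∈ pthPowers p (⊤ : IntermediateField k K) :=
      h1.imp fun b hb => ⟨trivial, hb⟩
    have h4 : x + algebraMap k K c' * y ∈ pthPowers p (⊤ : IntermediateField k K) :=
      h2.imp fun b hb => ⟨trivial, hb⟩
    have hcc0 : algebraMap k K c - algebraMap k K c' ≠ 0 := fun h =>
      hne ((algebraMap k K).injective (sub_eq_zero.mp h))
    have h5 : y = ((x + algebraMap k K c * y) - (x + algebraMap k K c' * y)) /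
        (algebraMap k K c - algebraMap k K c') := by
      field_simp
      ring
    have h6 : y ∈ pthPowers p (⊤ : IntermediateField k K) := by
      rw [h5]
      exact div_mem (sub_mem h3 h4) (sub_mem (algebraMap_mem _ c) (algebraMap_mem _ c'))
    obtain ⟨b, -, hb⟩ := h6
    exact hys p hp hchar ⟨b, hb⟩
  refine ((finite_setOf_exists_isSeparable hK hy hx).union hsub.finite).subset fun c hc => ?_
  by_contra hcon
  simp only [Set.mem_union, Set.mem_ofPred_eq, not_or, not_exists, not_and, not_not] at hcon
  refine hc ⟨fun h => hx ?_, relAlgClosed_of_isSeparable hcon.2 hcon.1⟩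
  have h1 : x = (x + algebraMap k K c * y) - algebraMap k K c * y := by ring
  rw [h1]
  exact sub_mem ((bot_le : (⊥ : IntermediateField k K) ≤ _) h)
    (mul_mem (algebraMap_mem _ c) (subset_algClosureOf _ rfl))

end

section

variable {ℓ : ℕ} {k K : Type*} [Field k] [Field K] [Algebra k K]

lemma milnorSymbol_congr {n : ℕ} {a b : Fin n → Kˣ} (h : ∀ i, K1proj ℓ K (a i) = K1proj ℓ K (b i)) :
    milnorSymbol ℓ a = milnorSymbol ℓ b := by
  have hsy : (fun i => sy ℓ (a i)) = fun i => sy ℓ (b i) := by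
    funext i
    obtain ⟨c, hc⟩ := QuotientGroup.eq.mp (h i)
    have : b i = a i * c ^ ℓ := by
      rw [← powMonoidHom_apply, hc, mul_inv_cancel_left]
    rw [this, sy_mul, sy_pow_self, add_zero]
  rw [← act_prod ℓ a, ← act_prod ℓ b, hsy]

lemma omega_mono {L L' : IntermediateField k K} (h : L ≤ L') : Omega ℓ L ≤ Omega ℓ L' :=
  Subgroup.map_mono fun _ ha => h ha

lemma k1proj_mem_omega {L : IntermediateField k K} {a : Kˣ} (ha : (a : K) ∈ L) :
    K1proj ℓ K a ∈ Omega ℓ L :=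
  ⟨a, ha, rfl⟩

lemma k1proj_eq_one [IsAlgClosed k] (hℓ : 0 < ℓ) {a : Kˣ} (ha : (a : K) ∈ (⊥ : IntermediateField k K)) :
    K1proj ℓ K a = 1 := by
  obtain ⟨c, hc⟩ := IntermediateField.mem_bot.mp ha
  obtain ⟨b, hb⟩ := IsAlgClosed.exists_pow_nat_eq c hℓ
  have hb0 : algebraMap k K b ≠ 0 := by
    intro h0
    refine a.ne_zero ?_
    rw [← hc, ← hb, _root_.map_pow, h0, zero_pow hℓ.ne']
  refine (QuotientGroup.eq_one_iff a).mpr ⟨Units.mk0 _ hb0, Units.ext ?_⟩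
  rw [← hc, ← hb, _root_.map_pow]
  rfl

/-- The dimension of `Ω(L)` is at most the transcendence degree of `L`. -/
lemma exists_algebraicIndependent_of_dimMge [IsAlgClosed k] (hℓ : 0 < ℓ) {L : IntermediateField k K}
    {n : ℕ} (h : dimMge ℓ (Omega ℓ L : Set (K1 ℓ K)) n) :
    ∃ x : Fin n → K, (∀ i, x i ∈ L) ∧ AlgebraicIndependent k x := by
  obtain ⟨a, ha, hne⟩ := h
  choose b hbL hb using ha
  refine ⟨fun i => b i, hbL, ?_⟩
  by_contra hind
  refine hne ?_
  rw [← milnorSymbol_eq_zero_of_not_algebraicIndependent hℓ b hind]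
  exact milnorSymbol_congr fun i => (hb i).symm

lemma dimMge_of_algebraicIndependent (hℓ : ℓ.Prime) [Infinite k] (hchar : ringChar k ≠ ℓ)
    (hK : IsFunctionField k K) {n : ℕ} {x : Fin n → K} (hx : AlgebraicIndependent k x)
    {S : Set (K1 ℓ K)}
    (hS : ∀ i, (Omega ℓ (IntermediateField.adjoin k {x i}) : Set (K1 ℓ K)) ⊆ S) :
    dimMge ℓ S n := by
  obtain ⟨c, a, ha, hne⟩ := exists_milnorSymbol_ne_zero hℓ hchar hK x hx
  refine ⟨a, fun i => hS i (k1proj_mem_omega ?_), hne⟩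
  rw [ha]
  exact sub_mem (IntermediateField.mem_adjoin_simple_self k _) (algebraMap_mem _ _)

lemma algebraicIndependent_comp_val {L : IntermediateField k K} {ι : Type*} {x : ι → L} :
    AlgebraicIndependent k (fun i => (x i : K)) ↔ AlgebraicIndependent k x :=
  AlgHom.algebraicIndependent_iff L.val Subtype.val_injective

lemma _root_.HasTrdeg.card_le {L : IntermediateField k K} {r n : ℕ} (hL : HasTrdeg k L r)
    {x : Fin n → K} (hx : AlgebraicIndependent k x) (hxL : ∀ i, x i ∈ L) : n ≤ r := by
  obtain ⟨y, hy⟩ := hL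
  have h1 : AlgebraicIndependent k fun i => (⟨x i, hxL i⟩ : L) :=
    algebraicIndependent_comp_val.mp hx
  have h2 := h1.lift_cardinalMk_le_trdeg
  rw [← hy.lift_cardinalMk_eq_trdeg] at h2
  simpa using h2

lemma _root_.HasTrdeg.exists_algebraicIndependent {L : IntermediateField k K} {r : ℕ}
    (hL : HasTrdeg k L r) : ∃ x : Fin r → K, (∀ i, x i ∈ L) ∧ AlgebraicIndependent k x := by
  obtain ⟨y, hy⟩ := hL
  exact ⟨fun i => y i, fun i => (y i).2, algebraicIndependent_comp_val.mpr hy.1⟩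

lemma hasTrdeg_of_le_algClosureOf {L : IntermediateField k K} {r : ℕ} {x : Fin r → K}
    (hx : AlgebraicIndependent k x) (hxL : ∀ i, x i ∈ L) (hL : L ≤ algClosureOf k (Set.range x)) :
    HasTrdeg k L r := by
  let y : Fin r → L := fun i => ⟨x i, hxL i⟩
  have hy : AlgebraicIndependent k y := algebraicIndependent_comp_val.mp hx
  refine ⟨y, hy.isTranscendenceBasis_iff_isAlgebraic.mpr ⟨fun a => ?_⟩⟩
  have h1 := mem_algClosureOf.mp (hL a.2)
  have h2 : Set.range x = L.val '' Set.range y := by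
    rw [← Set.range_comp]
    rfl
  rw [h2, ← IntermediateField.adjoin_map] at h1
  rw [← isAlgebraic_adjoin_iff]
  exact h1.of_ringHom_of_comp_eq
    ((IntermediateField.adjoin k (Set.range y)).equivMap L.val : _ →+* _)
    (L.val : L →+* K) (AlgEquiv.surjective _) L.val.injective rfl

/-- A relatively algebraically closed subfield generated by a set whose finite independent
subsets have bounded size has finite transcendence degree. -/
lemma exists_algebraicIndependent_le_algClosureOf (T : Set K) (r : ℕ)
    (hT : ∀ x : Fin (r + 1) → K, (∀ i, x i ∈ T) → ¬AlgebraicIndependent k x) :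
    ∃ d ≤ r, ∃ x : Fin d → K, (∀ i, x i ∈ T) ∧ AlgebraicIndependent k x ∧
      algClosureOf k T ≤ algClosureOf k (Set.range x) := by
  classical
  have h0 : ∃ x : Fin 0 → K, (∀ i, x i ∈ T) ∧ AlgebraicIndependent k x :=
    ⟨Fin.elim0, fun i => i.elim0, algebraicIndependent_empty_type_iff.mpr (algebraMap k K).injective⟩
  have hex : ∃ d, ¬∃ x : Fin (d + 1) → K, (∀ i, x i ∈ T) ∧ AlgebraicIndependent k x :=
    ⟨r, fun ⟨x, h1, h2⟩ => hT x h1 h2⟩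
  refine ⟨Nat.find hex, Nat.find_le fun ⟨x, h1, h2⟩ => hT x h1 h2, ?_⟩
  obtain ⟨x, hxT, hx⟩ : ∃ x : Fin (Nat.find hex) → K, (∀ i, x i ∈ T) ∧ AlgebraicIndependent k x := by
    rcases h : Nat.find hex with _ | d
    · exact h0
    · exact not_not.mp (Nat.find_min hex (h ▸ Nat.lt_succ_self d))
  refine ⟨x, hxT, hx, algClosureOf_le fun t ht => ?_⟩
  by_contra hcon
  rw [SetLike.mem_coe, mem_algClosureOf] at hcon
  exact Nat.find_spec hex ⟨Fin.cons t x, fun i => Fin.cases ht hxT i,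
    (algebraicIndependent_cons_iff hx).mpr hcon⟩

end

section

variable {ℓ : ℕ} {k K : Type*} [Field k] [Field K] [Algebra k K]

lemma mem_bot_of_mem_algClosureOf_empty [IsAlgClosed k] {u : K} (hu : u ∈ algClosureOf k ∅) :
    u ∈ (⊥ : IntermediateField k K) := by
  rw [mem_algClosureOf, isAlgebraic_adjoin_iff, Algebra.adjoin_empty] at hu
  refine IntermediateField.mem_bot.mpr (mem_range_of_isAlgebraic ?_)
  exact hu.of_ringHom_of_comp_eq (algebraMap k (⊥ : Subalgebra k K)) (RingHom.id K)
    (fun a => by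
      obtain ⟨c, hc⟩ := Algebra.mem_bot.mp a.2
      exact ⟨c, Subtype.ext hc⟩) Function.injective_id rfl

/-- In a function field a transcendental element is only finitely often a `p`-th power. -/
lemma exists_isSeparableIn_pow [IsAlgClosed k] (hK : IsFunctionField k K) {u : K}
    (hu : u ∉ (⊥ : IntermediateField k K)) : ∃ (v : K) (n : ℕ), v ^ n = u ∧ 0 < n ∧ IsSeparableIn K v := by
  classical
  by_cases hp : ∃ p : ℕ, p.Prime ∧ CharP K p
  swap
  · exact ⟨u, 1, pow_one u, one_pos, fun p h1 h2 => absurd ⟨p, h1, h2⟩ hp⟩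
  obtain ⟨p, hp, hchar⟩ := hp
  have : Fact p.Prime := ⟨hp⟩
  have : CharP k p := (algebraMap k K).charP (algebraMap k K).injective p
  have : ExpChar k p := .prime hp
  have : Infinite k := IsAlgClosed.instInfinite
  have hind : AlgebraicIndependent k (fun _ : Fin 1 => u) := by
    rw [algebraicIndependent_unique_type_iff]
    exact fun h => hu (IntermediateField.mem_bot.mpr (mem_range_of_isAlgebraic h))
  obtain ⟨c, w, N, hw, hwu⟩ := exists_weight_of_algebraicIndependent hK _ hind
  rw [ringExpChar.eq k p] at hwu
  have hex : ∃ m, ¬∃ y : K, y ^ p ^ m = u := by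
    refine ⟨N + 1, fun ⟨y, hy⟩ => ?_⟩
    obtain ⟨e, he⟩ := IsAlgClosed.exists_pow_nat_eq (c 0) (pow_pos hp.pos (N + 1))
    have h1 : (y - algebraMap k K e) ^ p ^ (N + 1) = u - algebraMap k K (c 0) := by
      rw [sub_pow_char_pow, hy, ← _root_.map_pow, he]
    have h2 : u - algebraMap k K (c 0) ≠ 0 := fun h =>
      hu (IntermediateField.mem_bot.mpr ⟨c 0, (sub_eq_zero.mp h).symm⟩)
    have h3 : y - algebraMap k K e ≠ 0 := by
      intro h0
      rw [h0, zero_pow (pow_pos hp.pos _).ne'] at h1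
      exact h2 h1.symm
    have h4 := hwu 0 (Units.mk0 _ h3 ^ p ^ (N + 1)) (by simpa using h1)
    rw [hw.pow] at h4
    have h5 := congrFun h4 0
    simp only [Pi.smul_apply, Pi.single_eq_same, nsmul_eq_mul, mul_one, Nat.cast_pow] at h5
    rw [pow_succ, mul_assoc] at h5
    have h6 : (p : ℤ) * w (Units.mk0 _ h3) 0 = 1 := by
      refine mul_left_cancel₀ (pow_ne_zero N (Nat.cast_ne_zero.mpr hp.ne_zero)) ?_
      rw [h5, mul_one]
    have h7 := Int.isUnit_iff_natAbs_eq.mp (IsUnit.of_mul_eq_one _ h6)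
    exact hp.one_lt.ne' (by simpa using h7)
  obtain ⟨m, hm⟩ : ∃ m, Nat.find hex = m + 1 := Nat.exists_eq_succ_of_ne_zero fun h0 =>
    Nat.find_spec hex (h0 ▸ ⟨u, by simp⟩)
  obtain ⟨v, hv⟩ := not_not.mp (Nat.find_min hex (m := m) (by omega))
  refine ⟨v, p ^ m, hv, pow_pos hp.pos m, fun p' hp' hchar' => ?_⟩
  obtain rfl := CharP.eq K hchar hchar'
  rintro ⟨y, rfl⟩
  refine Nat.find_spec hex ⟨y, ?_⟩
  rw [hm, pow_succ', pow_mul, hv]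

/-- If `L` is relatively algebraically closed of transcendence degree at least two, then `Ω(L)` is
generated by the rational subgroups of the general elements in `L`. -/
theorem omega_le_of_isGeneralElement [IsAlgClosed k] (hℓ : 0 < ℓ) (hK : IsFunctionField k K)
    {L : IntermediateField k K} (hL : RelAlgClosed L) (x : Fin 2 → K)
    (hx : AlgebraicIndependent k x) (hxL : ∀ i, x i ∈ L) (G : Subgroup (K1 ℓ K))
    (hG : ∀ t ∈ L, IsGeneralElement k t → Omega ℓ (IntermediateField.adjoin k {t}) ≤ G) :
    Omega ℓ L ≤ G := by
  have : Infinite k := IsAlgClosed.instInfinite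
  rintro _ ⟨u, huL, rfl⟩
  change (u : K) ∈ L at huL
  by_cases hu : (u : K) ∈ (⊥ : IntermediateField k K)
  · rw [k1proj_eq_one hℓ hu]
    exact G.one_mem
  obtain ⟨v, n, hvu, hn, hv⟩ := exists_isSeparableIn_pow hK hu
  have hvL : v ∈ L := by
    refine hL v (IsAlgebraic.of_pow hn ?_)
    rw [hvu]
    exact isAlgebraic_algebraMap (⟨u, huL⟩ : L)
  have hv0 : v ≠ 0 := by
    rintro rfl
    rw [zero_pow hn.ne'] at hvu
    exact u.ne_zero hvu.symm
  have huv : u = Units.mk0 v hv0 ^ n := Units.ext hvu.symm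
  rw [huv, _root_.map_pow]
  refine G.pow_mem ?_ n
  have hvb : v ∉ algClosureOf k ∅ := by
    intro h
    refine hu ?_
    rw [← hvu]
    exact pow_mem (mem_bot_of_mem_algClosureOf_empty h) n
  obtain ⟨y₀, hy₀L, hy₀⟩ : ∃ y ∈ L, y ∉ algClosureOf k {v} := by
    by_contra! hcon
    have h2 : x 1 ∉ algClosureOf k ∅ := fun h => by
      obtain ⟨c, hc⟩ := IntermediateField.mem_bot.mp (mem_bot_of_mem_algClosureOf_empty h)
      refine hx.transcendental 1 ?_
      rw [← hc]
      exact isAlgebraic_algebraMap c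
    have h3 : v ∈ algClosureOf k {x 1} := by
      have h1 := hcon _ (hxL 1)
      rw [← insert_empty_eq] at h1 ⊢
      exact mem_algClosureOf_insert h2 h1
    have h4 : x 0 ∈ algClosureOf k {x 1} :=
      algClosureOf_le (Set.singleton_subset_iff.mpr h3) (hcon _ (hxL 0))
    have h5 : AlgebraicIndependent k fun i : Fin 1 => x i.succ :=
      hx.comp Fin.succ (Fin.succ_injective 1)
    have h6 : AlgebraicIndependent k (Fin.cons (x 0) fun i : Fin 1 => x i.succ : Fin 2 → K) := by
      convert hx using 1
      exact Fin.cons_self_tail x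
    refine (algebraicIndependent_cons_iff h5).mp h6 ?_
    rw [Set.range_unique]
    exact mem_algClosureOf.mp h4
  have hgen : ∀ y ∉ algClosureOf k {v}, {c : k | IsGeneralElement k (y + algebraMap k K c * v)}.Infinite := by
    intro y hy
    have := (finite_setOf_not_isGeneralElement hK hvb hy hv).infinite_compl
    simpa [Set.compl_ofPred] using this
  obtain ⟨c, hc⟩ := (hgen y₀ hy₀).nonempty
  set y := y₀ + algebraMap k K c * v with hydef
  have hyL : y ∈ L := add_mem hy₀L (mul_mem (algebraMap_mem L c) hvL)
  have hvv : v ∈ algClosureOf k {v} := subset_algClosureOf _ rfl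
  have hy : y ∉ algClosureOf k {v} := by
    intro h
    refine hy₀ ?_
    have : y₀ = y - algebraMap k K c * v := by rw [hydef]; ring
    rw [this]
    exact sub_mem h (mul_mem (algebraMap_mem _ c) hvv)
  have hvy : v * y ∉ algClosureOf k {v} := by
    intro h
    refine hy ?_
    have : y = (v * y) / v := by field_simp
    rw [this]
    exact div_mem h hvv
  obtain ⟨d, hd⟩ := (hgen _ hvy).nonempty
  have hyd : y + algebraMap k K d ≠ 0 := by
    intro h
    refine hy ?_
    rw [eq_neg_of_add_eq_zero_left h]
    exact neg_mem (algebraMap_mem _ d)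
  have hprod : v * y + algebraMap k K d * v = v * (y + algebraMap k K d) := by ring
  have h1 : K1proj ℓ K (Units.mk0 v hv0 * Units.mk0 _ hyd) ∈ G := by
    refine hG _ (add_mem (mul_mem hvL hyL) (mul_mem (algebraMap_mem L d) hvL)) hd
      (k1proj_mem_omega ?_)
    rw [Units.val_mul, Units.val_mk0, Units.val_mk0, ← hprod]
    exact IntermediateField.mem_adjoin_simple_self k _
  have h2 : K1proj ℓ K (Units.mk0 _ hyd) ∈ G := by
    refine hG _ hyL hc (k1proj_mem_omega ?_)
    exact add_mem (IntermediateField.mem_adjoin_simple_self k _) (algebraMap_mem _ d)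
  rw [_root_.map_mul] at h1
  exact (Subgroup.mul_mem_cancel_right G h2).mp h1

end

section

variable {ℓ : ℕ} {k K : Type*} [Field k] [Field K] [Algebra k K] [IsAlgClosed k]

lemma dimMge_mono {S T : Set (K1 ℓ K)} (h : S ⊆ T) {n : ℕ} (hS : dimMge ℓ S n) : dimMge ℓ T n :=
  let ⟨a, ha, hne⟩ := hS
  ⟨a, fun i => h (ha i), hne⟩

lemma adjoin_simple_le {L : IntermediateField k K} {t : K} (ht : t ∈ L) :
    IntermediateField.adjoin k {t} ≤ L := by
  rwa [IntermediateField.adjoin_le_iff, Set.singleton_subset_iff]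

lemma spannedByRatWithDim_omega (hℓ : ℓ.Prime) (hchar : ringChar k ≠ ℓ) (hK : IsFunctionField k K)
    {r : ℕ} (hr : 2 ≤ r) {L : IntermediateField k K} (hL : RelAlgClosed L) (hLr : HasTrdeg k L r) :
    SpannedByRatWithDim ℓ k r (Omega ℓ L) := by
  have : Infinite k := IsAlgClosed.instInfinite
  obtain ⟨x, hxL, hx⟩ := hLr.exists_algebraicIndependent
  refine ⟨⟨{T | ∃ t ∈ L, IsGeneralElement k t ∧ T = Omega ℓ (IntermediateField.adjoin k {t})},
    ?_, ?_⟩, ?_, ?_⟩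
  · rintro T ⟨t, -, ht, rfl⟩
    exact ⟨t, ht, rfl⟩
  · refine le_antisymm ?_ (sSup_le ?_)
    · exact omega_le_of_isGeneralElement hℓ.pos hK hL _ (hx.comp _ (Fin.castLE_injective hr))
        (fun i => hxL _) _ fun t htL ht => le_sSup ⟨t, htL, ht, rfl⟩
    · rintro T ⟨t, htL, -, rfl⟩
      exact omega_mono (adjoin_simple_le htL)
  · exact dimMge_of_algebraicIndependent hℓ hchar hK hx fun i => omega_mono (adjoin_simple_le (hxL i))
  · intro h
    obtain ⟨y, hyL, hy⟩ := exists_algebraicIndependent_of_dimMge hℓ.pos h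
    have := hLr.card_le hy hyL
    omega

lemma le_omega_of_spannedByRatWithDim (hℓ : ℓ.Prime) (hchar : ringChar k ≠ ℓ)
    (hK : IsFunctionField k K) {r : ℕ} {L : IntermediateField k K} (hL : RelAlgClosed L)
    (hLr : HasTrdeg k L r) {B : Subgroup (K1 ℓ K)} (hLB : Omega ℓ L ≤ B)
    (hB : SpannedByRatWithDim ℓ k r B) : B ≤ Omega ℓ L := by
  have : Infinite k := IsAlgClosed.instInfinite
  obtain ⟨x, hxL, hx⟩ := hLr.exists_algebraicIndependent
  obtain ⟨⟨S, hS, rfl⟩, -, hdim⟩ := hB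
  refine sSup_le fun T hT => ?_
  obtain ⟨t, ht, rfl⟩ := hS T hT
  refine omega_mono (adjoin_simple_le ?_)
  by_contra htL
  have hind : AlgebraicIndependent k (Fin.cons t x : Fin (r + 1) → K) := by
    rw [algebraicIndependent_cons_iff hx]
    intro halg
    rw [← mem_algClosureOf] at halg
    refine htL (hL.algClosureOf_le ?_ halg)
    rintro _ ⟨i, rfl⟩
    exact hxL i
  refine hdim (dimMge_of_algebraicIndependent hℓ hchar hK hind fun i => ?_)
  refine Fin.cases ?_ (fun j => ?_) i
  · exact le_sSup hT
  · exact (omega_mono (adjoin_simple_le (hxL j))).trans hLB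

lemma exists_le_omega_of_spannedByRatWithDim (hℓ : ℓ.Prime) (hchar : ringChar k ≠ ℓ)
    (hK : IsFunctionField k K) {r : ℕ} {A : Subgroup (K1 ℓ K)}
    (hA : SpannedByRatWithDim ℓ k r A) :
    ∃ L : IntermediateField k K, RelAlgClosed L ∧ HasTrdeg k L r ∧ A ≤ Omega ℓ L := by
  have : Infinite k := IsAlgClosed.instInfinite
  obtain ⟨⟨S, hS, rfl⟩, hge, hnge⟩ := hA
  let T : Set K := {t | Omega ℓ (IntermediateField.adjoin k {t}) ∈ S}
  have hT : ∀ {n : ℕ} (x : Fin n → K), (∀ i, x i ∈ T) → AlgebraicIndependent k x →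
      dimMge ℓ (sSup S : Subgroup (K1 ℓ K)) n := fun x hxT hx =>
    dimMge_of_algebraicIndependent hℓ hchar hK hx fun i =>
      (le_sSup (hxT i) : Omega ℓ (IntermediateField.adjoin k {x i}) ≤ sSup S)
  obtain ⟨d, hdr, x, hxT, hx, hle⟩ := exists_algebraicIndependent_le_algClosureOf (k := k) T r
    fun x hxT hx => hnge (hT x hxT hx)
  have hLd : HasTrdeg k (algClosureOf k T) d :=
    hasTrdeg_of_le_algClosureOf hx (fun i => subset_algClosureOf T (hxT i)) hle
  have hA : sSup S ≤ Omega ℓ (algClosureOf k T) := by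
    refine sSup_le fun U hU => ?_
    obtain ⟨t, -, rfl⟩ := hS U hU
    exact omega_mono (adjoin_simple_le (subset_algClosureOf T hU))
  obtain ⟨y, hyL, hy⟩ := exists_algebraicIndependent_of_dimMge hℓ.pos (dimMge_mono hA hge)
  obtain rfl : d = r := le_antisymm hdr (hLd.card_le hy hyL)
  exact ⟨algClosureOf k T, relAlgClosed_algClosureOf T, hLd, hA⟩

end

end MilnorRing

theorem statement_6 (ℓ : ℕ) (hℓ : ℓ.Prime) (k K : Type*) [Field k] [Field K] [Algebra k K]
    [IsAlgClosed k] (hchar : ringChar k ≠ ℓ) (hK : IsFunctionField k K)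
    (htr : TrdegGe k K 2) (r : ℕ) (hr : 2 ≤ r) (A : Subgroup (K1 ℓ K)) :
    A ∈ GSet ℓ k r ↔
      (SpannedByRatWithDim ℓ k r A ∧
        ∀ B : Subgroup (K1 ℓ K), A ≤ B → SpannedByRatWithDim ℓ k r B → B = A) := by
  constructor
  · rintro ⟨L, hL, hLr, rfl⟩
    exact ⟨MilnorRing.spannedByRatWithDim_omega hℓ hchar hK hr hL hLr, fun B hLB hB =>
      le_antisymm (MilnorRing.le_omega_of_spannedByRatWithDim hℓ hchar hK hL hLr hLB hB) hLB⟩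
  · rintro ⟨hA, hmax⟩
    obtain ⟨L, hL, hLr, hAL⟩ :=
      MilnorRing.exists_le_omega_of_spannedByRatWithDim hℓ hchar hK hA
    exact ⟨L, hL, hLr, (hmax _ hAL
      (MilnorRing.spannedByRatWithDim_omega hℓ hchar hK hr hL hLr)).symm⟩

end
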